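/- Let p be a prime, d ≥ 1 an integer, D an elementary abelian group of order p^d, and E a group of automorphisms of D whose action on D ∖ {1} is regular (transitive with trivial point stabilizers). Then one of the following holds: (i) there is a factorization d = nk such that every prime divisor of n divides p^k − 1, and 4 divides p^k − 1 whenever 4 divides n, and the number of conjugacy classes of E equals ∑_{e | n} ((p^{ek} − 1)/(ne)) · J_2(n/e); in this case k(E) = p^d − 1 if n = 1, and k(E) > (p^k − 1)·φ(n) + (p^d − 1)/n² if n > 1; or (ii) the pair (p^d, k(E)) is one of (5², 7), (7², 8), (11², 9), (11², 35), (23², 88), (29², 63), (59², 261). -/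

import Mathlib

/-- Jordan's totient function `J₂(n) = n² ∏_{ℓ ∣ n, ℓ prime} (1 - 1/ℓ²)`. -/
def J2 (n : ℕ) : ℚ :=
  (n : ℚ) ^ 2 * ∏ ℓ ∈ n.primeFactors, (1 - 1 / (ℓ : ℚ) ^ 2)


/-- fixed-point-free representation -/
structure FPF {G K V : Type*} [Group G] [Field K] [AddCommGroup V] [Module K V]
    (ρ : G →* Module.End K V) : Prop where
  fpf : ∀ g : G, g ≠ 1 → ∀ v : V, ρ g v = v → v = 0
  ne : (Nat.card G : K) ≠ 0

/-- the group-theoretic consequences of having a fixed-point-free representation -/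
structure FC (G : Type*) [Group G] : Prop where
  cyc : ∀ A : Subgroup G, (∀ x ∈ A, ∀ y ∈ A, x * y = y * x) → IsCyclic A
  inv : ∀ x y : G, x ≠ 1 → y ≠ 1 → x ^ 2 = 1 → y ^ 2 = 1 → x = y
  pq : ∀ g e : G, (orderOf g).Prime → g * e * g⁻¹ ∈ Subgroup.zpowers e → g * e = e * g

lemma FC.subgroup {G : Type*} [Group G] (h : FC G) (H : Subgroup G) : FC H where
  cyc A hA := by
    have := h.cyc (A.map H.subtype) (by
      rintro _ ⟨x, hx, rfl⟩ _ ⟨y, hy, rfl⟩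
      rw [← map_mul, hA x hx y hy, map_mul])
    exact isCyclic_of_injective (A.equivMapOfInjective H.subtype H.subtype_injective).toMonoidHom
      (A.equivMapOfInjective H.subtype H.subtype_injective).injective
  inv x y hx hy hx2 hy2 := by
    apply Subtype.ext
    apply h.inv x y
    · simpa using hx
    · simpa using hy
    · rw [← Subgroup.coe_pow, hx2]; rfl
    · rw [← Subgroup.coe_pow, hy2]; rfl
  pq g e hg he := by
    apply Subtype.ext
    apply h.pq g e
    · rwa [Subgroup.orderOf_coe]
    · obtain ⟨k, hk⟩ := he
      refine ⟨k, ?_⟩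
      have := congrArg (Subtype.val) hk
      simpa using this

section
variable {G K V : Type*} [Group G] [Field K] [AddCommGroup V] [Module K V]
  {ρ : G →* Module.End K V}

lemma FPF.subgroup [Finite G] (h : FPF ρ) (H : Subgroup G) : FPF (ρ.comp H.subtype) where
  fpf g hg v hv := h.fpf g (by simpa using hg) v hv
  ne := by
    intro h0
    apply h.ne
    obtain ⟨c, hc⟩ := H.card_subgroup_dvd_card
    rw [hc]; push_cast; rw [h0, zero_mul]

/-- common eigenvectors of commuting families -/
lemma exists_common_eigenvector [IsAlgClosed K] [FiniteDimensional K V] [Nontrivial V]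
    (S : Set (Module.End K V)) (hS : ∀ f ∈ S, ∀ g ∈ S, f * g = g * f) :
    ∃ v : V, v ≠ 0 ∧ ∀ f ∈ S, ∃ μ : K, f v = μ • v := by
  classical
  let P : Submodule K V → Prop := fun W => W ≠ ⊥ ∧ ∀ f ∈ S, W ≤ W.comap f
  have hP : P ⊤ := ⟨top_ne_bot, fun f _ => by simp⟩
  have hwf : WellFounded ((· < ·) : Submodule K V → Submodule K V → Prop) := wellFounded_lt
  obtain ⟨W, hW, hmin⟩ := hwf.has_min {W | P W} ⟨⊤, hP⟩
  obtain ⟨hW0, hWS⟩ := hW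
  have : Nontrivial W := Submodule.nontrivial_iff_ne_bot.mpr hW0
  have key : ∀ f ∈ S, ∃ μ : K, ∀ w ∈ W, f w = μ • w := by
    intro f hf
    obtain ⟨μ, hμ⟩ := Module.End.exists_eigenvalue (f.restrict (hWS f hf) : Module.End K W)
    obtain ⟨w, hw⟩ := hμ.exists_hasEigenvector
    refine ⟨μ, ?_⟩
    have hle : W ⊓ Module.End.eigenspace f μ ≤ W := inf_le_left
    have hPW : P (W ⊓ Module.End.eigenspace f μ) := by
      refine ⟨?_, ?_⟩
      · intro h0
        have h1 : (w : V) ∈ W ⊓ Module.End.eigenspace f μ := by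
          refine ⟨w.2, ?_⟩
          rw [SetLike.mem_coe, Module.End.mem_eigenspace_iff]
          have := hw.apply_eq_smul
          exact congrArg Subtype.val this
        rw [h0] at h1
        apply hw.2
        exact Subtype.ext (by simpa using h1)
      · intro g hg x hx
        refine ⟨hWS g hg hx.1, ?_⟩
        have hx2 := hx.2
        rw [SetLike.mem_coe, Module.End.mem_eigenspace_iff] at hx2 ⊢
        have := LinearMap.congr_fun (hS f hf g hg) x
        simp only [Module.End.mul_apply] at this
        rw [this, hx2, map_smul]
    have heq : W ⊓ Module.End.eigenspace f μ = W := by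
      by_contra hne
      exact hmin _ hPW (lt_of_le_of_ne hle hne)
    intro x hx
    rw [← heq] at hx
    exact Module.End.mem_eigenspace_iff.mp hx.2
  obtain ⟨w, hw, hw0⟩ := W.exists_mem_ne_zero_of_ne_bot hW0
  exact ⟨w, hw0, fun f hf => (key f hf).imp fun μ h => h w hw⟩

lemma FPF.exists_char [IsAlgClosed K] [FiniteDimensional K V] [Nontrivial V] (h : FPF ρ)
    (A : Subgroup G) (hA : ∀ x ∈ A, ∀ y ∈ A, x * y = y * x) :
    ∃ v : V, v ≠ 0 ∧ ∃ χ : A →* K, Function.Injective χ ∧ ∀ a : A, ρ a v = χ a • v := by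
  obtain ⟨v, hv, hS⟩ := exists_common_eigenvector (ρ '' (A : Set G)) (by
    rintro _ ⟨x, hx, rfl⟩ _ ⟨y, hy, rfl⟩
    rw [← map_mul, hA x hx y hy, map_mul])
  choose μ hμ using fun a : A => hS (ρ a) ⟨a, a.2, rfl⟩
  have huniq : ∀ a b : K, a • v = b • v → a = b := fun a b hab => smul_left_injective K hv hab
  let χ : A →* K :=
    { toFun := μ
      map_one' := by apply huniq; rw [← hμ]; simp
      map_mul' := by
        intro a b; apply huniq
        rw [← hμ, Subgroup.coe_mul, map_mul, Module.End.mul_apply, hμ b, map_smul, hμ a, smul_smul,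
          mul_comm] }
  refine ⟨v, hv, χ, ?_, fun a => hμ a⟩
  rw [injective_iff_map_eq_one]
  intro a ha
  by_contra hne
  apply hv
  apply h.fpf a (by simpa using hne)
  have := hμ a
  change μ a = 1 at ha
  rw [this, ha, one_smul]

lemma FPF.neg_one (h : FPF ρ) (x : G) (hx : x ≠ 1) (hx2 : x ^ 2 = 1) : ρ x = -1 := by
  ext v
  have h1 : ρ x (v + ρ x v) = v + ρ x v := by
    rw [map_add, ← Module.End.mul_apply, ← map_mul, ← pow_two, hx2, map_one, Module.End.one_apply,
      add_comm]
  have := h.fpf x hx _ h1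
  simp only [LinearMap.neg_apply, Module.End.one_apply]
  exact (neg_eq_of_add_eq_zero_right this).symm

lemma FPF.injective [Nontrivial V] (h : FPF ρ) : Function.Injective ρ := by
  rw [injective_iff_map_eq_one]
  intro a ha
  by_contra hne
  obtain ⟨v, hv⟩ := exists_ne (0 : V)
  exact hv (h.fpf a hne v (by rw [ha]; rfl))

lemma FPF.fc [Finite G] [IsAlgClosed K] [FiniteDimensional K V] [Nontrivial V] (h : FPF ρ) :
    FC G where
  cyc A hA := by
    obtain ⟨v, hv, χ, hχ, -⟩ := h.exists_char A hA
    exact isCyclic_of_injective_ringHom χ hχ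
  inv x y hx hy hx2 hy2 := h.injective (by rw [h.neg_one x hx hx2, h.neg_one y hy hy2])
  pq g e hg he := by
    by_contra hne
    set s := orderOf g with hs
    obtain ⟨v, hv, χ, hχ, hχv⟩ := h.exists_char (Subgroup.zpowers e) (by
      rintro _ ⟨a, rfl⟩ _ ⟨b, rfl⟩
      simp only [← zpow_add, add_comm])
    have hnorm : g⁻¹ ∈ Subgroup.normalizer (Subgroup.zpowers e : Set G) := by
      rw [inv_mem_iff]
      have hg' : Subgroup.map (MulAut.conj g).toMonoidHom (Subgroup.zpowers e) ≤
          Subgroup.zpowers e := by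
        rw [MonoidHom.map_zpowers, Subgroup.zpowers_le]
        simpa using he
      have hcard : Nat.card (Subgroup.map (MulAut.conj g).toMonoidHom (Subgroup.zpowers e)) =
          Nat.card (Subgroup.zpowers e) := by
        apply Subgroup.card_map_of_injective
        exact (MulAut.conj g).injective
      have heq := Subgroup.eq_of_le_of_card_ge hg' hcard.ge
      rw [Subgroup.mem_normalizer_iff]
      intro x
      constructor
      · intro hx
        exact hg' ⟨x, hx, by simp⟩
      · intro hx
        rw [← heq] at hx
        obtain ⟨y, hy, hyx⟩ := hx
        simp only [MulEquiv.toMonoidHom_eq_coe, MonoidHom.coe_coe, MulAut.conj_apply,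
          mul_left_inj, mul_right_inj] at hyx
        rwa [← hyx]
    have hconj : ∀ l : ℕ, (g ^ l)⁻¹ * e * g ^ l ∈ Subgroup.zpowers e := by
      intro l
      have h1 := pow_mem hnorm l
      rw [inv_pow, Subgroup.mem_normalizer_iff] at h1
      have := (h1 e).mp (Subgroup.mem_zpowers e)
      simpa using this
    have heig : ∀ l : Fin s, (ρ e).HasEigenvector (χ ⟨_, hconj l⟩) (ρ (g ^ (l : ℕ)) v) := by
      intro l
      refine ⟨?_, ?_⟩
      · rw [Module.End.mem_eigenspace_iff, ← map_smul, ← hχv ⟨_, hconj l⟩, ← Module.End.mul_apply,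
          ← Module.End.mul_apply, ← map_mul, ← map_mul]
        congr 2
        simp only [mul_assoc]
        group
      · intro h0
        apply hv
        have : ρ ((g ^ (l : ℕ))⁻¹) (ρ (g ^ (l : ℕ)) v) = 0 := by rw [h0, map_zero]
        rwa [← Module.End.mul_apply, ← map_mul, inv_mul_cancel, map_one] at this
    have hinj : Function.Injective (fun l : Fin s => χ ⟨_, hconj l⟩) := by
      have aux : ∀ l m : ℕ, l < m → m < s → (g ^ l)⁻¹ * e * g ^ l = (g ^ m)⁻¹ * e * g ^ m → False := by
        intro l m hlm hms heq
        apply hne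
        have hcom : Commute (g ^ (m - l)) e := by
          obtain ⟨r, rfl⟩ := Nat.exists_eq_add_of_lt hlm
          rw [show l + r + 1 - l = r + 1 by omega]
          have h2 : e = (g ^ (r+1))⁻¹ * e * g ^ (r+1) := by
            rw [show l + r + 1 = (r + 1) + l by ring, pow_add g (r+1) l] at heq
            simp only [mul_inv_rev, mul_assoc, mul_right_inj] at heq
            have h3 : e * g ^ l = ((g ^ (r+1))⁻¹ * e * g ^ (r+1)) * g ^ l := by
              rw [heq]; simp only [mul_assoc]
            exact mul_right_cancel h3
          rw [Commute, SemiconjBy]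
          conv_lhs => rw [h2]
          simp [mul_assoc]
        have hcop : (m - l).Coprime s := by
          rw [Nat.coprime_comm, hg.coprime_iff_not_dvd]
          intro hd
          have := Nat.le_of_dvd (by omega) hd
          omega
        obtain ⟨c, hc⟩ := exists_pow_eq_self_of_coprime (x := g) hcop
        have := hcom.pow_left c
        rw [hc] at this
        exact this
      intro l m hlm
      have h2 := congrArg Subtype.val (hχ hlm)
      simp only at h2
      rcases lt_trichotomy (l : ℕ) (m : ℕ) with hlt | heq | hgt
      · exact (aux l m hlt m.2 h2).elim
      · exact Fin.ext heq
      · exact (aux m l hgt l.2 h2.symm).elim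
    have hli := Module.End.eigenvectors_linearIndependent' (ρ e) _ hinj _ heig
    have hsum : ∑ l : Fin s, ρ (g ^ (l : ℕ)) v = 0 := by
      apply h.fpf g (by rintro rfl; simp at hs; rw [hs] at hg; exact Nat.not_prime_one hg)
      rw [Fin.sum_univ_eq_sum_range (fun l => ρ (g ^ l) v) s, map_sum]
      have : ∀ l, ρ g (ρ (g ^ l) v) = ρ (g ^ (l+1)) v := by
        intro l
        rw [← Module.End.mul_apply, ← map_mul, ← pow_succ']
      simp only [this]
      have e1 := Finset.sum_range_succ (fun l => ρ (g ^ l) v) s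
      have e2 := Finset.sum_range_succ' (fun l => ρ (g ^ l) v) s
      rw [e1, hs, pow_orderOf_eq_one, pow_zero] at e2
      exact (add_right_cancel e2).symm
    rw [Fintype.linearIndependent_iff] at hli
    have := hli (fun _ => 1) (by simpa using hsum) ⟨0, hg.pos⟩
    exact one_ne_zero this

end


lemma exists_max_abelian_normal (G : Type*) [Group G] [Finite G] :
    ∃ A : Subgroup G, A.Normal ∧ (∀ x ∈ A, ∀ y ∈ A, x * y = y * x) ∧
      ∀ B : Subgroup G, B.Normal → (∀ x ∈ B, ∀ y ∈ B, x * y = y * x) → A ≤ B → B ≤ A := by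
  let P : Subgroup G → Prop := fun A => A.Normal ∧ (∀ x ∈ A, ∀ y ∈ A, x * y = y * x)
  have hfin : {A | P A}.Finite := Set.toFinite _
  obtain ⟨A, hA⟩ := hfin.exists_maximal ⟨⊥, by
    refine ⟨inferInstance, ?_⟩
    intro x hx y hy
    rw [Subgroup.mem_bot] at hx hy
    rw [hx, hy]⟩
  exact ⟨A, hA.1.1, hA.1.2, fun B h1 h2 h3 => hA.2 ⟨h1, h2⟩ h3⟩

lemma comm_sup_zpowers {G : Type*} [Group G] (A : Subgroup G) (x : G)
    (hA : ∀ x ∈ A, ∀ y ∈ A, x * y = y * x) (hx : ∀ y ∈ A, x * y = y * x) :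
    ∀ u ∈ A ⊔ Subgroup.zpowers x, ∀ v ∈ A ⊔ Subgroup.zpowers x, u * v = v * u := by
  have h1 : ∀ u ∈ A ⊔ Subgroup.zpowers x, ∀ v ∈ A, u * v = v * u := by
    have : A ⊔ Subgroup.zpowers x ≤ Subgroup.centralizer (A : Set G) := by
      rw [sup_le_iff, Subgroup.zpowers_le]
      refine ⟨fun u hu => ?_, ?_⟩
      · rw [Subgroup.mem_centralizer_iff]; intro y hy; exact hA y hy u hu
      · rw [Subgroup.mem_centralizer_iff]; intro y hy; exact (hx y hy).symm
    intro u hu v hv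
    exact (Subgroup.mem_centralizer_iff.mp (this hu) v hv).symm
  have h2 : ∀ u ∈ A ⊔ Subgroup.zpowers x, u * x = x * u := by
    have : A ⊔ Subgroup.zpowers x ≤ Subgroup.centralizer ({x} : Set G) := by
      rw [sup_le_iff, Subgroup.zpowers_le]
      refine ⟨fun u hu => ?_, ?_⟩
      · rw [Subgroup.mem_centralizer_iff]; rintro y rfl; exact hx u hu
      · rw [Subgroup.mem_centralizer_iff]; rintro y rfl; rfl
    intro u hu
    exact (Subgroup.mem_centralizer_iff.mp (this hu) x rfl).symm
  have : A ⊔ Subgroup.zpowers x ≤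
      Subgroup.centralizer ((A ⊔ Subgroup.zpowers x : Subgroup G) : Set G) := by
    rw [sup_le_iff, Subgroup.zpowers_le]
    refine ⟨fun u hu => ?_, ?_⟩
    · rw [Subgroup.mem_centralizer_iff]; intro y hy; exact h1 y hy u hu
    · rw [Subgroup.mem_centralizer_iff]; intro y hy; exact h2 y hy
  intro u hu v hv
  exact (Subgroup.mem_centralizer_iff.mp (this hu) v hv).symm

lemma pgroup_self_centralizing {S : Type*} [Group S] [Finite S] {t : ℕ} [Fact t.Prime]
    (hS : IsPGroup t S) :
    ∃ A : Subgroup S, A.Normal ∧ (∀ x ∈ A, ∀ y ∈ A, x * y = y * x) ∧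
      ∀ x, (∀ y ∈ A, x * y = y * x) → x ∈ A := by
  obtain ⟨A, hN, hA, hmax⟩ := exists_max_abelian_normal S
  refine ⟨A, hN, hA, ?_⟩
  by_contra hcon
  push Not at hcon
  obtain ⟨x, hx, hxA⟩ := hcon
  let C : Subgroup (S ⧸ A) := (Subgroup.centralizer (A : Set S)).map (QuotientGroup.mk' A)
  have hCn : C.Normal := Subgroup.Normal.map inferInstance _ (QuotientGroup.mk'_surjective A)
  have hQ : IsPGroup t (ConjAct (S ⧸ A)) := (hS.to_quotient A).of_equiv ConjAct.toConjAct
  have hCne : C ≠ ⊥ := by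
    intro h0
    have : (QuotientGroup.mk' A x) ∈ C := ⟨x, by
      rw [SetLike.mem_coe, Subgroup.mem_centralizer_iff]; intro y hy; exact (hx y hy).symm, rfl⟩
    rw [h0, Subgroup.mem_bot] at this
    exact hxA ((QuotientGroup.eq_one_iff x).mp this)
  have hdvd : t ∣ Nat.card C := by
    rcases ((hS.to_quotient A).to_subgroup C).card_eq_or_dvd with h1 | h1
    · exact absurd (Subgroup.card_eq_one.mp h1) hCne
    · exact h1
  obtain ⟨b, hb, hb1⟩ := hQ.exists_fixed_point_of_prime_dvd_card_of_fixed_point C hdvd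
    (a := 1) (by intro g; simp)
  obtain ⟨b, y, hy, rfl⟩ := b
  have hyA : y ∉ A := by
    intro h0
    apply hb1
    exact Subtype.ext ((QuotientGroup.eq_one_iff y).mpr h0).symm
  have hcent : ∀ g : S, g * y * g⁻¹ * y⁻¹ ∈ A := by
    intro g
    have := congrArg Subtype.val (hb (ConjAct.toConjAct (QuotientGroup.mk' A g)))
    rw [ConjAct.Subgroup.val_conj_smul, ConjAct.toConjAct_smul] at this
    simp only at this
    rw [← map_inv, ← map_mul, ← map_mul, ← mul_inv_eq_one, ← map_inv, ← map_mul] at this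
    exact (QuotientGroup.eq_one_iff _).mp this
  apply hyA
  have hyc : ∀ u ∈ A, y * u = u * y := fun u hu =>
    (Subgroup.mem_centralizer_iff.mp hy u hu).symm
  refine hmax (A ⊔ Subgroup.zpowers y) ⟨?_⟩ (comm_sup_zpowers A y hA hyc) le_sup_left
    (le_sup_right (a := A) (Subgroup.mem_zpowers y))
  intro n hn g
  have : A ⊔ Subgroup.zpowers y ≤ (A ⊔ Subgroup.zpowers y).comap (MulAut.conj g).toMonoidHom := by
    rw [sup_le_iff, Subgroup.zpowers_le]
    refine ⟨fun u hu => ?_, ?_⟩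
    · exact le_sup_left (a := A) (hN.conj_mem u hu g)
    · have h1 := le_sup_left (a := A) (b := Subgroup.zpowers y) (hcent g)
      have h2 := mul_mem h1 (le_sup_right (a := A) (Subgroup.mem_zpowers y))
      simpa using h2
  exact this hn

lemma pow_semi {G : Type*} [Group G] (a g : G) (k x : ℤ) (hg : g * a * g⁻¹ = a ^ k) (n : ℕ) :
    (a ^ x * g) ^ n = a ^ (x * ∑ i ∈ Finset.range n, k ^ i) * g ^ n := by
  have h1 : ∀ m : ℤ, g * a ^ m = a ^ (k * m) * g := by
    intro m
    have : (g * a * g⁻¹) ^ m = g * a ^ m * g⁻¹ := by rw [conj_zpow]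
    rw [zpow_mul, ← hg, this]; group
  induction n with
  | zero => simp
  | succ n ih =>
    rw [pow_succ', ih, geom_sum_succ, mul_assoc, ← mul_assoc g, h1, mul_assoc, ← mul_assoc,
      ← zpow_add, ← pow_succ']
    congr 2
    ring

lemma conj_pow_exp {G : Type*} [Group G] (a g : G) (k : ℤ) (hg : g * a * g⁻¹ = a ^ k) (n : ℕ) :
    g ^ n * a * (g ^ n)⁻¹ = a ^ (k ^ n) := by
  induction n with
  | zero => simp
  | succ n ih =>
    rw [pow_succ', mul_inv_rev]
    have : g * g ^ n * a * ((g ^ n)⁻¹ * g⁻¹) = g * (g ^ n * a * (g ^ n)⁻¹) * g⁻¹ := by group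
    rw [this, ih, ← conj_zpow, hg, ← zpow_mul, pow_succ, mul_comm]

lemma FC.key_no_prime {S : Type*} [Group S] (hF : FC S) {t : ℕ} (ht : t.Prime) (a g : S)
    (hC : ∀ x, x * a = a * x → x ∈ Subgroup.zpowers a) (hg : g ∉ Subgroup.zpowers a)
    (k x : ℤ) (hk : g * a * g⁻¹ = a ^ k) : (a ^ x * g) ^ t ≠ 1 := by
  intro h1
  have hh : a ^ x * g ∉ Subgroup.zpowers a := by
    intro h
    exact hg ((Subgroup.mul_mem_cancel_left _ (Subgroup.zpow_mem_zpowers a x)).mp h)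
  have ho : orderOf (a ^ x * g) = t := by
    have := Fact.mk ht
    apply orderOf_eq_prime h1
    intro h
    rw [h] at hh
    exact hh (one_mem _)
  apply hh
  apply hC
  apply hF.pq _ _ (ho ▸ ht)
  refine ⟨k, ?_⟩
  simp only
  have h2 : a ^ x * g * a * (a ^ x * g)⁻¹ = a ^ x * (g * a * g⁻¹) * (a ^ x)⁻¹ := by group
  rw [h2, hk, ← zpow_add, ← zpow_neg, ← zpow_add]
  congr 1; ring

lemma FC.odd_cyclic {S : Type*} [Group S] [Finite S] (hF : FC S) {t : ℕ} [ht : Fact t.Prime]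
    (hS : IsPGroup t S) (hodd : t ≠ 2) : IsCyclic S := by
  obtain ⟨A, hN, hA, hC⟩ := pgroup_self_centralizing hS
  have hcyc := hF.cyc A hA
  obtain ⟨a, ha⟩ := (Subgroup.isCyclic_iff_exists_zpowers_eq_top A).mp hcyc
  subst ha
  have hC' : ∀ x, x * a = a * x → x ∈ Subgroup.zpowers a := by
    intro x hx
    apply hC
    rintro _ ⟨m, rfl⟩
    exact (show Commute x a from hx).zpow_right m
  by_contra hnc
  have hex : ∃ g : S, g ∉ Subgroup.zpowers a ∧ g ^ t ∈ Subgroup.zpowers a := by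
    have : ∃ g : S, g ∉ Subgroup.zpowers a := by
      by_contra hall
      push Not at hall
      exact hnc ⟨a, hall⟩
    obtain ⟨g, hg⟩ := this
    obtain ⟨n, hn⟩ := hS g
    classical
    have hP : ∃ n, g ^ t ^ n ∈ Subgroup.zpowers a := ⟨n, by rw [hn]; exact one_mem _⟩
    have h1 := Nat.find_spec hP
    have h2 : Nat.find hP ≠ 0 := by
      intro h0
      rw [h0] at h1
      simp at h1
      exact hg h1
    obtain ⟨m, hm⟩ := Nat.exists_eq_succ_of_ne_zero h2
    refine ⟨g ^ t ^ m, Nat.find_min hP (by omega), ?_⟩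
    rw [← pow_mul, ← pow_succ, ← Nat.succ_eq_add_one, ← hm]
    exact h1
  obtain ⟨g, hg, y, hy⟩ := hex
  simp only at hy
  obtain ⟨k, hk⟩ := hN.conj_mem a (Subgroup.mem_zpowers a) g
  simp only at hk
  obtain ⟨e, he⟩ := (IsPGroup.iff_orderOf.mp hS) a
  have he0 : e ≠ 0 := by
    rintro rfl
    simp at he
    subst he
    exact hg (hC' g (by simp))
  have hk1 : ¬ (orderOf a : ℤ) ∣ k - 1 := by
    intro hd
    rw [orderOf_dvd_iff_zpow_eq_one, zpow_sub_one, hk, mul_inv_eq_one] at hd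
    exact hg (hC' g (by rw [mul_inv_eq_iff_eq_mul] at hd; exact hd))
  have hkt : (orderOf a : ℤ) ∣ k ^ t - 1 := by
    rw [orderOf_dvd_iff_zpow_eq_one, zpow_sub_one, ← conj_pow_exp a g k hk.symm, ← hy]
    have : a ^ y * a = a * a ^ y := ((Commute.refl a).zpow_left y)
    rw [this]; group
  have hyk : (orderOf a : ℤ) ∣ y * (k - 1) := by
    rw [orderOf_dvd_iff_zpow_eq_one, mul_sub, mul_one, zpow_sub, mul_comm, zpow_mul, hk, conj_zpow, hy]
    group
  rw [he] at hk1 hkt hyk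
  push_cast at hk1 hkt hyk
  have htp : Prime (t : ℤ) := Nat.prime_iff_prime_int.mp ht.out
  have hty : (t : ℤ) ∣ y := by
    by_contra hn
    apply hk1
    exact (((htp.coprime_iff_not_dvd).mpr hn).pow_left).dvd_of_dvd_mul_left hyk
  have htk : (t : ℤ) ∣ k - 1 := by
    have h1 : (t : ℤ) ∣ k ^ t - 1 := (dvd_pow_self _ he0).trans hkt
    have h2 : ((k ^ t - 1 : ℤ) : ZMod t) = 0 := (ZMod.intCast_zmod_eq_zero_iff_dvd _ _).mpr h1 |> fun h => by simpa using h
    have h3 : ((k - 1 : ℤ) : ZMod t) = 0 := by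
      push_cast at h2 ⊢
      rwa [ZMod.pow_card] at h2
    exact (ZMod.intCast_zmod_eq_zero_iff_dvd _ _).mp h3
  obtain ⟨m, hm⟩ := htk
  have hk' : k = 1 + t * m := by linarith
  -- the geometric sum
  have hgs : ∃ w : ℤ, ∑ i ∈ Finset.range t, k ^ i = t * (1 + t * w) := by
    have h1 : ∀ i : ℕ, ∃ c : ℤ, k ^ i = 1 + i * (t * m) + t ^ 2 * c := by
      intro i
      induction i with
      | zero => exact ⟨0, by simp⟩
      | succ i ih =>
        obtain ⟨c, hc⟩ := ih
        refine ⟨c + i * m ^ 2 + c * t * m, ?_⟩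
        rw [pow_succ, hc, hk']; push_cast; ring
    choose c hc using h1
    have hsum : ∑ i ∈ Finset.range t, (i : ℤ) = (t : ℤ) * (((t - 1) / 2 : ℕ) : ℤ) := by
      have := Finset.sum_range_id_mul_two t
      have ho : t % 2 = 1 := (ht.out.eq_two_or_odd).resolve_left hodd
      have h3 : (t - 1) = 2 * ((t - 1) / 2) := by omega
      have h4 : ∑ i ∈ Finset.range t, i = t * ((t - 1) / 2) := by
        have : (∑ i ∈ Finset.range t, i) * 2 = (t * ((t - 1) / 2)) * 2 := by
          rw [this]; conv_lhs => rw [h3]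
          ring
        omega
      rw [← Nat.cast_sum, h4, Nat.cast_mul]
    refine ⟨m * (((t - 1) / 2 : ℕ) : ℤ) + ∑ i ∈ Finset.range t, c i, ?_⟩
    simp only [hc]
    rw [Finset.sum_add_distrib, Finset.sum_add_distrib, ← Finset.sum_mul, ← Finset.mul_sum, hsum]
    simp; ring
  obtain ⟨w, hw⟩ := hgs
  obtain ⟨y', rfl⟩ := hty
  have hcop : IsCoprime ((t : ℤ) ^ e) (1 + t * w) := by
    apply IsCoprime.pow_left
    exact ⟨-w, 1, by ring⟩
  obtain ⟨u, v, huv⟩ := hcop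
  refine hF.key_no_prime ht.out a g hC' hg k (-y' * v) hk.symm ?_ (t := t)
  rw [pow_semi a g k _ hk.symm, ← hy, ← zpow_add, ← orderOf_dvd_iff_zpow_eq_one, he, hw]
  push_cast
  refine ⟨t * y' * u, ?_⟩
  linear_combination (-(t : ℤ) * y') * huv

lemma FC.two_group {S : Type*} [Group S] [Finite S] (hF : FC S) (hS : IsPGroup 2 S) :
    IsCyclic S ∨ ∃ s : S, 4 ∣ orderOf s ∧ (Subgroup.zpowers s).index = 2 ∧
      ∀ g ∉ Subgroup.zpowers s, g * s * g⁻¹ = s⁻¹ ∧ g ^ 2 ≠ 1 ∧ g ^ 4 = 1 := by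
  have : Fact (Nat.Prime 2) := ⟨Nat.prime_two⟩
  obtain ⟨A, hN, hA, hC⟩ := pgroup_self_centralizing hS
  have hcyc := hF.cyc A hA
  obtain ⟨a, ha⟩ := (Subgroup.isCyclic_iff_exists_zpowers_eq_top A).mp hcyc
  subst ha
  have hC' : ∀ x, x * a = a * x → x ∈ Subgroup.zpowers a := by
    intro x hx
    apply hC
    rintro _ ⟨m, rfl⟩
    exact (show Commute x a from hx).zpow_right m
  by_cases hnc : IsCyclic S
  · exact Or.inl hnc
  right
  obtain ⟨e, he⟩ := (IsPGroup.iff_orderOf.mp hS) a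
  have hinvert : ∀ g ∉ Subgroup.zpowers a, g ^ 2 ∈ Subgroup.zpowers a → g * a * g⁻¹ = a⁻¹ := by
    intro g hg hg2
    obtain ⟨y, hy⟩ := hg2
    simp only at hy
    obtain ⟨k, hk⟩ := hN.conj_mem a (Subgroup.mem_zpowers a) g
    simp only at hk
    have he0 : e ≠ 0 := by
      rintro rfl
      simp at he
      subst he
      exact hg (hC' g (by simp))
    have hk1 : ¬ (orderOf a : ℤ) ∣ k - 1 := by
      intro hd
      rw [orderOf_dvd_iff_zpow_eq_one, zpow_sub_one, hk, mul_inv_eq_one] at hd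
      exact hg (hC' g (by rw [mul_inv_eq_iff_eq_mul] at hd; exact hd))
    have hkt : (orderOf a : ℤ) ∣ k ^ 2 - 1 := by
      rw [orderOf_dvd_iff_zpow_eq_one, zpow_sub_one, ← conj_pow_exp a g k hk.symm, ← hy]
      have : a ^ y * a = a * a ^ y := ((Commute.refl a).zpow_left y)
      rw [this]; group
    have hyk : (orderOf a : ℤ) ∣ y * (k - 1) := by
      rw [orderOf_dvd_iff_zpow_eq_one, mul_sub, mul_one, zpow_sub, mul_comm, zpow_mul, hk, conj_zpow, hy]
      group
    by_contra hne
    have hkm : ¬ (orderOf a : ℤ) ∣ k + 1 := by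
      intro hd
      rw [orderOf_dvd_iff_zpow_eq_one, zpow_add_one, hk, mul_eq_one_iff_eq_inv] at hd
      exact hne hd
    have hno : ∀ x : ℤ, ¬ (orderOf a : ℤ) ∣ x * (1 + k) + y := by
      intro x hx
      refine hF.key_no_prime Nat.prime_two a g hC' hg k x hk.symm ?_
      rw [pow_semi a g k _ hk.symm, ← hy, ← zpow_add, ← orderOf_dvd_iff_zpow_eq_one]
      simpa [Finset.sum_range_succ] using hx
    rw [he] at hk1 hkt hyk hkm hno
    push_cast at hk1 hkt hyk hkm hno
    obtain ⟨f, rfl⟩ := Nat.exists_eq_succ_of_ne_zero he0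
    rw [Nat.succ_eq_add_one] at hk1 hkt hyk hkm hno
    have hkodd : k % 2 = 1 := by
      have h1 : (2 : ℤ) ∣ k ^ 2 - 1 := (dvd_pow_self _ he0).trans hkt
      rcases Int.emod_two_eq_zero_or_one k with h | h
      · exfalso
        obtain ⟨c, hc⟩ := h1
        obtain ⟨r, rfl⟩ := Int.dvd_of_emod_eq_zero h
        have : 2 * (2 * r ^ 2 - c) = 1 := by linarith [hc, (show (2 * r) ^ 2 = 4 * r ^ 2 by ring)]
        omega
      · exact h
    have hcop : ∀ w : ℤ, w % 2 = 1 → IsCoprime ((2 : ℤ) ^ (f + 1)) w := by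
      intro w hw
      apply IsCoprime.pow_left
      exact ⟨-(w / 2), 1, by omega⟩
    have h4 : k % 4 = 1 ∨ k % 4 = 3 := by omega
    rcases h4 with h4 | h4
    · obtain ⟨w, hw⟩ : ∃ w, 1 + k = 2 * w := ⟨(1 + k) / 2, by omega⟩
      have hw1 : w % 2 = 1 := by omega
      have hy2 : y % 2 = 0 := by
        by_contra h
        exact hk1 ((hcop y (by omega)).dvd_of_dvd_mul_left hyk)
      obtain ⟨y', rfl⟩ := Int.dvd_of_emod_eq_zero hy2
      obtain ⟨u, v, huv⟩ := hcop w hw1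
      apply hno (-y' * v)
      rw [hw]
      exact ⟨2 * y' * u, by linear_combination (-2 * y') * huv⟩
    · obtain ⟨w, hw⟩ : ∃ w, k - 1 = 2 * w := ⟨(k - 1) / 2, by omega⟩
      have hw1 : w % 2 = 1 := by omega
      have h5 : (2 : ℤ) ^ (f + 1) ∣ 2 * y := by
        apply (hcop w hw1).dvd_of_dvd_mul_left
        rw [hw] at hyk
        rwa [show y * (2 * w) = w * (2 * y) by ring] at hyk
      have h6 : (2 : ℤ) ^ (f + 1) ∣ 2 * (k + 1) := by
        apply (hcop w hw1).dvd_of_dvd_mul_left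
        rw [show k ^ 2 - 1 = (k - 1) * (k + 1) by ring, hw] at hkt
        rwa [show (2 * w) * (k + 1) = w * (2 * (k + 1)) by ring] at hkt
      rw [pow_succ'] at h5 h6
      obtain ⟨y', rfl⟩ := Int.dvd_of_mul_dvd_mul_left (by norm_num) h5
      obtain ⟨u, hu⟩ := Int.dvd_of_mul_dvd_mul_left (by norm_num) h6
      rw [hu, pow_succ] at hkm
      have hu1 : u % 2 = 1 := by
        by_contra h
        obtain ⟨c, rfl⟩ : ∃ c, u = 2 * c := ⟨u / 2, by omega⟩
        exact hkm ⟨c, by ring⟩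
      rcases Int.emod_two_eq_zero_or_one y' with h | h
      · apply hno 0
        obtain ⟨c, rfl⟩ : ∃ c, y' = 2 * c := ⟨y' / 2, by omega⟩
        exact ⟨c, by ring⟩
      · apply hno 1
        rw [add_comm 1 k, hu]
        obtain ⟨c, hc⟩ : ∃ c, u + y' = 2 * c := ⟨(u + y') / 2, by omega⟩
        exact ⟨c, by linear_combination 2 ^ f * hc⟩
  have hsq : ∀ g ∉ Subgroup.zpowers a, g ^ 2 ∈ Subgroup.zpowers a := by
    intro g hg
    obtain ⟨n, hn⟩ := hS g
    classical
    have hP : ∃ n, g ^ 2 ^ n ∈ Subgroup.zpowers a := ⟨n, by rw [hn]; exact one_mem _⟩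
    have h1 := Nat.find_spec hP
    have h2 : Nat.find hP ≠ 0 := by
      intro h0
      rw [h0] at h1
      simp at h1
      exact hg h1
    obtain ⟨m, hm⟩ := Nat.exists_eq_succ_of_ne_zero h2
    have h3 := Nat.find_min hP (m := m) (by omega)
    rw [hm] at h1
    rcases Nat.eq_zero_or_eq_succ_pred m with rfl | hm'
    · simpa using h1
    exfalso
    have h1' : (g ^ 2 ^ m) ^ 2 ∈ Subgroup.zpowers a := by rwa [← pow_mul, ← pow_succ]
    have h4 := hinvert _ h3 h1'
    rw [hm', Nat.succ_eq_add_one, pow_succ, pow_mul] at h4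
    obtain ⟨k, hk⟩ := hN.conj_mem a (Subgroup.mem_zpowers a) (g ^ 2 ^ m.pred)
    simp only at hk
    have h5 := conj_pow_exp a _ k hk.symm 2
    rw [h4, eq_comm, ← mul_eq_one_iff_eq_inv, ← zpow_add_one, ← orderOf_dvd_iff_zpow_eq_one, he] at h5
    have h6 : e ≠ 0 := by
      rintro rfl
      simp at he
      subst he
      exact hg (hC' g (by simp))
    have h7 : e ≠ 1 := by
      rintro rfl
      have ha2 : a ^ 2 = 1 := by rw [← orderOf_dvd_iff_pow_eq_one, he]; norm_num
      have ha3 : a⁻¹ = a := by rw [inv_eq_iff_mul_eq_one, ← pow_two, ha2]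
      rw [ha3] at h4
      apply h3
      apply hC'
      rw [mul_inv_eq_iff_eq_mul] at h4
      rw [hm', Nat.succ_eq_add_one, pow_succ, pow_mul]
      exact h4
    have h8 : (4 : ℤ) ∣ k ^ 2 + 1 := by
      refine dvd_trans ?_ h5
      obtain ⟨f, rfl⟩ := Nat.exists_eq_add_of_le (show 2 ≤ e by omega)
      push_cast
      rw [pow_add]
      exact ⟨2 ^ f, by norm_num⟩
    have h9 : k % 4 = 0 ∨ k % 4 = 1 ∨ k % 4 = 2 ∨ k % 4 = 3 := by omega
    have h10 : (k ^ 2 + 1) % 4 = 0 := Int.emod_eq_zero_of_dvd h8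
    rcases h9 with h | h | h | h <;> simp [pow_two, Int.add_emod, Int.mul_emod, h] at h10
  have hinv2 : ∀ g ∉ Subgroup.zpowers a, g * a * g⁻¹ = a⁻¹ := fun g hg => hinvert g hg (hsq g hg)
  have hex : ∃ g : S, g ∉ Subgroup.zpowers a := by
    by_contra hall
    push Not at hall
    exact hnc ⟨a, hall⟩
  obtain ⟨g, hg⟩ := hex
  refine ⟨a, ?_, ?_, ?_⟩
  · rw [he]
    have h6 : e ≠ 0 := by
      rintro rfl
      simp at he
      subst he
      exact hg (hC' g (by simp))
    have h7 : e ≠ 1 := by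
      rintro rfl
      have ha2 : a ^ 2 = 1 := by rw [← orderOf_dvd_iff_pow_eq_one, he]; norm_num
      have ha3 : a⁻¹ = a := by rw [inv_eq_iff_mul_eq_one, ← pow_two, ha2]
      have h4 := hinv2 g hg
      rw [ha3] at h4
      apply hg
      apply hC'
      rw [mul_inv_eq_iff_eq_mul] at h4
      exact h4
    obtain ⟨f, rfl⟩ := Nat.exists_eq_add_of_le (show 2 ≤ e by omega)
    rw [pow_add]
    exact ⟨2 ^ f, by norm_num⟩
  · rw [Subgroup.index_eq_two_iff]
    refine ⟨g, fun b => ?_⟩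
    by_cases hb : b ∈ Subgroup.zpowers a
    · refine Or.inr ⟨hb, fun h => hg ((Subgroup.mul_mem_cancel_left _ hb).mp h)⟩
    · refine Or.inl ⟨hC' _ ?_, hb⟩
      have h1 := hinv2 g hg
      have h2 := hinv2 b hb
      have h3 : b * a⁻¹ * b⁻¹ = a := by
        have := congrArg (·⁻¹) h2
        simp only [mul_inv_rev, inv_inv] at this
        rw [mul_assoc]; exact this
      rw [← mul_inv_eq_iff_eq_mul]
      calc b * g * a * (b * g)⁻¹ = b * (g * a * g⁻¹) * b⁻¹ := by group
        _ = a := by rw [h1, h3]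
  · intro b hb
    have h2 := hinv2 b hb
    refine ⟨h2, ?_, ?_⟩
    · intro hb2
      refine hF.key_no_prime Nat.prime_two a b hC' hb (-1) 0 (by simpa using h2) ?_
      simpa using hb2
    · obtain ⟨y, hy⟩ := hsq b hb
      simp only at hy
      have h3 : b * b ^ 2 * b⁻¹ = b ^ 2 := by group
      have h4 : b * b ^ 2 * b⁻¹ = (b ^ 2)⁻¹ := by
        rw [← hy, ← conj_zpow, h2, inv_zpow]
      rw [h3] at h4
      rw [show (4 : ℕ) = 2 + 2 by norm_num, pow_add]
      nth_rw 1 [h4]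
      group


/-- the exceptional case of Dickson's theorem -/
structure DII (L : Type*) [Group L] (Z : Subgroup L) (m N : ℕ) : Prop where
  mN : (m = 3 ∧ N = 12) ∨ (m = 4 ∧ N = 24) ∨ (m = 5 ∧ N = 60)
  card : Nat.card L = N * Nat.card Z
  cls : 2 * Nat.card (ConjClasses L) = (4 + m) * Nat.card Z
  cent : ∀ g, g ∉ Z → ∃ e, (e = 2 ∨ e = 3 ∨ e = m) ∧
    Nat.card (Subgroup.centralizer {g}) = e * Nat.card Z ∧ ∀ x, x * g = g * x → x ^ e ∈ Z
  five : m = 5 → ∃ (C : Subgroup L) (h : L), Z ≤ C ∧ (∀ x ∈ C, ∀ y ∈ C, x * y = y * x) ∧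
    Nat.card C = 3 * Nat.card Z ∧ h ∉ C ∧ h ^ 2 ∈ C ∧ (∀ x ∈ C, h * x * h⁻¹ ∈ C) ∧
    ∀ x ∈ C, x ∉ Z → ∀ y, y * x = x * y → y ∈ C

lemma dickson_arith3 (N f1 f2 f3 e1 e2 e3 : ℕ) (h1 : e1 * f1 = N) (h2 : e2 * f2 = N)
    (h3 : e3 * f3 = N) (he1 : 2 ≤ e1) (h12 : e1 ≤ e2) (h23 : e2 ≤ e3)
    (hs : f1 + f2 + f3 = N + 2) :
    (f3 = 2) ∨ (e1 = 2 ∧ e2 = 3 ∧ ((e3 = 3 ∧ N = 12) ∨ (e3 = 4 ∧ N = 24) ∨ (e3 = 5 ∧ N = 60))) := by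
  have a1 : e1 = 2 := by
    by_contra h
    have k1 : 3 * f1 ≤ N := by rw [← h1]; exact Nat.mul_le_mul_right _ (by omega)
    have k2 : 3 * f2 ≤ N := by rw [← h2]; exact Nat.mul_le_mul_right _ (by omega)
    have k3 : 3 * f3 ≤ N := by rw [← h3]; exact Nat.mul_le_mul_right _ (by omega)
    omega
  subst a1
  have a2 : e2 ≤ 3 := by
    by_contra h
    have k2 : 4 * f2 ≤ N := by rw [← h2]; exact Nat.mul_le_mul_right _ (by omega)
    have k3 : 4 * f3 ≤ N := by rw [← h3]; exact Nat.mul_le_mul_right _ (by omega)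
    omega
  have a2' : e2 = 2 ∨ e2 = 3 := by omega
  rcases a2' with rfl | rfl
  · left; omega
  · right
    refine ⟨rfl, rfl, ?_⟩
    have a3 : e3 ≤ 5 := by
      by_contra h
      have k3 : 6 * f3 ≤ N := by rw [← h3]; exact Nat.mul_le_mul_right _ (by omega)
      omega
    have : e3 = 3 ∨ e3 = 4 ∨ e3 = 5 := by omega
    rcases this with rfl | rfl | rfl <;> omega

section
variable {L Ω : Type*} [Group L] [Finite L] [Finite Ω] [MulAction L Ω]

theorem dickson_abs (Z : Subgroup L) (hZc : ∀ g ∈ Z, ∀ h, h * g = g * h)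
    (hZfix : ∀ g ∈ Z, ∀ ω : Ω, g • ω = ω)
    (h2 : ∀ g ∉ Z, Nat.card (MulAction.fixedBy Ω g) = 2)
    (hne : ∀ ω : Ω, ∃ g ∉ Z, g • ω = ω)
    (hcomm : ∀ (ω : Ω) (g h : L), g • ω = ω → h • ω = ω → g * h = h * g)
    (hcent : ∀ g ∉ Z, ∀ ω : Ω, g • ω = ω → ∀ h, h * g = g * h → h • ω = ω) :
    (∃ A : Subgroup L, (∀ x ∈ A, ∀ y ∈ A, x * y = y * x) ∧ (A.index = 1 ∨ A.index = 2)) ∨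
    ∃ m N, DII L Z m N := by
  classical
  have : Fintype L := Fintype.ofFinite L
  have : Fintype Ω := Fintype.ofFinite Ω
  let Q := MulAction.orbitRel.Quotient L Ω
  have : Finite Q := Quotient.finite _
  have : Fintype Q := Fintype.ofFinite Q
  set z := Nat.card Z with hz
  have hz0 : 0 < z := Nat.card_pos
  set N := Z.index with hN
  have hN0 : 0 < N := Nat.pos_of_ne_zero Subgroup.index_ne_zero_of_finite
  have hLN : Nat.card L = N * z := by rw [hN, hz, Subgroup.index_mul_card]
  have hZle : ∀ ω : Ω, Z ≤ MulAction.stabilizer L ω := fun ω g hg => hZfix g hg ω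
  let E : Ω → ℕ := fun ω => Z.relIndex (MulAction.stabilizer L ω)
  have hE : ∀ ω : Ω, Nat.card (MulAction.stabilizer L ω) = E ω * z := by
    intro ω
    have := Subgroup.card_mul_index (Z.subgroupOf (MulAction.stabilizer L ω))
    rw [← this, mul_comm]
    congr 1
    exact Nat.card_congr (Subgroup.subgroupOfEquivOfLe (hZle ω)).toEquiv
  have hE0 : ∀ ω : Ω, E ω ≠ 0 := by
    intro ω h0
    have := hE ω
    rw [h0, zero_mul] at this
    exact Nat.card_pos.ne' this
  have hE2 : ∀ ω : Ω, 2 ≤ E ω := by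
    intro ω
    have h1 : E ω ≠ 1 := by
      intro h1
      obtain ⟨g, hg, hgω⟩ := hne ω
      have : MulAction.stabilizer L ω ≤ Z := Subgroup.relIndex_eq_one.mp h1
      exact hg (this hgω)
    have := hE0 ω
    omega
  let F : Ω → ℕ := fun ω => (MulAction.stabilizer L ω).index
  have hEF : ∀ ω, E ω * F ω = N := by
    intro ω
    exact Subgroup.relIndex_mul_index (hZle ω)
  have hForb : ∀ ω, Nat.card (MulAction.orbit L ω) = F ω := by
    intro ω
    exact (MulAction.index_stabilizer L ω).symm
  -- same orbit, same E
  have hEorb : ∀ ω (g : L), E (g • ω) = E ω := by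
    intro ω g
    have h1 := hE (g • ω)
    have h3 : Nat.card (MulAction.stabilizer L (g • ω)) = Nat.card (MulAction.stabilizer L ω) :=
      (Nat.card_congr (MulAction.stabilizerEquivStabilizer (g := g) rfl).toEquiv).symm
    rw [h3, hE ω] at h1
    exact (Nat.eq_of_mul_eq_mul_right hz0 h1).symm
  -- summation over orbits
  have hsum : ∀ φ : ℕ → ℕ, ∑ ω : Ω, φ (E ω) = ∑ q : Q, F q.out * φ (E q.out) := by
    intro φ
    rw [← Finset.sum_fiberwise (s := Finset.univ) (g := fun ω => (Quotient.mk _ ω : Q))]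
    apply Finset.sum_congr rfl
    intro q _
    have hq : ∀ ω : Ω, (Quotient.mk _ ω : Q) = q ↔ ω ∈ MulAction.orbit L q.out := by
      intro ω
      rw [← MulAction.orbitRel_apply, ← Quotient.eq (r := MulAction.orbitRel L Ω), Quotient.out_eq]
    have h1 : ∀ ω ∈ Finset.univ.filter (fun ω : Ω => (Quotient.mk _ ω : Q) = q),
        φ (E ω) = φ (E q.out) := by
      intro ω hω
      rw [Finset.mem_filter] at hω
      obtain ⟨g, hg⟩ := (hq ω).mp hω.2
      rw [← hg]
      simp only
      rw [hEorb]
    rw [Finset.sum_congr rfl h1, Finset.sum_const, smul_eq_mul]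
    congr 1
    rw [← hForb, Nat.card_eq_fintype_card, Fintype.card_subtype]
    congr 1
    ext ω
    simp only [Finset.mem_filter, Finset.mem_univ, true_and]
    rw [hq]
  -- incidence
  have hfix : ∀ g : L, Nat.card (MulAction.fixedBy Ω g) = ∑ ω : Ω, if g • ω = ω then 1 else 0 := by
    intro g
    rw [Nat.card_eq_fintype_card, Fintype.card_subtype, Finset.card_filter]
    rfl
  have hstab : ∀ ω : Ω, ∑ g : L, (if g • ω = ω then 1 else 0) = E ω * z := by
    intro ω
    rw [← hE, Nat.card_eq_fintype_card, Fintype.card_subtype, Finset.card_filter]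
    rfl
  have hZcard : (Finset.univ.filter (fun g : L => g ∈ Z)).card = z := by
    rw [hz, Nat.card_eq_fintype_card, Fintype.card_subtype]
  have hZcard' : (Finset.univ.filter (fun g : L => g ∉ Z)).card + z = N * z := by
    rw [← hLN, Nat.card_eq_fintype_card, ← Finset.card_univ, ← hZcard, add_comm]
    exact Finset.card_filter_add_card_filter_not (s := Finset.univ) (p := fun g : L => g ∈ Z)
  have hstab' : ∀ ω : Ω, (∑ g ∈ Finset.univ.filter (fun g : L => g ∉ Z),
      if g • ω = ω then 1 else 0) + z = E ω * z := by
    intro ω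
    rw [← hstab, ← Finset.sum_filter_add_sum_filter_not Finset.univ (fun g : L => g ∈ Z), add_comm]
    congr 1
    rw [← hZcard, Finset.card_eq_sum_ones]
    apply Finset.sum_congr rfl
    intro g hg
    rw [Finset.mem_filter] at hg
    rw [if_pos (hZfix g hg.2 ω)]
  have hout : ∀ ω : Ω, (∑ g ∈ Finset.univ.filter (fun g : L => g ∉ Z),
      if g • ω = ω then 1 else 0) = (E ω - 1) * z := by
    intro ω
    have h1 := hstab' ω
    rw [Nat.sub_mul, one_mul]; omega
  -- main identity
  have hmain : (∑ q : Q, F q.out) + 2 * N = Fintype.card Q * N + 2 := by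
    have h1 : ∑ g ∈ Finset.univ.filter (fun g : L => g ∉ Z), Nat.card (MulAction.fixedBy Ω g) =
        ∑ ω : Ω, (E ω - 1) * z := by
      simp only [hfix]
      rw [Finset.sum_comm]
      exact Finset.sum_congr rfl fun ω _ => hout ω
    rw [Finset.sum_congr rfl (g := fun _ => 2) (by
      intro g hg
      rw [Finset.mem_filter] at hg
      exact h2 g hg.2), Finset.sum_const, smul_eq_mul, hsum (fun e => (e - 1) * z)] at h1
    have h3 : ∑ q : Q, F q.out * ((E q.out - 1) * z) + (∑ q : Q, F q.out) * z =
        Fintype.card Q * N * z := by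
      rw [Finset.sum_mul, ← Finset.sum_add_distrib]
      rw [Finset.sum_congr rfl (g := fun _ => N * z)]
      · rw [Finset.sum_const, smul_eq_mul, Finset.card_univ, mul_assoc]
      · intro q _
        have := hE2 q.out
        obtain ⟨e, he⟩ := Nat.exists_eq_add_of_le this
        rw [← hEF q.out, he, show 2 + e - 1 = 1 + e by omega]; ring
    apply Nat.eq_of_mul_eq_mul_right hz0
    rw [← h1] at h3
    nlinarith [h3, hZcard']
  -- class number
  have hcls : 2 * Nat.card (ConjClasses L) = 2 * z + z * ∑ q : Q, (E q.out - 1) := by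
    have h1 : ∑ g : L, Nat.card (Subgroup.centralizer {g}) = Nat.card (ConjClasses L) * (N * z) := by
      rw [← hLN, ← card_comm_eq_card_conjClasses_mul_card]
      have : Nat.card { p : L × L // Commute p.1 p.2 } =
          Nat.card (Σ g : L, Subgroup.centralizer {g}) := by
        apply Nat.card_congr
        exact
          { toFun := fun p => ⟨p.1.1, p.1.2, by
              rw [Subgroup.mem_centralizer_iff]; rintro _ rfl; exact p.2⟩
            invFun := fun p => ⟨(p.1, p.2.1), Subgroup.mem_centralizer_iff.mp p.2.2 _ rfl⟩
            left_inv := fun p => rfl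
            right_inv := fun p => rfl }
      rw [this, Nat.card_sigma]
    have hcc : ∀ g ∉ Z, ∀ ω : Ω, g • ω = ω → Subgroup.centralizer {g} = MulAction.stabilizer L ω := by
      intro g hg ω hω
      ext h
      rw [Subgroup.mem_centralizer_singleton_iff, MulAction.mem_stabilizer_iff]
      exact ⟨fun hh => hcent g hg ω hω h hh, fun hh => hcomm ω h g hh hω⟩
    have h3 : ∀ g ∈ Finset.univ.filter (fun g : L => g ∉ Z), 2 * Nat.card (Subgroup.centralizer {g}) =
        ∑ ω : Ω, (if g • ω = ω then 1 else 0) * (E ω * z) := by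
      intro g hg
      rw [Finset.mem_filter] at hg
      rw [← h2 g hg.2, hfix, Finset.sum_mul]
      apply Finset.sum_congr rfl
      intro ω _
      split_ifs with h
      · rw [hcc g hg.2 ω h, hE]
      · simp
    have h4 : 2 * ∑ g ∈ Finset.univ.filter (fun g : L => g ∉ Z), Nat.card (Subgroup.centralizer {g}) =
        ∑ q : Q, N * z * (z * (E q.out - 1)) := by
      rw [Finset.mul_sum, Finset.sum_congr rfl h3, Finset.sum_comm]
      rw [Finset.sum_congr rfl (g := fun ω => (E ω - 1) * z * (E ω * z)) (by
        intro ω _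
        rw [← Finset.sum_mul, hout])]
      rw [hsum (fun e => (e - 1) * z * (e * z))]
      apply Finset.sum_congr rfl
      intro q _
      rw [← hEF q.out]; ring
    have h5 : ∑ g ∈ Finset.univ.filter (fun g : L => g ∈ Z), Nat.card (Subgroup.centralizer {g}) =
        z * (N * z) := by
      rw [Finset.sum_congr rfl (g := fun _ => N * z)]
      · rw [Finset.sum_const, hZcard, smul_eq_mul]
      · intro g hg
        rw [Finset.mem_filter] at hg
        rw [← hLN]
        have : Subgroup.centralizer {g} = ⊤ := by
          ext h
          simp only [Subgroup.mem_top, iff_true]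
          rw [Subgroup.mem_centralizer_singleton_iff]
          exact hZc g hg.2 h
        rw [this, Subgroup.card_top]
    rw [← Finset.sum_filter_add_sum_filter_not Finset.univ (fun g : L => g ∈ Z), h5] at h1
    rw [← Finset.mul_sum, ← Finset.mul_sum] at h4
    apply Nat.eq_of_mul_eq_mul_right (Nat.mul_pos hN0 hz0)
    nlinarith [h1, h4]
  have hstabA : ∀ ω : Ω, (F ω = 1 ∨ F ω = 2) → ∃ A : Subgroup L,
      (∀ x ∈ A, ∀ y ∈ A, x * y = y * x) ∧ (A.index = 1 ∨ A.index = 2) := by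
    intro ω hω
    exact ⟨MulAction.stabilizer L ω, fun x hx y hy => hcomm ω x y hx hy, hω⟩
  have hF2 : ∀ ω, 2 * F ω ≤ N := fun ω => by
    rw [← hEF ω]; exact Nat.mul_le_mul_right _ (hE2 ω)
  have hF0 : ∀ ω, 0 < F ω := fun ω => Nat.pos_of_ne_zero Subgroup.index_ne_zero_of_finite
  have hQ3 : Fintype.card Q ≤ 3 := by
    have h1 : 2 * ∑ q : Q, F q.out ≤ Fintype.card Q * N := by
      rw [Finset.mul_sum]
      calc ∑ q : Q, 2 * F q.out ≤ ∑ q : Q, N := Finset.sum_le_sum fun q _ => hF2 _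
        _ = Fintype.card Q * N := by simp
    by_contra h
    have h3 : 4 * N ≤ Fintype.card Q * N := Nat.mul_le_mul_right _ (by omega)
    nlinarith
  obtain ⟨o, ho⟩ : ∃ o, Fintype.card Q = o := ⟨_, rfl⟩
  rw [ho] at hmain hQ3
  have eQ : Fin o ≃ Q := (Fintype.equivFinOfCardEq ho).symm
  have hsumQ : ∀ φ : Q → ℕ, ∑ q, φ q = ∑ i, φ (eQ i) := fun φ => (eQ.sum_comp φ).symm
  rw [hsumQ] at hmain hcls
  interval_cases o
  · left
    simp at hmain
    refine ⟨Z, fun x hx y hy => hZc y hy x, Or.inl ?_⟩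
    omega
  · exfalso
    have h1 := hF2 (eQ 0).out
    have h3 := hF0 (eQ 0).out
    simp at hmain
    omega
  · left
    have h1 := hF0 (eQ 0).out
    have h3 := hF0 (eQ 1).out
    rw [Fin.sum_univ_two] at hmain
    apply hstabA (eQ 0).out
    omega
  -- three orbits
  obtain ⟨σ, hσ⟩ : ∃ σ : Fin 3 ≃ Q, E (σ 0).out ≤ E (σ 1).out ∧ E (σ 1).out ≤ E (σ 2).out := by
    let τ := Tuple.sort (fun i => E (eQ i).out)
    have hm := Tuple.monotone_sort (fun i => E (eQ i).out)
    refine ⟨τ.trans eQ, hm (by decide : (0 : Fin 3) ≤ 1), hm (by decide : (1 : Fin 3) ≤ 2)⟩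
  have hsumQ' : ∀ φ : Q → ℕ, ∑ i, φ (eQ i) = φ (σ 0) + φ (σ 1) + φ (σ 2) := fun φ => by
    rw [← hsumQ, ← Fin.sum_univ_three (fun i => φ (σ i))]; exact (σ.sum_comp φ).symm
  rw [hsumQ' (fun q => F q.out)] at hmain
  rw [hsumQ' (fun q => E q.out - 1)] at hcls
  have hrep : ∀ ω : Ω, ∃ i : Fin 3, ω ∈ MulAction.orbit L (σ i).out := by
    intro ω
    refine ⟨σ.symm (Quotient.mk _ ω), ?_⟩
    rw [Equiv.apply_symm_apply, ← MulAction.orbitRel_apply, ← Quotient.eq (r := MulAction.orbitRel L Ω),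
      Quotient.out_eq]
  have hEi : ∀ ω : Ω, E ω = E (σ 0).out ∨ E ω = E (σ 1).out ∨ E ω = E (σ 2).out := by
    intro ω
    obtain ⟨i, g, hi⟩ := hrep ω
    simp only at hi
    rw [← hi, hEorb]
    fin_cases i
    · exact Or.inl rfl
    · exact Or.inr (Or.inl rfl)
    · exact Or.inr (Or.inr rfl)
  rcases dickson_arith3 N _ _ _ _ _ _ (hEF (σ 0).out) (hEF (σ 1).out) (hEF (σ 2).out) (hE2 _)
    hσ.1 hσ.2 (by omega) with h | ⟨h0, h1, h3⟩
  · left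
    exact hstabA _ (Or.inr h)
  right
  have hcc : ∀ g ∉ Z, ∀ ω : Ω, g • ω = ω → Subgroup.centralizer {g} = MulAction.stabilizer L ω := by
    intro g hg ω hω
    ext h
    rw [Subgroup.mem_centralizer_singleton_iff, MulAction.mem_stabilizer_iff]
    exact ⟨fun hh => hcent g hg ω hω h hh, fun hh => hcomm ω h g hh hω⟩
  refine ⟨E (σ 2).out, N, h3, hLN, ?_, ?_, ?_⟩
  · rw [hcls, h0, h1]
    have := hE2 (σ 2).out
    obtain ⟨e, he⟩ := Nat.exists_eq_add_of_le this
    rw [he, show 2 + e - 1 = 1 + e by omega]; ring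
  · intro g hg
    obtain ⟨⟨ω, hω⟩⟩ : Nonempty (MulAction.fixedBy Ω g) := by
      by_contra hemp
      rw [not_nonempty_iff] at hemp
      have := h2 g hg
      rw [Nat.card_of_isEmpty] at this
      omega
    refine ⟨E ω, ?_, ?_, ?_⟩
    · have := hEi ω
      rw [h0, h1] at this
      exact this
    · rw [hcc g hg ω hω, hE]
    · have hn : (Z.subgroupOf (MulAction.stabilizer L ω)).Normal := ⟨by
        intro n hn k
        rw [Subgroup.mem_subgroupOf] at hn ⊢
        have := hZc n hn k
        simp only [Subgroup.coe_mul, InvMemClass.coe_inv]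
        rw [this]
        simpa using hn⟩
      intro x hx
      have := Subgroup.pow_index_mem (Z.subgroupOf (MulAction.stabilizer L ω))
        ⟨x, hcent g hg ω hω x hx⟩
      rw [Subgroup.mem_subgroupOf] at this
      exact this
  · intro hm
    let ω := (σ 1).out
    obtain ⟨g, hg, hgω⟩ := hne ω
    have hcard2 := h2 g hg
    have : ∃ ω', g • ω' = ω' ∧ ω' ≠ ω ∧ ∀ ω'', g • ω'' = ω'' → ω'' = ω ∨ ω'' = ω' := by
      obtain ⟨a, b, hab, huniv⟩ := Nat.card_eq_two_iff.mp hcard2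
      have hmem : ∀ x : MulAction.fixedBy Ω g, x = a ∨ x = b := by
        intro x
        have : x ∈ ({a, b} : Set (MulAction.fixedBy Ω g)) := by rw [huniv]; trivial
        simpa using this
      rcases hmem ⟨ω, hgω⟩ with h | h
      · refine ⟨b, b.2, ?_, ?_⟩
        · intro hb; apply hab; rw [← h]; exact Subtype.ext hb.symm
        · intro x hx
          rcases hmem ⟨x, hx⟩ with h' | h'
          · left; rw [← h] at h'; exact congrArg Subtype.val h'
          · right; exact congrArg Subtype.val h'
      · refine ⟨a, a.2, ?_, ?_⟩
        · intro hb; apply hab; rw [← h]; exact Subtype.ext hb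
        · intro x hx
          rcases hmem ⟨x, hx⟩ with h' | h'
          · right; exact congrArg Subtype.val h'
          · left; rw [← h] at h'; exact congrArg Subtype.val h'
    obtain ⟨ω', hgω', hne', honly⟩ := this
    have hst : MulAction.stabilizer L ω' = MulAction.stabilizer L ω := by
      rw [← hcc g hg ω' hgω', ← hcc g hg ω hgω]
    have hE' : E ω' = 3 := by
      have : E ω' = E ω := by
        apply Nat.eq_of_mul_eq_mul_right hz0
        rw [← hE, ← hE, hst]
      rw [this]; exact h1
    obtain ⟨h, hh⟩ : ∃ h : L, h • ω = ω' := by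
      obtain ⟨i, k, hk⟩ := hrep ω'
      simp only at hk
      have : E ω' = E (σ i).out := by rw [← hk, hEorb]
      fin_cases i
      · change _ = E (σ 0).out at this; omega
      · exact ⟨k, hk⟩
      · change _ = E (σ 2).out at this; omega
    have hconj : ∀ x ∈ MulAction.stabilizer L ω, h * x * h⁻¹ ∈ MulAction.stabilizer L ω := by
      intro x hx
      rw [← hst, MulAction.mem_stabilizer_iff, ← hh, ← mul_smul]
      rw [MulAction.mem_stabilizer_iff] at hx
      rw [inv_mul_cancel_right, mul_smul, hx]
    refine ⟨MulAction.stabilizer L ω, h, hZle ω, fun x hx y hy => hcomm ω x y hx hy, ?_, ?_, ?_, hconj,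
      ?_⟩
    · rw [hE]; rw [show E ω = 3 from h1]
    · intro hhs
      rw [MulAction.mem_stabilizer_iff] at hhs
      exact hne' (hh.symm.trans hhs)
    · have hgg : h⁻¹ * g * h ∈ MulAction.stabilizer L ω := by
        rw [MulAction.mem_stabilizer_iff, mul_smul, hh, mul_smul, hgω', ← hh, inv_smul_smul]
      have : g • (h • ω') = h • ω' := by
        rw [← hst, MulAction.mem_stabilizer_iff] at hgg
        have := congrArg (h • ·) hgg
        simp only [← mul_smul] at this
        rw [← mul_smul]
        rw [← this]
        congr 1
        group
      rw [MulAction.mem_stabilizer_iff, pow_two, mul_smul, hh]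
      rcases honly _ this with h' | h'
      · exact h'
      · exfalso
        apply hne'
        rw [← hh] at h'
        have := MulAction.injective h h'
        rw [← hh]
        exact this
    · intro x hx hxZ y hy
      exact hcent x hxZ ω hx y hy
end


section
variable {K W : Type*} [Field K] [AddCommGroup W] [Module K W]

lemma two_dim_pair (h2 : Module.finrank K W = 2) (v u : W) (hv : v ≠ 0)
    (hu : u ∉ Submodule.span K {v}) :
    (∀ x : W, ∃ a b : K, x = a • v + b • u) ∧ ∀ a b : K, a • v + b • u = 0 → a = 0 ∧ b = 0 := by
  have hli : LinearIndependent K ![v, u] := by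
    rw [LinearIndependent.pair_iff' hv]
    intro a ha
    exact hu (Submodule.mem_span_singleton.mpr ⟨a, ha⟩)
  refine ⟨?_, fun a b hab => LinearIndependent.pair_iff.mp hli a b hab⟩
  intro x
  let B := basisOfLinearIndependentOfCardEqFinrank hli (by simp [h2])
  have := B.sum_repr x
  rw [Fin.sum_univ_two] at this
  refine ⟨B.repr x 0, B.repr x 1, ?_⟩
  conv_lhs => rw [← this]
  simp [B]

variable {L : Type*} [Group L] {ρ : L →* Module.End K W}

lemma FPF.diag [Finite L] [IsAlgClosed K] (h : FPF ρ) (h2 : Module.finrank K W = 2) (g : L)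
    (hg : ∀ μ : K, ρ g ≠ μ • (1 : Module.End K W)) :
    ∃ (v w : W) (α β : K), α ≠ β ∧ v ≠ 0 ∧ w ≠ 0 ∧ ρ g v = α • v ∧ ρ g w = β • w ∧
      (∀ x : W, ∃ a b : K, x = a • v + b • w) ∧ ∀ a b : K, a • v + b • w = 0 → a = 0 ∧ b = 0 := by
  have : FiniteDimensional K W := FiniteDimensional.of_finrank_pos (by omega)
  have : Nontrivial W := Module.nontrivial_of_finrank_pos (R := K) (by omega)
  obtain ⟨α, hα⟩ := Module.End.exists_eigenvalue (ρ g)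
  obtain ⟨v, hv⟩ := hα.exists_hasEigenvector
  have hgv := hv.apply_eq_smul
  have hv0 := hv.2
  obtain ⟨u, hu⟩ : ∃ u, u ∉ Submodule.span K {v} := by
    by_contra hall
    push Not at hall
    have htop : Submodule.span K {v} = ⊤ := by ext x; simp [hall x]
    have := finrank_span_singleton (K := K) hv0
    rw [htop, finrank_top] at this
    omega
  obtain ⟨hex, hli⟩ := two_dim_pair h2 v u hv0 hu
  obtain ⟨γ, β, hgu⟩ := hex (ρ g u)
  have hα0 : α ≠ 0 := by
    rintro rfl
    apply hv0
    have : ρ g⁻¹ (ρ g v) = v := by rw [← Module.End.mul_apply, ← map_mul]; simp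
    rw [← this, hgv]; simp
  have hαβ : α ≠ β := by
    rintro rfl
    have hpow : ∀ n : ℕ, ρ (g ^ n) v = α ^ n • v ∧
        ρ (g ^ (n + 1)) u = ((n + 1 : ℕ) * α ^ n * γ) • v + α ^ (n + 1) • u := by
      intro n
      induction n with
      | zero => simp [hgu]
      | succ n ih =>
        refine ⟨?_, ?_⟩
        · rw [pow_succ', map_mul, Module.End.mul_apply, ih.1, map_smul, hgv, smul_smul, pow_succ]
        · rw [pow_succ', map_mul, Module.End.mul_apply, ih.2, map_add, map_smul, map_smul, hgv, hgu,
            smul_add, smul_smul, smul_smul, smul_smul, ← add_assoc, ← add_smul]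
          congr 2
          · push_cast; ring
          · ring
    have hn0 := h.ne
    obtain ⟨n, hn⟩ := Nat.exists_eq_succ_of_ne_zero (Nat.card_pos (α := L)).ne'
    have h1 : g ^ (n + 1) = 1 := by rw [← Nat.succ_eq_add_one, ← hn]; exact pow_card_eq_one'
    have h3 := (hpow n).2
    have h4 := (hpow (n + 1)).1
    rw [h1, map_one, Module.End.one_apply] at h3 h4
    have h5 : ((n + 1 : ℕ) * α ^ n * γ) • v + (α ^ (n + 1) - 1) • u = 0 := by
      rw [sub_smul, one_smul, ← add_sub_assoc, ← h3, sub_self]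
    have h6 := (hli _ _ h5).1
    rw [hn] at hn0
    have hγ : γ = 0 := by
      rcases mul_eq_zero.mp h6 with h7 | h7
      · rcases mul_eq_zero.mp h7 with h8 | h8
        · exact absurd h8 hn0
        · exact absurd h8 (pow_ne_zero _ hα0)
      · exact h7
    apply hg α
    ext x
    obtain ⟨a, b, rfl⟩ := hex x
    rw [map_add, map_smul, map_smul, hgv, hgu, hγ]
    simp only [zero_smul, zero_add, LinearMap.smul_apply, Module.End.one_apply, smul_add, smul_smul,
      mul_comm]
  have hne : β - α ≠ 0 := sub_ne_zero.mpr hαβ.symm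
  have hw : u + ((β - α)⁻¹ * γ) • v ∉ Submodule.span K {v} := by
    intro hmem
    apply hu
    have h1 : ((β - α)⁻¹ * γ) • v ∈ Submodule.span K {v} :=
      Submodule.smul_mem _ _ (Submodule.mem_span_singleton_self v)
    exact (Submodule.add_mem_iff_left _ h1).mp hmem
  refine ⟨v, u + ((β - α)⁻¹ * γ) • v, α, β, hαβ, hv0, ?_, hgv, ?_, two_dim_pair h2 v _ hv0 hw⟩
  · intro h0
    rw [h0] at hw
    exact hw (zero_mem _)
  · rw [map_add, map_smul, hgv, hgu, smul_add, smul_smul, smul_smul, add_comm (γ • v), add_assoc,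
      ← add_smul]
    congr 2
    field_simp
    ring

/-- elements acting as scalars -/
def scalarSub (ρ : L →* Module.End K W) : Subgroup L where
  carrier := {g | ∃ μ : K, ρ g = μ • (1 : Module.End K W)}
  one_mem' := ⟨1, by simp⟩
  mul_mem' := by
    rintro a b ⟨μ, hμ⟩ ⟨ν, hν⟩
    exact ⟨μ * ν, by rw [map_mul, hμ, hν]; simp [smul_smul, mul_comm]⟩
  inv_mem' := by
    rintro a ⟨μ, hμ⟩
    by_cases h0 : μ = 0
    · refine ⟨1, ?_⟩
      have h1 : ρ a⁻¹ * ρ a = 1 := by rw [← map_mul]; simp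
      have h2 : (1 : Module.End K W) = 0 := by rw [← h1, hμ, h0]; simp
      rw [← mul_one (ρ a⁻¹), h2]; simp
    · refine ⟨μ⁻¹, ?_⟩
      have h1 : ρ a⁻¹ * ρ a = 1 := by rw [← map_mul]; simp
      rw [hμ, mul_smul_comm, mul_one] at h1
      rw [← h1, smul_smul, inv_mul_cancel₀ h0, one_smul]

lemma mem_scalarSub (g : L) : g ∈ scalarSub ρ ↔ ∃ μ : K, ρ g = μ • (1 : Module.End K W) := Iff.rfl

/-- lines fixed by a non-scalar element -/
def DLines (ρ : L →* Module.End K W) : Type _ :=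
  {ω : Submodule K W // (∃ x : W, x ≠ 0 ∧ ω = Submodule.span K {x}) ∧
    ∃ g ∉ scalarSub ρ, ω.map (ρ g) = ω}

lemma scalarSub_conj (g h : L) (hg : g ∉ scalarSub ρ) : h * g * h⁻¹ ∉ scalarSub ρ := by
  rintro ⟨μ, hμ⟩
  apply hg
  refine ⟨μ, ?_⟩
  have : g = h⁻¹ * (h * g * h⁻¹) * h := by group
  rw [this, map_mul, map_mul, hμ]
  simp only [mul_smul_comm, mul_one, smul_mul_assoc]
  rw [← map_mul]; simp

instance dlinesAction (ρ : L →* Module.End K W) : MulAction L (DLines ρ) where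
  smul g ω := ⟨ω.1.map (ρ g), by
    obtain ⟨ω, ⟨x, hx, hω⟩, k, hk, hkω⟩ := ω
    refine ⟨⟨ρ g x, ?_, ?_⟩, g * k * g⁻¹, scalarSub_conj k g hk, ?_⟩
    · intro h0
      apply hx
      have : ρ g⁻¹ (ρ g x) = x := by rw [← Module.End.mul_apply, ← map_mul]; simp
      rw [← this, h0, map_zero]
    · simp only
      rw [hω, Submodule.map_span, Set.image_singleton]
    · simp only
      rw [← Submodule.map_comp, ← Module.End.mul_eq_comp, ← map_mul, inv_mul_cancel_right, map_mul,
        Module.End.mul_eq_comp, Submodule.map_comp, hkω]⟩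
  one_smul ω := by
    apply Subtype.ext
    change ω.1.map (ρ 1) = ω.1
    rw [map_one]; exact Submodule.map_id _
  mul_smul g h ω := by
    apply Subtype.ext
    change ω.1.map (ρ (g * h)) = (ω.1.map (ρ h)).map (ρ g)
    rw [map_mul, Module.End.mul_eq_comp, Submodule.map_comp]

lemma line_fixed_iff (g : L) (x : W) (hx : x ≠ 0) :
    (Submodule.span K {x}).map (ρ g) = Submodule.span K {x} ↔ ∃ μ : K, ρ g x = μ • x := by
  rw [Submodule.map_span, Set.image_singleton]
  constructor
  · intro h
    have : ρ g x ∈ Submodule.span K {x} := by rw [← h]; exact Submodule.mem_span_singleton_self _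
    obtain ⟨μ, hμ⟩ := Submodule.mem_span_singleton.mp this
    exact ⟨μ, hμ.symm⟩
  · rintro ⟨μ, hμ⟩
    rw [hμ]
    apply Submodule.span_singleton_smul_eq
    rw [isUnit_iff_ne_zero]
    rintro rfl
    apply hx
    have : ρ g⁻¹ (ρ g x) = x := by rw [← Module.End.mul_apply, ← map_mul]; simp
    rw [← this, hμ]; simp

theorem dickson [Finite L] [IsAlgClosed K] (h : FPF ρ) (h2 : Module.finrank K W = 2) :
    (∃ A : Subgroup L, (∀ x ∈ A, ∀ y ∈ A, x * y = y * x) ∧ (A.index = 1 ∨ A.index = 2)) ∨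
    ∃ m N, DII L (scalarSub ρ) m N := by
  have : FiniteDimensional K W := FiniteDimensional.of_finrank_pos (by omega)
  have : Nontrivial W := Module.nontrivial_of_finrank_pos (R := K) (by omega)
  have hpair : ∀ g ∉ scalarSub ρ, ∃ a b : Submodule K W, a ≠ b ∧
      (∃ x : W, x ≠ 0 ∧ a = Submodule.span K {x}) ∧ (∃ x : W, x ≠ 0 ∧ b = Submodule.span K {x}) ∧
      a.map (ρ g) = a ∧ b.map (ρ g) = b ∧ (∀ ω : Submodule K W, (∃ x : W, x ≠ 0 ∧ ω = Submodule.span K {x}) →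
        ω.map (ρ g) = ω → ω = a ∨ ω = b) ∧ ∀ k, k * g = g * k → a.map (ρ k) = a ∧ b.map (ρ k) = b := by
    intro g hg
    obtain ⟨v, w, α, β, hαβ, hv, hw, hgv, hgw, hex, hli⟩ := h.diag h2 g (fun μ hμ => hg ⟨μ, hμ⟩)
    refine ⟨Submodule.span K {v}, Submodule.span K {w}, ?_, ⟨v, hv, rfl⟩, ⟨w, hw, rfl⟩,
      (line_fixed_iff g v hv).mpr ⟨α, hgv⟩, (line_fixed_iff g w hw).mpr ⟨β, hgw⟩, ?_, ?_⟩
    · intro heq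
      have : v ∈ Submodule.span K {w} := by rw [← heq]; exact Submodule.mem_span_singleton_self _
      obtain ⟨c, hc⟩ := Submodule.mem_span_singleton.mp this
      have := (hli 1 (-c) (by rw [← hc]; simp)).1
      exact one_ne_zero this
    · rintro ω ⟨x, hx, rfl⟩ hfix
      obtain ⟨c, hc⟩ := (line_fixed_iff g x hx).mp hfix
      obtain ⟨a, b, rfl⟩ := hex x
      rw [map_add, map_smul, map_smul, hgv, hgw, smul_add] at hc
      have h3 : (a * α - c * a) • v + (b * β - c * b) • w = 0 := by
        rw [sub_smul, sub_smul, ← smul_smul, ← smul_smul, ← smul_smul, ← smul_smul,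
          sub_add_sub_comm, hc, sub_self]
      obtain ⟨h4, h5⟩ := hli _ _ h3
      by_cases hb : b = 0
      · left
        subst hb
        have ha : a ≠ 0 := by rintro rfl; simp at hx
        rw [zero_smul, add_zero]
        exact Submodule.span_singleton_smul_eq (isUnit_iff_ne_zero.mpr ha) v
      · right
        have ha : a = 0 := by
          by_contra ha
          apply hαβ
          have h6 : α = c := by
            apply mul_left_cancel₀ ha; linear_combination h4
          have h7 : β = c := by
            apply mul_left_cancel₀ hb; linear_combination h5
          rw [h6, h7]
        subst ha
        rw [zero_smul, zero_add]
        exact Submodule.span_singleton_smul_eq (isUnit_iff_ne_zero.mpr hb) w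
    · intro k hk
      have hcomm : ∀ x, ρ g (ρ k x) = ρ k (ρ g x) := by
        intro x
        rw [← Module.End.mul_apply, ← Module.End.mul_apply, ← map_mul, ← map_mul, hk]
      constructor
      · rw [line_fixed_iff k v hv]
        obtain ⟨a, b, hab⟩ := hex (ρ k v)
        have h3 := hcomm v
        rw [hgv, map_smul, hab, map_add, map_smul, map_smul, hgv, hgw] at h3
        have h4 : (0 : K) • v + (b * β - α * b) • w = 0 := by
          rw [sub_smul, ← smul_smul, ← smul_smul, zero_smul, zero_add, sub_eq_zero]
          rw [smul_add, smul_comm a α v] at h3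
          exact add_left_cancel h3
        have h5 := (hli _ _ h4).2
        have hb : b = 0 := by
          by_contra hb
          exact hαβ (mul_left_cancel₀ hb (by linear_combination -h5))
        exact ⟨a, by rw [hab, hb]; simp⟩
      · rw [line_fixed_iff k w hw]
        obtain ⟨a, b, hab⟩ := hex (ρ k w)
        have h3 := hcomm w
        rw [hgw, map_smul, hab, map_add, map_smul, map_smul, hgv, hgw] at h3
        have h4 : (a * α - β * a) • v + (0 : K) • w = 0 := by
          rw [sub_smul, ← smul_smul, ← smul_smul, zero_smul, add_zero, sub_eq_zero]
          rw [smul_add, smul_comm b β w] at h3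
          exact add_right_cancel h3
        have h5 := (hli _ _ h4).1
        have ha : a = 0 := by
          by_contra ha
          exact hαβ (mul_left_cancel₀ ha (by linear_combination h5))
        exact ⟨b, by rw [hab, ha]; simp⟩
  have hfinΩ : Finite (DLines ρ) := by
    choose! a b hab using hpair
    have : Function.Injective (fun ω : DLines ρ => (⟨ω.1, by
        obtain ⟨ω, hx, g, hg, hgω⟩ := ω
        rcases (hab g hg).2.2.2.2.2.1 ω hx hgω with h' | h'
        · exact Set.mem_union_left _ ⟨g, h'.symm⟩
        · exact Set.mem_union_right _ ⟨g, h'.symm⟩⟩ : (Set.range a ∪ Set.range b : Set (Submodule K W)))) := by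
      intro ω ω' hh
      have h1 : ω.1 = ω'.1 := (Subtype.mk.injEq _ _ _ _).mp hh
      exact Subtype.ext h1
    have hf : (Set.range a ∪ Set.range b).Finite := (Set.finite_range a).union (Set.finite_range b)
    have := hf.to_subtype
    exact Finite.of_injective _ ‹Function.Injective _›
  have hsm : ∀ (g : L) (ω : DLines ρ), g • ω = ω ↔ ω.1.map (ρ g) = ω.1 := by
    intro g ω
    constructor
    · intro hh; exact congrArg Subtype.val hh
    · intro hh; exact Subtype.ext hh
  apply dickson_abs (Ω := DLines ρ) (scalarSub ρ)
  · rintro g ⟨μ, hμ⟩ k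
    apply h.injective
    rw [map_mul, map_mul, hμ]; simp
  · rintro g ⟨μ, hμ⟩ ω
    rw [hsm]
    obtain ⟨⟨x, hx, hω⟩, -⟩ := ω.2
    rw [hω, line_fixed_iff g x hx]
    exact ⟨μ, by rw [hμ]; simp⟩
  · intro g hg
    obtain ⟨a, b, hab, ha, hb, hga, hgb, honly, -⟩ := hpair g hg
    rw [Nat.card_eq_two_iff]
    let A : DLines ρ := ⟨a, ha, g, hg, hga⟩
    let B : DLines ρ := ⟨b, hb, g, hg, hgb⟩
    refine ⟨⟨A, (hsm _ _).mpr hga⟩, ⟨B, (hsm _ _).mpr hgb⟩, ?_, ?_⟩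
    · intro hh
      apply hab
      have h1 : A = B := congrArg Subtype.val hh
      exact congrArg Subtype.val h1
    · ext ⟨ω, hω⟩
      simp only [Set.mem_insert_iff, Set.mem_singleton_iff, Set.mem_univ, iff_true]
      rcases honly ω.1 ω.2.1 ((hsm _ _).mp hω) with h' | h'
      · left; exact Subtype.ext (Subtype.ext h')
      · right; exact Subtype.ext (Subtype.ext h')
  · intro ω
    obtain ⟨-, g, hg, hgω⟩ := ω.2
    exact ⟨g, hg, (hsm _ _).mpr hgω⟩
  · intro ω g k hg hk
    rw [hsm] at hg hk
    obtain ⟨⟨x, hx, hω⟩, -⟩ := ω.2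
    rw [hω, line_fixed_iff _ x hx] at hg hk
    obtain ⟨μ, hμ⟩ := hg
    obtain ⟨ν, hν⟩ := hk
    by_contra hne
    apply hx
    apply h.fpf ((k * g)⁻¹ * (g * k)) (by
      intro h1
      rw [inv_mul_eq_one] at h1
      exact hne h1.symm)
    have h3 : ρ (g * k) x = ρ (k * g) x := by
      rw [map_mul, map_mul, Module.End.mul_apply, Module.End.mul_apply, hν, hμ, map_smul, map_smul, hμ,
        hν, smul_comm]
    rw [map_mul, Module.End.mul_apply, h3, ← Module.End.mul_apply, ← map_mul]
    simp
  · intro g hg ω hgω k hk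
    obtain ⟨a, b, hab, ha, hb, hga, hgb, honly, hc⟩ := hpair g hg
    rw [hsm] at hgω ⊢
    rcases honly ω.1 ω.2.1 hgω with h' | h'
    · rw [h']; exact (hc k hk).1
    · rw [h']; exact (hc k hk).2

end


/-- a group with the Frobenius complement conditions and an involution `z` -/
structure Ctx (G : Type*) [Group G] (z : G) : Prop where
  fc : FC G
  z1 : z ≠ 1
  z2 : z * z = 1

section
variable {G : Type*} [Group G] {z : G}

lemma Ctx.eq_z (h : Ctx G z) (x : G) (hx : x ≠ 1) (hx2 : x * x = 1) : x = z :=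
  h.fc.inv x z hx h.z1 (by rw [pow_two, hx2]) (by rw [pow_two, h.z2])

lemma Ctx.zc (h : Ctx G z) (g : G) : g * z = z * g := by
  have : g * z * g⁻¹ = z := by
    apply h.eq_z
    · intro h1
      apply h.z1
      rw [mul_inv_eq_one] at h1
      simpa using h1
    · calc g * z * g⁻¹ * (g * z * g⁻¹) = g * (z * z) * g⁻¹ := by group
        _ = 1 := by rw [h.z2]; group
  rwa [mul_inv_eq_iff_eq_mul] at this

lemma Ctx.zinv (h : Ctx G z) : z⁻¹ = z := inv_eq_of_mul_eq_one_left h.z2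

/-- pairs generating a quaternion group -/
structure QP (z i j : G) : Prop where
  ii : i * i = z
  jj : j * j = z
  ji : j * i * j⁻¹ = i⁻¹

lemma Ctx.jinv (h : Ctx G z) {x : G} (hx : x * x = z) : x⁻¹ = x * z := by
  rw [inv_eq_iff_mul_eq_one, ← mul_assoc, hx, h.z2]

lemma Ctx.j_ne (h : Ctx G z) {x : G} (hx : x * x = z) : x ≠ x * z := by
  intro h1
  exact h.z1 (by simpa using h1)

lemma Ctx.conjJ (h : Ctx G z) {x : G} (hx : x * x = z) (g : G) : (g * x * g⁻¹) * (g * x * g⁻¹) = z := by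
  calc (g * x * g⁻¹) * (g * x * g⁻¹) = g * (x * x) * g⁻¹ := by group
    _ = z := by rw [hx, h.zc]; group

lemma Ctx.pmJ (h : Ctx G z) {x : G} (hx : x * x = z) : (x * z) * (x * z) = z := by
  rw [mul_assoc, ← mul_assoc z, ← h.zc x, mul_assoc x, h.z2, mul_one, hx]

lemma Ctx.orderJ (h : Ctx G z) {x : G} (hx : x * x = z) : orderOf x = 4 := by
  have h4 : x ^ (2 ^ (1 + 1)) = 1 := by
    rw [pow_succ, pow_mul, pow_one, pow_two, pow_two, hx, h.z2]
  have h2 : ¬ x ^ (2 ^ 1) = 1 := by rw [pow_one, pow_two, hx]; exact h.z1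
  have : Fact (Nat.Prime 2) := ⟨Nat.prime_two⟩
  have := orderOf_eq_prime_pow h2 h4
  simpa using this

lemma QP.ij (h : Ctx G z) {i j : G} (q : QP z i j) : j * i = i * j * z := by
  have := q.ji
  rw [mul_inv_eq_iff_eq_mul, h.jinv q.ii] at this
  rw [this, mul_assoc, mul_assoc, h.zc j]

lemma QP.of_anti (h : Ctx G z) {i j : G} (hi : i * i = z) (hj : j * j = z) (hji : j * i = i * j * z) :
    QP z i j := ⟨hi, hj, by rw [mul_inv_eq_iff_eq_mul, h.jinv hi, hji, mul_assoc, mul_assoc, h.zc j]⟩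

lemma QP.symm (h : Ctx G z) {i j : G} (q : QP z i j) : QP z j i :=
  QP.of_anti h q.jj q.ii (by rw [q.ij h, mul_assoc, h.z2, mul_one])

lemma QP.kk (h : Ctx G z) {i j : G} (q : QP z i j) : (i * j) * (i * j) = z := by
  calc (i * j) * (i * j) = i * (j * i) * j := by group
    _ = i * (i * j * z) * j := by rw [q.ij h]
    _ = (i * i) * (j * (z * j)) := by group
    _ = (i * i) * ((j * j) * z) := by rw [← h.zc j, ← mul_assoc j]
    _ = z := by rw [q.ii, q.jj, h.z2, mul_one]

lemma QP.k (h : Ctx G z) {i j : G} (q : QP z i j) : QP z i (i * j) :=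
  QP.of_anti h q.ii (q.kk h) (by
    rw [mul_assoc i j i, q.ij h]; simp only [mul_assoc])

lemma QP.conj (h : Ctx G z) {i j : G} (q : QP z i j) (g : G) : QP z (g * i * g⁻¹) (g * j * g⁻¹) :=
  ⟨h.conjJ q.ii g, h.conjJ q.jj g, by
    have := q.ji
    calc g * j * g⁻¹ * (g * i * g⁻¹) * (g * j * g⁻¹)⁻¹ = g * (j * i * j⁻¹) * g⁻¹ := by group
      _ = _ := by rw [this]; group⟩

lemma QP.neg (h : Ctx G z) {i j : G} (q : QP z i j) : QP z (i * z) j :=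
  QP.of_anti h (h.pmJ q.ii) q.jj (by
    rw [← mul_assoc, q.ij h, mul_assoc i z j, ← h.zc j]
    simp only [mul_assoc])

/-- explicit elements of the quaternion group -/
def InQ (z i j x : G) : Prop :=
  x = 1 ∨ x = z ∨ x = i ∨ x = i * z ∨ x = j ∨ x = j * z ∨ x = i * j ∨ x = i * j * z

lemma QP.mul_i (h : Ctx G z) {i j : G} (q : QP z i j) {x : G} (hx : InQ z i j x) :
    InQ z i j (i * x) := by
  have hz : ∀ a, a * z * z = a := fun a => by rw [mul_assoc, h.z2, mul_one]
  have e1 : ∀ a, i * (i * a) = a * z := fun a => by rw [← mul_assoc, q.ii, h.zc]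
  rcases hx with rfl | rfl | rfl | rfl | rfl | rfl | rfl | rfl <;>
    simp only [InQ, mul_one, e1, q.ii, mul_assoc, h.z2] <;> simp

lemma QP.mul_j (h : Ctx G z) {i j : G} (q : QP z i j) {x : G} (hx : InQ z i j x) :
    InQ z i j (j * x) := by
  have e1 : ∀ a, j * (j * a) = a * z := fun a => by rw [← mul_assoc, q.jj, h.zc]
  have e2 : ∀ a, j * (i * a) = i * (j * (a * z)) := fun a => by
    rw [← mul_assoc, q.ij h, mul_assoc, mul_assoc, h.zc a]
  have e3 : j * i = i * (j * z) := by rw [q.ij h, mul_assoc]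
  rcases hx with rfl | rfl | rfl | rfl | rfl | rfl | rfl | rfl <;>
    simp only [InQ, mul_one, e1, e2, e3, q.jj, mul_assoc, h.z2, ← h.zc] <;> simp [h.z2]

/-- the quaternion subgroup -/
def Qs (i j : G) : Subgroup G := Subgroup.closure {i, j}

lemma mem_Qs_i (i j : G) : i ∈ Qs i j := Subgroup.subset_closure (by simp)
lemma mem_Qs_j (i j : G) : j ∈ Qs i j := Subgroup.subset_closure (by simp)

lemma QP.mem_iff (h : Ctx G z) {i j : G} (q : QP z i j) (x : G) : x ∈ Qs i j ↔ InQ z i j x := by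
  have hz : z ∈ Qs i j := by rw [← q.ii]; exact mul_mem (mem_Qs_i i j) (mem_Qs_i i j)
  have hzm : ∀ {x}, InQ z i j x → InQ z i j (z * x) := by
    intro x hx
    have e : z * x = i * (i * x) := by rw [← mul_assoc, q.ii]
    rw [e]
    exact q.mul_i h (q.mul_i h hx)
  constructor
  · intro hx
    induction hx using Subgroup.closure_induction_left with
    | one => exact Or.inl rfl
    | mul_left a ha b hb ih =>
      rcases ha with rfl | rfl
      · exact q.mul_i h ih
      · exact q.mul_j h ih
    | inv_mul_cancel a ha b hb ih =>
      rcases ha with rfl | rfl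
      · rw [h.jinv q.ii, mul_assoc]
        exact q.mul_i h (hzm ih)
      · rw [h.jinv q.jj, mul_assoc]
        exact q.mul_j h (hzm ih)
  · have hi := mem_Qs_i i j
    have hj := mem_Qs_j i j
    rintro (rfl | rfl | rfl | rfl | rfl | rfl | rfl | rfl)
    · exact one_mem _
    · exact hz
    · exact hi
    · exact mul_mem hi hz
    · exact hj
    · exact mul_mem hj hz
    · exact mul_mem hi hj
    · exact mul_mem (mul_mem hi hj) hz

lemma Ctx.j_ne_one (h : Ctx G z) {x : G} (hx : x * x = z) : x ≠ 1 := by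
  rintro rfl; exact h.z1 (by rw [← hx, mul_one])

lemma Ctx.j_ne_z (h : Ctx G z) {x : G} (hx : x * x = z) : x ≠ z := by
  rintro rfl; exact h.z1 (by rw [← hx, h.z2])

lemma QP.ne (h : Ctx G z) {i j : G} (q : QP z i j) : i ≠ j ∧ i ≠ j * z := by
  have := q.ij h
  constructor
  · rintro rfl
    rw [q.ii, h.z2] at this
    exact h.z1 this
  · intro h1
    rw [h1] at this
    have h2 : j * (j * z) = 1 := by rw [← mul_assoc, q.jj, h.z2]
    have h3 : j * z * j * z = z := by
      rw [mul_assoc]; exact h.pmJ q.jj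
    rw [h2, h3] at this
    exact h.z1 this.symm

lemma Ctx.pm_eq (h : Ctx G z) {x y : G} : x = y * z ↔ x * z = y := by
  constructor
  · rintro rfl; rw [mul_assoc, h.z2, mul_one]
  · rintro rfl; rw [mul_assoc, h.z2, mul_one]

lemma QP.card (h : Ctx G z) {i j : G} (q : QP z i j) : Nat.card (Qs i j) = 8 := by
  classical
  have hset : (Qs i j : Set G) =
      (({1, z, i, i * z, j, j * z, i * j, i * j * z} : Finset G) : Set G) := by
    ext x
    rw [SetLike.mem_coe, q.mem_iff h]
    simp [InQ]
  have : Nat.card (Qs i j) = ({1, z, i, i * z, j, j * z, i * j, i * j * z} : Finset G).card := by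
    rw [← Set.ncard_coe_finset, ← hset]; rfl
  rw [this]
  have hk := q.k h
  have a1 := h.j_ne_one q.ii
  have a2 := h.j_ne_z q.ii
  have a3 := h.j_ne_one q.jj
  have a4 := h.j_ne_z q.jj
  have a5 := h.j_ne_one hk.jj
  have a6 := h.j_ne_z hk.jj
  have b1 := h.j_ne_one (h.pmJ q.ii)
  have b2 := h.j_ne_z (h.pmJ q.ii)
  have b3 := h.j_ne_one (h.pmJ q.jj)
  have b4 := h.j_ne_z (h.pmJ q.jj)
  have b5 := h.j_ne_one (h.pmJ hk.jj)
  have b6 := h.j_ne_z (h.pmJ hk.jj)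
  have c1 := h.j_ne q.ii
  have c2 := h.j_ne q.jj
  have c3 := h.j_ne hk.jj
  have d1 := q.ne h
  have d2 := hk.ne h
  have d3 : QP z j (i * j) := QP.of_anti h q.jj hk.jj (by
    rw [← mul_assoc j, q.ij h, mul_assoc (i * j) z j, ← h.zc j, ← mul_assoc, mul_assoc _ z z, h.z2,
      mul_one])
  have d4 := d3.ne h
  have e1 : i * z ≠ j := fun hh => d1.2 (h.pm_eq.mpr hh)
  have e2 : i * z ≠ i * j := fun hh => d2.2 (h.pm_eq.mpr hh)
  have e3 : j * z ≠ i * j := fun hh => d4.2 (h.pm_eq.mpr hh)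
  have f1 : i * z ≠ j * z := fun hh => d1.1 (mul_right_cancel hh)
  have f2 : i * z ≠ i * j * z := fun hh => d2.1 (mul_right_cancel hh)
  have f3 : j * z ≠ i * j * z := fun hh => d4.1 (mul_right_cancel hh)
  have g0 := h.z1
  rw [Finset.card_insert_of_notMem, Finset.card_insert_of_notMem, Finset.card_insert_of_notMem,
    Finset.card_insert_of_notMem, Finset.card_insert_of_notMem, Finset.card_insert_of_notMem,
    Finset.card_insert_of_notMem, Finset.card_singleton]
  all_goals simp only [Finset.mem_insert, Finset.mem_singleton, not_or]
  all_goals grind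

/-- J-elements of Q -/
lemma QP.mem_J (h : Ctx G z) {i j : G} (q : QP z i j) (x : G) (hx : x ∈ Qs i j) (hxx : x * x = z) :
    (x = i ∨ x = i * z) ∨ (x = j ∨ x = j * z) ∨ (x = i * j ∨ x = i * j * z) := by
  rcases (q.mem_iff h x).mp hx with hh | hh | hh | hh | hh | hh | hh | hh
  · exact absurd hh (h.j_ne_one hxx)
  · exact absurd hh (h.j_ne_z hxx)
  all_goals tauto

lemma QP.not_J (h : Ctx G z) {i j : G} (q : QP z i j) (x : G) (hx : x ∈ Qs i j) (hxx : x * x ≠ z) :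
    x = 1 ∨ x = z := by
  have hk := q.k h
  rcases (q.mem_iff h x).mp hx with hh | hh | hh | hh | hh | hh | hh | hh
  · exact Or.inl hh
  · exact Or.inr hh
  all_goals exfalso; apply hxx; rw [hh]
  · exact q.ii
  · exact h.pmJ q.ii
  · exact q.jj
  · exact h.pmJ q.jj
  · exact hk.jj
  · exact h.pmJ hk.jj

end


/-- generalized quaternion subgroup data -/
structure GQ {G : Type*} [Group G] (z : G) (S : Subgroup G) (s : G) : Prop where
  mem : s ∈ S
  four : 4 ∣ orderOf s
  card : Nat.card S = 2 * orderOf s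
  anti : ∀ g ∈ S, g ∉ Subgroup.zpowers s → g * s * g⁻¹ = s⁻¹ ∧ g * g = z

section
variable {G : Type*} [Group G] [Finite G] {z : G}

lemma two_sub (h : Ctx G z) (S : Subgroup G) (hS : IsPGroup 2 S) :
    (∃ s, S = Subgroup.zpowers s) ∨ ∃ s, GQ z S s := by
  rcases (h.fc.subgroup S).two_group hS with hc | ⟨s, h4, hi, ha⟩
  · left
    obtain ⟨s, hs⟩ := hc.exists_generator
    refine ⟨s, le_antisymm ?_ ?_⟩
    · intro x hx
      obtain ⟨n, hn⟩ := hs ⟨x, hx⟩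
      exact ⟨n, by simpa using congrArg Subtype.val hn⟩
    · rw [Subgroup.zpowers_le]; exact s.2
  · right
    refine ⟨s, s.2, by rwa [Subgroup.orderOf_coe], ?_, ?_⟩
    · rw [Subgroup.orderOf_coe, ← Nat.card_zpowers, ← Subgroup.index_mul_card (Subgroup.zpowers s), hi]
    · intro g hg hgs
      have hgs' : (⟨g, hg⟩ : S) ∉ Subgroup.zpowers s := by
        rintro ⟨n, hn⟩
        exact hgs ⟨n, by simpa using congrArg Subtype.val hn⟩
      obtain ⟨h1, h2, h3⟩ := ha ⟨g, hg⟩ hgs'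
      refine ⟨by simpa using congrArg Subtype.val h1, h.eq_z _ ?_ ?_⟩
      · intro hh
        apply h2
        ext
        simpa [pow_two] using hh
      · have := congrArg Subtype.val h3
        simp only [SubmonoidClass.mk_pow, OneMemClass.coe_one] at this
        rw [← this, show 4 = 2 + 2 from rfl, pow_add, pow_two]

lemma GQ.exists_out {S : Subgroup G} {s : G} (q : GQ z S s) : ∃ g ∈ S, g ∉ Subgroup.zpowers s := by
  by_contra hcon
  push Not at hcon
  have h1 : Nat.card S ≤ Nat.card (Subgroup.zpowers s) := Subgroup.card_le_of_le hcon
  rw [q.card, Nat.card_zpowers] at h1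
  have := orderOf_pos s
  omega

lemma GQ.i0 (h : Ctx G z) {S : Subgroup G} {s : G} (q : GQ z S s) :
    (s ^ (orderOf s / 4)) * (s ^ (orderOf s / 4)) = z := by
  obtain ⟨m, hm⟩ := q.four
  have hpos := orderOf_pos s
  have hm0 : 0 < m := by omega
  rw [hm, Nat.mul_div_cancel_left _ (by norm_num), ← pow_add]
  apply h.eq_z
  · intro hh
    have := orderOf_dvd_of_pow_eq_one hh
    have := Nat.le_of_dvd (by omega) this
    omega
  · rw [← pow_add, show m + m + (m + m) = orderOf s by omega, pow_orderOf_eq_one]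

lemma Ctx.commJ (h : Ctx G z) {x y : G} (hx : x * x = z) (hy : y * y = z) (hc : x * y = y * x) :
    x = y ∨ x = y * z := by
  by_cases h1 : y⁻¹ * x = 1
  · left; rw [inv_mul_eq_one] at h1; exact h1.symm
  · right
    have hc' : x * y⁻¹ = y⁻¹ * x := (Commute.inv_right hc : Commute x y⁻¹)
    have := h.eq_z _ h1 (by
      calc y⁻¹ * x * (y⁻¹ * x) = y⁻¹ * (x * y⁻¹) * x := by group
        _ = y⁻¹ * (y⁻¹ * x) * x := by rw [hc']
        _ = (y * y)⁻¹ * (x * x) := by group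
        _ = 1 := by rw [hx, hy]; group)
    rw [← this]; group

lemma comm_zpowers {s a b : G} (ha : a ∈ Subgroup.zpowers s) (hb : b ∈ Subgroup.zpowers s) :
    a * b = b * a := by
  obtain ⟨m, rfl⟩ := ha
  obtain ⟨n, rfl⟩ := hb
  simp only [← zpow_add, add_comm]

lemma GQ.inv_all {S : Subgroup G} {s : G} (q : GQ z S s) {g : G} (hg : g ∈ S)
    (hgs : g ∉ Subgroup.zpowers s) {x : G} (hx : x ∈ Subgroup.zpowers s) : g * x * g⁻¹ = x⁻¹ := by
  obtain ⟨n, rfl⟩ := hx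
  have := (q.anti g hg hgs).1
  simp only
  rw [← conj_zpow, this, inv_zpow]

lemma perfect_not_solvable (hP : commutator G = ⊤) [Nontrivial G] : ¬ Group.IsSolvable G := by
  intro hs
  have := Group.IsSolvable.commutator_lt_top_of_nontrivial G
  rw [hP] at this
  exact lt_irrefl _ this

lemma perfect_ctx (hF : FC G) (hP : commutator G = ⊤) [Nontrivial G] :
    ∃ z, Ctx G z ∧ ∀ S : Sylow 2 G, ∃ s, GQ z S s := by
  have h2 : Fact (Nat.Prime 2) := ⟨Nat.prime_two⟩
  obtain ⟨S0, hS0⟩ : ∃ S : Sylow 2 G, ¬ IsCyclic S := by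
    by_contra hcon
    push Not at hcon
    have hz : IsZGroup G := ⟨fun p hp P => by
      by_cases hp2 : p = 2
      · subst hp2; exact hcon P
      · have : Fact p.Prime := ⟨hp⟩
        exact (hF.subgroup P).odd_cyclic P.2 hp2⟩
    exact perfect_not_solvable hP inferInstance
  have hall : ∀ S : Sylow 2 G, ¬ IsCyclic S := by
    intro S hS
    exact hS0 ((Sylow.equiv S S0).isCyclic.mp hS)
  obtain ⟨s, h4, -, -⟩ := ((hF.subgroup (S0 : Subgroup G)).two_group S0.2).resolve_left hS0
  obtain ⟨m, hm⟩ := h4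
  have hpos := orderOf_pos s
  have hc : Ctx G ((s ^ (2 * m) : S0) : G) := by
    refine ⟨hF, ?_, ?_⟩
    · intro hh
      have : s ^ (2 * m) = 1 := by ext; exact hh
      have := Nat.le_of_dvd (by omega) (orderOf_dvd_of_pow_eq_one this)
      omega
    · have : s ^ (2 * m) * s ^ (2 * m) = 1 := by
        rw [← pow_add, show 2 * m + 2 * m = orderOf s by omega, pow_orderOf_eq_one]
      simpa using congrArg Subtype.val this
  refine ⟨_, hc, fun S => ?_⟩
  rcases two_sub hc S S.2 with ⟨s, hs⟩ | hh
  · exfalso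
    apply hall S
    rw [hs]
    infer_instance
  · exact hh

lemma perfect_hom_trivial (hP : commutator G = ⊤) {A : Type*} [CommGroup A] (f : G →* A) (g : G) :
    f g = 1 := by
  have := Abelianization.commutator_subset_ker f
  rw [hP] at this
  exact this (Subgroup.mem_top g)

lemma perfect_into (h : Ctx G z) (hP : commutator G = ⊤) (S : Sylow 2 G) {s : G} (q : GQ z S s)
    {x : G} (hx : x * x = z) : ∃ g : G, g * x * g⁻¹ ∈ Subgroup.zpowers s := by
  classical
  have h2 : Fact (Nat.Prime 2) := ⟨Nat.prime_two⟩
  by_contra hcon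
  push Not at hcon
  have := Fintype.ofFinite (G ⧸ Subgroup.zpowers s)
  set f := MulAction.toPermHom G (G ⧸ Subgroup.zpowers s) with hf
  have hsq : (f x) ^ 2 = 1 := by
    rw [← map_pow, pow_two, hx]
    ext y
    induction y using QuotientGroup.induction_on with
    | H g =>
      simp only [hf, MulAction.toPermHom_apply, MulAction.toPerm_apply, Equiv.Perm.coe_one, id]
      rw [MulAction.Quotient.smul_coe, QuotientGroup.eq]
      have : (z • g)⁻¹ * g = z := by
        rw [smul_eq_mul, ← h.zc g]; rw [mul_inv_rev, h.zinv]; group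
      rw [this, ← q.i0 h]
      exact mul_mem (Subgroup.npow_mem_zpowers s _) (Subgroup.npow_mem_zpowers s _)
  have hsign := Equiv.Perm.sign_of_pow_two_eq_one hsq
  have hone : Equiv.Perm.sign (f x) = 1 := perfect_hom_trivial hP (Equiv.Perm.sign.comp f) x
  have hfix : Fintype.card (Function.fixedPoints (f x)) = 0 := by
    rw [Fintype.card_eq_zero_iff]
    refine ⟨fun ⟨y, hy⟩ => ?_⟩
    induction y using QuotientGroup.induction_on with
    | H g =>
      have hy' : x • (g : G ⧸ Subgroup.zpowers s) = g := hy
      rw [MulAction.Quotient.smul_coe, QuotientGroup.eq] at hy'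
      have h3 := inv_mem hy'
      apply hcon g⁻¹
      have : (((x • g)⁻¹ * g)⁻¹) = g⁻¹ * x * g⁻¹⁻¹ := by rw [smul_eq_mul]; group
      rwa [this] at h3
  have hcd : Fintype.card (G ⧸ Subgroup.zpowers s) = 2 * (S : Subgroup G).index := by
    rw [← Nat.card_eq_fintype_card]
    change (Subgroup.zpowers s).index = _
    have e1 := Subgroup.index_mul_card (Subgroup.zpowers s)
    have e2 := Subgroup.index_mul_card (S : Subgroup G)
    rw [q.card] at e2
    rw [Nat.card_zpowers] at e1
    have hpos := orderOf_pos s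
    apply Nat.eq_of_mul_eq_mul_right hpos
    rw [e1, ← e2]; ring
  rw [hone, hfix, hcd, Nat.sub_zero, Nat.mul_div_cancel_left _ (by norm_num)] at hsign
  have hodd : Odd (S : Subgroup G).index := by
    have := S.not_dvd_index
    rw [← Nat.not_even_iff_odd, even_iff_two_dvd]
    exact this
  rw [hodd.neg_one_pow] at hsign
  exact absurd hsign (by decide)

lemma perfect_conj (h : Ctx G z) (hP : commutator G = ⊤) (S : Sylow 2 G) {s : G} (q : GQ z S s)
    {x y : G} (hx : x * x = z) (hy : y * y = z) : ∃ g : G, g * x * g⁻¹ = y := by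
  have key : ∀ x : G, x * x = z → ∃ g : G, g * x * g⁻¹ = s ^ (orderOf s / 4) := by
    intro x hx
    obtain ⟨g, hg⟩ := perfect_into h hP S q hx
    have hm := Subgroup.npow_mem_zpowers s (orderOf s / 4)
    rcases h.commJ (h.conjJ hx g) (q.i0 h) (comm_zpowers hg hm) with h1 | h1
    · exact ⟨g, h1⟩
    · obtain ⟨t, ht, hts⟩ := q.exists_out
      refine ⟨t * g, ?_⟩
      have h3 := q.inv_all ht hts hg
      have h4 : t * g * x * (t * g)⁻¹ = (g * x * g⁻¹)⁻¹ := by rw [← h3]; group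
      rw [h4, h1, mul_inv_rev, h.zinv, h.jinv (q.i0 h), ← mul_assoc, ← h.zc, mul_assoc, h.z2, mul_one]
  obtain ⟨g1, h1⟩ := key x hx
  obtain ⟨g2, h2⟩ := key y hy
  refine ⟨g2⁻¹ * g1, ?_⟩
  calc g2⁻¹ * g1 * x * (g2⁻¹ * g1)⁻¹ = g2⁻¹ * (g1 * x * g1⁻¹) * g2 := by group
    _ = g2⁻¹ * (g2 * y * g2⁻¹) * g2 := by rw [h1, h2]
    _ = y := by group

lemma odd_sub (h : Ctx G z) {x : G} (hx : x * x = z) :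
    ∃ O : Subgroup G, (∀ u, u ∈ O ↔ u * x = x * u ∧ Odd (orderOf u)) ∧
      ∃ w : G, x ∈ Subgroup.zpowers w ∧ (∃ n, orderOf w = 2 ^ n) ∧ w * x = x * w ∧
        ∀ c, c * x = x * c → ∃ o ∈ O, ∃ n : ℤ, c = o * w ^ n := by
  have h2 : Fact (Nat.Prime 2) := ⟨Nat.prime_two⟩
  set C := Subgroup.centralizer ({x} : Set G) with hC
  have hmem : ∀ c, c ∈ C ↔ c * x = x * c := fun c => by
    rw [hC, Subgroup.mem_centralizer_singleton_iff]
  have hxC : x ∈ C := (hmem x).mpr rfl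
  obtain ⟨T⟩ : Nonempty (Sylow 2 C) := inferInstance
  have hox := h.orderJ hx
  have hxT : (⟨x, hxC⟩ : C) ∈ (T : Subgroup C) := by
    have hn : (Subgroup.zpowers (⟨x, hxC⟩ : C)).Normal := by
      constructor
      intro n hn g
      obtain ⟨k, rfl⟩ := hn
      have : g * (⟨x, hxC⟩ : C) * g⁻¹ = ⟨x, hxC⟩ := by
        ext
        have := (hmem g).mp g.2
        simp [this]
      simp only
      rw [← conj_zpow, this]
      exact ⟨k, rfl⟩
    have hp : IsPGroup 2 (Subgroup.zpowers (⟨x, hxC⟩ : C)) := by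
      rw [IsPGroup.iff_card]
      refine ⟨2, ?_⟩
      rw [Nat.card_zpowers, ← Subgroup.orderOf_coe]
      rw [hox]; norm_num
    exact hp.le_sylow_of_normal T (Subgroup.mem_zpowers _)
  have hTp : IsPGroup 2 ((T : Subgroup C).map C.subtype) := T.2.map _
  have hcyc : ∃ w, (T : Subgroup C).map C.subtype = Subgroup.zpowers w := by
    rcases two_sub h _ hTp with hh | ⟨s, q⟩
    · exact hh
    · exfalso
      have hcm : ∀ t ∈ (T : Subgroup C).map C.subtype, t * x = x * t := by
        rintro t ⟨c, hc, rfl⟩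
        exact (hmem _).mp c.2
      have hxm : x ∈ (T : Subgroup C).map C.subtype := ⟨⟨x, hxC⟩, hxT, rfl⟩
      by_cases hxs : x ∈ Subgroup.zpowers s
      · obtain ⟨t, ht, hts⟩ := q.exists_out
        have h3 := q.inv_all ht hts hxs
        rw [hcm t ht, mul_inv_cancel_right, h.jinv hx] at h3
        exact h.j_ne hx h3
      · have h3 := (q.anti x hxm hxs).1
        rw [← hcm s q.mem, mul_inv_cancel_right] at h3
        have h4 : s ^ 2 = 1 := by rw [pow_two]; nth_rw 1 [h3]; group
        have h5 := q.four.trans (orderOf_dvd_of_pow_eq_one h4)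
        exact absurd h5 (by decide)
  obtain ⟨w, hw⟩ := hcyc
  have hTc : IsCyclic T := by
    have e := (T : Subgroup C).equivMapOfInjective C.subtype C.subtype_injective
    have : IsCyclic ((T : Subgroup C).map C.subtype) := by rw [hw]; infer_instance
    exact e.isCyclic.mpr this
  have hdvd : 2 ∣ Nat.card C := by
    have : orderOf (⟨x, hxC⟩ : C) ∣ Nat.card C := orderOf_dvd_natCard _
    rw [← Subgroup.orderOf_coe] at this
    rw [hox] at this
    exact (by norm_num : (2 : ℕ) ∣ 4).trans this
  have hmf : (Nat.card C).minFac = 2 := (Nat.minFac_eq_two_iff _).mpr hdvd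
  have hcompl := MonoidHom.ker_transferSylow_isComplement' T
    (IsCyclic.normalizer_le_centralizer hmf hTc)
  have hnd := MonoidHom.not_dvd_card_ker_transferSylow T
    (IsCyclic.normalizer_le_centralizer hmf hTc)
  set f := MonoidHom.transferSylow T (IsCyclic.normalizer_le_centralizer hmf hTc) with hf
  refine ⟨f.ker.map C.subtype, ?_, w, ?_, ?_, ?_, ?_⟩
  · intro u
    constructor
    · rintro ⟨c, hc, rfl⟩
      refine ⟨(hmem _).mp c.2, ?_⟩
      rw [← Nat.not_even_iff_odd, even_iff_two_dvd]
      intro hh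
      apply hnd
      refine hh.trans ?_
      have h3 := Subgroup.orderOf_dvd_natCard (s := f.ker) hc
      have : orderOf (C.subtype c) = orderOf c := Subgroup.orderOf_coe c
      rwa [this]
    · rintro ⟨hu, ho⟩
      refine ⟨⟨u, (hmem u).mpr hu⟩, ?_, rfl⟩
      have h3 : orderOf (f ⟨u, (hmem u).mpr hu⟩) ∣ orderOf u := by
        have := orderOf_map_dvd f ⟨u, (hmem u).mpr hu⟩
        rwa [← Subgroup.orderOf_coe ⟨u, (hmem u).mpr hu⟩] at this
      obtain ⟨n, hn⟩ := (IsPGroup.iff_orderOf.mp T.2) (f ⟨u, (hmem u).mpr hu⟩)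
      change _ = 1
      rw [← orderOf_eq_one_iff]
      rcases Nat.eq_zero_or_pos n with h0 | h0
      · rw [hn, h0, pow_zero]
      · exfalso
        rw [← Nat.not_even_iff_odd] at ho
        apply ho
        rw [even_iff_two_dvd]
        refine dvd_trans ?_ h3
        rw [hn]
        exact dvd_pow_self 2 (by omega)
  · rw [← hw]; exact ⟨⟨x, hxC⟩, hxT, rfl⟩
  · rw [hw] at hTp
    obtain ⟨n, hn⟩ := IsPGroup.iff_card.mp hTp
    exact ⟨n, by rw [← Nat.card_zpowers, hn]⟩
  · have : w ∈ (T : Subgroup C).map C.subtype := by rw [hw]; exact Subgroup.mem_zpowers w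
    obtain ⟨c, hc, rfl⟩ := this
    exact (hmem _).mp c.2
  · intro c hc
    obtain ⟨⟨o, t⟩, hot⟩ := hcompl.2 ⟨c, (hmem c).mpr hc⟩
    have ht : ((t : C) : G) ∈ (T : Subgroup C).map C.subtype := ⟨t, t.2, rfl⟩
    rw [hw] at ht
    obtain ⟨n, hn⟩ := ht
    refine ⟨((o : C) : G), ⟨o, o.2, rfl⟩, n, ?_⟩
    have := congrArg Subtype.val hot
    simp only at hn this
    rw [hn, ← this]; rfl

end


/-- equality up to the central involution -/
def pm {G : Type*} [Group G] (z x y : G) : Prop := x = y ∨ x = y * z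

section
variable {G : Type*} [Group G] {z : G}

lemma pm.refl (x : G) : pm z x x := Or.inl rfl

lemma pm.symm' (h : Ctx G z) {x y : G} (hxy : pm z x y) : pm z y x := by
  rcases hxy with rfl | rfl
  · exact Or.inl rfl
  · right; rw [mul_assoc, h.z2, mul_one]

lemma pm.trans' (h : Ctx G z) {x y w : G} (hxy : pm z x y) (hyw : pm z y w) : pm z x w := by
  rcases hxy with rfl | rfl
  · exact hyw
  · rcases hyw with rfl | rfl
    · right; rfl
    · left; rw [mul_assoc, h.z2, mul_one]

lemma pm.conj' (h : Ctx G z) {x y : G} (hxy : pm z x y) (g : G) : pm z (g * x * g⁻¹) (g * y * g⁻¹) := by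
  rcases hxy with rfl | rfl
  · exact Or.inl rfl
  · right
    rw [mul_assoc _ g⁻¹ z, h.zc g⁻¹]; group

lemma pm.mul' (h : Ctx G z) {x y x' y' : G} (hx : pm z x x') (hy : pm z y y') :
    pm z (x * y) (x' * y') := by
  rcases hx with rfl | rfl <;> rcases hy with rfl | rfl
  · left; rfl
  · right; rw [mul_assoc]
  · right; rw [mul_assoc, ← h.zc y, ← mul_assoc]
  · left
    rw [mul_assoc x' z, ← mul_assoc z, ← h.zc y', mul_assoc y', h.z2, mul_one]

lemma pm.sq (h : Ctx G z) {x y : G} (hxy : pm z x y) (hy : y * y = z) : x * x = z := by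
  rcases hxy with rfl | rfl
  · exact hy
  · exact h.pmJ hy

lemma QP.pm_of (h : Ctx G z) {i j i' j' : G} (q : QP z i j) (hi : pm z i' i) (hj : pm z j' j) :
    QP z i' j' := by
  have key : ∀ {i j j' : G}, QP z i j → pm z j' j → QP z i j' := by
    rintro i j j' q (rfl | rfl)
    · exact q
    · exact ((q.symm h).neg h).symm h
  exact ((key ((key q hj).symm h) hi)).symm h

lemma QP.not_pm (h : Ctx G z) {i j : G} (q : QP z i j) : ¬ pm z i j := by
  rintro (hh | hh)
  · exact (q.ne h).1 hh
  · exact (q.ne h).2 hh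

lemma QP.jk (h : Ctx G z) {i j : G} (q : QP z i j) : QP z j (i * j) := by
  have e : pm z (j * i) (i * j) := Or.inr (q.ij h)
  exact ((q.symm h).k h).pm_of h (pm.refl _) (e.symm' h)

lemma QP.jk_pm (h : Ctx G z) {i j : G} (q : QP z i j) : pm z (j * (i * j)) i := by
  left
  rw [← mul_assoc, q.ij h, mul_assoc _ z j, ← h.zc j, mul_assoc i, ← mul_assoc j, q.jj, h.z2, mul_one]

lemma QP.ik_pm (h : Ctx G z) {i j : G} (q : QP z i j) : pm z (i * (i * j)) j := by
  right
  rw [← mul_assoc, q.ii, h.zc]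

lemma pm_comm_of_odd (h : Ctx G z) {x y : G} (hx : pm z (x * y * x⁻¹) y) (ho : Odd (orderOf x)) :
    x * y = y * x := by
  have h2 : Commute (x ^ 2) y := by
    have : x ^ 2 * y * (x ^ 2)⁻¹ = y := by
      have e : x ^ 2 * y * (x ^ 2)⁻¹ = x * (x * y * x⁻¹) * x⁻¹ := by rw [pow_two]; group
      rw [e]
      rcases hx with hx | hx
      · rw [hx, hx]
      · rw [hx, ← mul_assoc, mul_assoc _ z, ← h.zc, ← mul_assoc, hx, mul_assoc, h.z2, mul_one]
    rwa [mul_inv_eq_iff_eq_mul] at this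
  obtain ⟨k, hk⟩ := ho
  have : x = (x ^ 2) ^ (k + 1) := by
    rw [← pow_mul, show 2 * (k + 1) = orderOf x + 1 by omega, pow_succ, pow_orderOf_eq_one, one_mul]
  rw [this]
  exact (h2.pow_left (k + 1)).eq

/-- Burnside-type fusion at an odd prime in a perfect group. -/
lemma perfect_F2 [Finite G] (hF : FC G) (hP : commutator G = ⊤) {t : ℕ} (ht : t.Prime) (ht2 : t ≠ 2)
    {ε : G} (ho : orderOf ε = t) :
    ∃ g : G, g * ε * g⁻¹ ∈ Subgroup.zpowers ε ∧ g * ε ≠ ε * g := by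
  have htf : Fact t.Prime := ⟨ht⟩
  have hp : IsPGroup t (Subgroup.zpowers ε) := by
    rw [IsPGroup.iff_card]
    exact ⟨1, by rw [Nat.card_zpowers, ho, pow_one]⟩
  obtain ⟨T, hT⟩ := hp.exists_le_sylow
  have hεT : ε ∈ (T : Subgroup G) := hT (Subgroup.mem_zpowers ε)
  have hcyc : IsCyclic T := (hF.subgroup (T : Subgroup G)).odd_cyclic T.2 ht2
  by_cases hNC : Subgroup.normalizer (T : Set G) ≤ Subgroup.centralizer (T : Set G)
  · exfalso
    have hcompl := MonoidHom.ker_transferSylow_isComplement' T hNC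
    set f := MonoidHom.transferSylow T hNC
    have hker : f.ker = ⊤ := by
      rw [eq_top_iff, ← hP, commutator_def, Subgroup.commutator_le]
      intro a _ b _
      change f _ = 1
      rw [map_commutatorElement, commutatorElement_eq_one_iff_mul_comm]
      exact (IsCyclic.commGroup (α := T)).mul_comm _ _
    have hd := hcompl.disjoint
    rw [hker, top_disjoint] at hd
    rw [hd, Subgroup.mem_bot] at hεT
    rw [hεT, orderOf_one] at ho
    exact ht.one_lt.ne ho
  · obtain ⟨g, hgN, hgC⟩ := SetLike.not_le_iff_exists.mp hNC
    obtain ⟨τ, hτ⟩ := hcyc.exists_generator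
    have hgen : ∀ x ∈ (T : Subgroup G), ∃ n : ℕ, x = (τ : G) ^ n := by
      intro x hx
      have := hτ ⟨x, hx⟩
      rw [← mem_powers_iff_mem_zpowers] at this
      obtain ⟨n, hn⟩ := this
      exact ⟨n, by simpa using (congrArg Subtype.val hn).symm⟩
    have hgτ : g * τ * g⁻¹ ∈ (T : Subgroup G) := (Subgroup.mem_normalizer_iff.mp hgN τ).mp τ.2
    obtain ⟨k, hk⟩ := hgen _ hgτ
    obtain ⟨n, hn⟩ := hgen ε hεT
    have hconj : ∀ m : ℕ, g * (τ : G) ^ m * g⁻¹ = ((τ : G) ^ m) ^ k := by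
      intro m
      rw [← conj_pow, hk, ← pow_mul, ← pow_mul, mul_comm]
    have hgε : g * ε * g⁻¹ = ε ^ k := by rw [hn]; exact hconj n
    refine ⟨g, by rw [hgε]; exact Subgroup.npow_mem_zpowers ε k, ?_⟩
    intro hcomm
    -- k ≡ 1 mod t
    have hk1 : (t : ℤ) ∣ k - 1 := by
      have : ε ^ ((k : ℤ) - 1) = 1 := by
        rw [zpow_sub, zpow_natCast, zpow_one, ← hgε, hcomm]; group
      rw [← ho]
      exact orderOf_dvd_iff_zpow_eq_one.mpr this
    set N := Subgroup.normalizer (T : Set G)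
    have hTN : (T : Subgroup G) ≤ N := Subgroup.le_normalizer
    have hnorm : ((T : Subgroup G).subgroupOf N).Normal := Subgroup.normal_in_normalizer
    set r := ((T : Subgroup G).subgroupOf N).index with hr
    have hrt : ¬ t ∣ r := by
      intro hh
      apply T.not_dvd_index
      have : r * N.index = (T : Subgroup G).index := Subgroup.relIndex_mul_index hTN
      rw [← this]
      exact hh.mul_right _
    have hgr : g ^ r ∈ (T : Subgroup G) := by
      have := Subgroup.pow_index_mem ((T : Subgroup G).subgroupOf N) ⟨g, hgN⟩
      exact this
    have hkr : (τ : G) ^ ((k : ℤ) ^ r) = τ := by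
      rw [← conj_pow_exp (τ : G) g k (by rw [hk, zpow_natCast]) r]
      obtain ⟨n', hn'⟩ := hgen _ hgr
      rw [hn', mul_inv_eq_iff_eq_mul, ← pow_succ, ← pow_succ']
    have hdv : (orderOf (τ : G) : ℤ) ∣ (k : ℤ) ^ r - 1 := by
      rw [orderOf_dvd_iff_zpow_eq_one, zpow_sub, zpow_one, hkr, mul_inv_cancel]
    have hfac : (k : ℤ) ^ r - 1 = (∑ m ∈ Finset.range r, (k : ℤ) ^ m) * (k - 1) := by
      rw [geom_sum_mul]
    have hsum : ¬ (t : ℤ) ∣ ∑ m ∈ Finset.range r, (k : ℤ) ^ m := by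
      intro hh
      apply hrt
      have e : (∑ m ∈ Finset.range r, (k : ℤ) ^ m) ≡ ∑ m ∈ Finset.range r, (1 : ℤ) [ZMOD t] := by
        apply Int.ModEq.sum
        intro m _
        have := (Int.modEq_iff_dvd.mpr hk1 : (1 : ℤ) ≡ k [ZMOD t])
        simpa using (this.symm.pow m)
      have e2 := (Int.modEq_zero_iff_dvd.mpr hh).symm.trans e
      simp at e2
      exact_mod_cast Int.modEq_zero_iff_dvd.mp e2.symm
    have hcop : IsCoprime (orderOf (τ : G) : ℤ) (∑ m ∈ Finset.range r, (k : ℤ) ^ m) := by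
      obtain ⟨m, hm⟩ := (IsPGroup.iff_orderOf.mp T.2) τ
      rw [Subgroup.orderOf_coe, hm]
      push_cast
      apply IsCoprime.pow_left
      exact (Prime.coprime_iff_not_dvd (Nat.prime_iff_prime_int.mp ht)).mpr hsum
    rw [hfac] at hdv
    have hfin := hcop.dvd_of_dvd_mul_left hdv
    have hτk : (τ : G) ^ k = τ := by
      have := orderOf_dvd_iff_zpow_eq_one.mp hfin
      rw [zpow_sub, zpow_one, zpow_natCast, mul_inv_eq_one] at this
      exact this
    apply hgC
    rw [Subgroup.mem_centralizer_iff]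
    intro x hx
    obtain ⟨m, rfl⟩ := hgen x hx
    have := hconj m
    rw [← pow_mul, mul_comm, pow_mul, hτk, mul_inv_eq_iff_eq_mul] at this
    exact this.symm

end

section
variable {G K V : Type*} [Group G] [Finite G] [Field K] [AddCommGroup V] [Module K V]
  {ρ : G →* Module.End K V} {z : G}

lemma a_formula {R : Type*} [Ring R] (I J A : R) (hI : I * I = -1) (hJ : J * J = -1)
    (hJI : J * I = -(I * J)) (h1 : A * I = J * A) (h2 : A * J = I * J * A) (hA : A * A + A + 1 = 0) :
    2 * A = -(1 + I + J + I * J) := by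
  have e1 : A * A * I = I * J * (A * A) := by
    rw [mul_assoc, h1, ← mul_assoc, h2, mul_assoc]
  have e2 : I * (A * A * I) + I * (A * I) + I * I = 0 := by
    have : I * (A * A + A + 1) * I = 0 := by rw [hA]; simp
    rw [← this]; noncomm_ring
  have e3 : A * A = -A - 1 := by
    have : A * A = (A * A + A + 1) - A - 1 := by noncomm_ring
    rw [this, hA]; noncomm_ring
  have e4 : I * (I * J * (A * A)) = J * A + J := by
    have : I * (I * J * (A * A)) = (I * I) * J * (A * A) := by noncomm_ring
    rw [this, hI, e3]; noncomm_ring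
  rw [e1, e4, h1, hI] at e2
  have e5 : (J + I * J) * A = 1 - J := by
    have : (J + I * J) * A = (J * A + J + I * (J * A) + -1) + 1 - J := by noncomm_ring
    rw [this, e2]; noncomm_ring
  have e6 : (J + I * J) * (J + I * J) = -2 := by
    have : (J + I * J) * (J + I * J) = J * J + (J * I) * J + I * (J * J) + I * (J * I) * J := by
      noncomm_ring
    rw [this, hJI, hJ]
    have : -1 + -(I * J) * J + I * -1 + I * -(I * J) * J = -1 - I * (J * J) - I - (I * I) * (J * J) := by
      noncomm_ring
    rw [this, hI, hJ, ← one_add_one_eq_two]; noncomm_ring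
  have e7 : (J + I * J) * ((J + I * J) * A) = (J + I * J) * (1 - J) := by rw [e5]
  rw [← mul_assoc, e6] at e7
  have e8 : (J + I * J) * (1 - J) = J + I * J - J * J - I * (J * J) := by noncomm_ring
  rw [e8, hJ] at e7
  have : 2 * A = -(-2 * A) := by noncomm_ring
  rw [this, e7]; noncomm_ring

lemma FPF.two_ne (hρ : FPF ρ) (h : Ctx G z) : (2 : K) ≠ 0 := by
  intro h2
  apply hρ.ne
  have : orderOf z = 2 := by
    rw [orderOf_eq_prime_iff]
    exact ⟨by rw [pow_two, h.z2], h.z1⟩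
  obtain ⟨c, hc⟩ := orderOf_dvd_natCard z
  rw [hc, this]
  push_cast
  rw [h2, zero_mul]

lemma FPF.rho_z (hρ : FPF ρ) (h : Ctx G z) : ρ z = -1 :=
  hρ.neg_one z h.z1 (by rw [pow_two, h.z2])

lemma good_inv_aux (hρ : FPF ρ) (h : Ctx G z) {i j a : G} (q : QP z i j) (ha : orderOf a = 3)
    (h1 : a * i * a⁻¹ = j) (h2 : a * j * a⁻¹ = i * j) (W : Submodule K V)
    (hi : ∀ w ∈ W, ρ i w ∈ W) (hj : ∀ w ∈ W, ρ j w ∈ W) : ∀ w ∈ W, ρ a w ∈ W := by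
  have hz := hρ.rho_z h
  have ha1 : a ≠ 1 := by rintro rfl; simp at ha
  have ha3 : a * a * a = 1 := by rw [← pow_orderOf_eq_one a, ha, pow_succ, pow_two]
  have hA : ρ a * ρ a + ρ a + 1 = 0 := by
    ext v
    apply hρ.fpf a ha1
    simp only [LinearMap.add_apply, Module.End.mul_apply, Module.End.one_apply, map_add]
    have : ρ a (ρ a (ρ a v)) = v := by
      rw [← Module.End.mul_apply, ← Module.End.mul_apply, ← map_mul, ← map_mul, ha3]
      simp
    rw [this]; abel
  have key := a_formula (ρ i) (ρ j) (ρ a) (by rw [← map_mul, q.ii, hz]) (by rw [← map_mul, q.jj, hz])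
    (by rw [← map_mul, q.ij h, map_mul, map_mul, hz]; simp)
    (by rw [← map_mul, ← map_mul, ← mul_inv_eq_iff_eq_mul.mp h1])
    (by rw [← map_mul, ← map_mul, ← map_mul, ← mul_inv_eq_iff_eq_mul.mp h2]) hA
  intro w hw
  have k2 : (2 : K) • ρ a w = -(w + ρ i w + ρ j w + ρ i (ρ j w)) := by
    have := congrArg (fun f : Module.End K V => f w) key
    simp only [LinearMap.neg_apply, LinearMap.add_apply, Module.End.one_apply,
      Module.End.mul_apply] at this
    rw [← this, two_smul, ← one_add_one_eq_two]
    simp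
  have k3 : (2 : K) • ρ a w ∈ W := by
    rw [k2]
    exact neg_mem (add_mem (add_mem (add_mem hw (hi w hw)) (hj w hw)) (hi _ (hj w hw)))
  have := W.smul_mem (2 : K)⁻¹ k3
  rwa [smul_smul, inv_mul_cancel₀ (hρ.two_ne h), one_smul] at this

lemma good_inv (hρ : FPF ρ) (h : Ctx G z) {i j a : G} (q : QP z i j) (ha : orderOf a = 3)
    (h1 : pm z (a * i * a⁻¹) j) (h2 : pm z (a * j * a⁻¹) (i * j)) (W : Submodule K V)
    (hi : ∀ w ∈ W, ρ i w ∈ W) (hj : ∀ w ∈ W, ρ j w ∈ W) : ∀ w ∈ W, ρ a w ∈ W := by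
  have hzW : ∀ w ∈ W, ρ z w ∈ W := by
    intro w hw
    rw [hρ.rho_z h]; simpa using hw
  have hmW : ∀ x, (∀ w ∈ W, ρ x w ∈ W) → ∀ w ∈ W, ρ (x * z) w ∈ W := by
    intro x hx w hw
    rw [map_mul, Module.End.mul_apply]
    exact hx _ (hzW w hw)
  have hzz : ∀ x : G, x * z * z = x := fun x => by rw [mul_assoc, h.z2, mul_one]
  have hcz : ∀ x, a * (x * z) * a⁻¹ = a * x * a⁻¹ * z := fun x => by
    rw [mul_assoc _ a⁻¹ z, h.zc a⁻¹]; group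
  have hzm : ∀ x y : G, x * z * y = x * y * z := fun x y => by rw [mul_assoc, ← h.zc y, mul_assoc]
  rcases h1 with h1 | h1 <;> rcases h2 with h2 | h2
  · exact good_inv_aux hρ h q ha h1 h2 W hi hj
  · exact good_inv_aux hρ h (q.pm_of h (Or.inr rfl) (Or.inr rfl) : QP z (i * z) (j * z)) ha
      (by rw [hcz, h1]) (by rw [hcz, h2, hzz, hzm, ← mul_assoc, hzz]) W (hmW i hi) (hmW j hj)
  · exact good_inv_aux hρ h (q.pm_of h (Or.inl rfl) (Or.inr rfl) : QP z i (j * z)) ha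
      h1 (by rw [hcz, h2, mul_assoc]) W hi (hmW j hj)
  · exact good_inv_aux hρ h (q.pm_of h (Or.inr rfl) (Or.inl rfl) : QP z (i * z) j) ha
      (by rw [hcz, h1, hzz]) (by rw [h2, hzm]) W (hmW i hi) hj

lemma closure_inv (X : Set G) (W : Submodule K V) (hX : ∀ g ∈ X, ∀ w ∈ W, ρ g w ∈ W) :
    ∀ g ∈ Subgroup.closure X, ∀ w ∈ W, ρ g w ∈ W := by
  intro g hg
  induction hg using Subgroup.closure_induction with
  | mem x hx => exact hX x hx
  | one => intro w hw; simpa using hw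
  | mul x y _ _ hx hy =>
    intro w hw
    rw [map_mul, Module.End.mul_apply]
    exact hx _ (hy w hw)
  | inv x _ hx =>
    have hpow : ∀ n : ℕ, ∀ w ∈ W, ρ (x ^ n) w ∈ W := by
      intro n
      induction n with
      | zero => intro w hw; simpa using hw
      | succ n ih =>
        intro w hw
        rw [pow_succ, map_mul, Module.End.mul_apply]
        exact ih _ (hx w hw)
    have : x⁻¹ = x ^ (orderOf x - 1) := by
      rw [inv_eq_iff_mul_eq_one, ← pow_succ', Nat.sub_add_cancel (orderOf_pos x), pow_orderOf_eq_one]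
    rw [this]
    exact hpow _

lemma restr (hρ : FPF ρ) (L : Subgroup G) (W : Submodule K V) (hW : ∀ g ∈ L, ∀ w ∈ W, ρ g w ∈ W) :
    ∃ σ : L →* Module.End K W, FPF σ ∧ ∀ g w, (σ g w : V) = ρ g w := by
  have hL := hρ.subgroup L
  refine ⟨{ toFun := fun g => (ρ g).restrict (hW g g.2), map_one' := ?_, map_mul' := ?_ }, ⟨?_, ?_⟩, ?_⟩
  · ext w; simp
  · intro x y; ext w; simp
  · intro g hg v hv
    have := hL.fpf g hg v (by simpa using congrArg Subtype.val hv)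
    exact Subtype.ext this
  · exact hL.ne
  · intro g w; rfl

lemma dick2 [IsAlgClosed K] (hρ : FPF ρ) (h : Ctx G z) {i j : G} (q : QP z i j) (L : Subgroup G)
    (hi : i ∈ L) (hj : j ∈ L) (W : Submodule K V) (hW2 : Module.finrank K W = 2)
    (hL : ∀ g ∈ L, ∀ w ∈ W, ρ g w ∈ W) :
    (∃ A : Subgroup G, (∀ x ∈ A, ∀ y ∈ A, x * y = y * x) ∧ (∀ x ∈ L, x * x ∈ A) ∧
      (i ∈ A ∨ j ∈ A ∨ i * j ∈ A)) ∨
    ∃ m N, ∃ Z : Subgroup L, DII L Z m N ∧ ∀ x ∈ Z, ∀ y : L, (x : G) * y = y * x := by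
  obtain ⟨σ, hσ, hσρ⟩ := restr hρ L W hL
  have hnt : Nontrivial W := Module.nontrivial_of_finrank_pos (R := K) (by omega)
  rcases dickson hσ hW2 with ⟨A, hA, hind⟩ | ⟨m, N, hD⟩
  · left
    refine ⟨A.map L.subtype, ?_, ?_, ?_⟩
    · rintro _ ⟨x, hx, rfl⟩ _ ⟨y, hy, rfl⟩
      rw [← map_mul, hA x hx y hy, map_mul]
    · intro x hx
      refine ⟨⟨x, hx⟩ * ⟨x, hx⟩, ?_, rfl⟩
      rcases hind with h1 | h1
      · rw [Subgroup.index_eq_one.mp h1]; trivial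
      · exact Subgroup.mul_self_mem_of_index_two h1 _
    · rcases hind with h1 | h1
      · left
        exact ⟨⟨i, hi⟩, by rw [Subgroup.index_eq_one.mp h1]; trivial, rfl⟩
      · by_cases hiA : (⟨i, hi⟩ : L) ∈ A
        · left; exact ⟨_, hiA, rfl⟩
        · by_cases hjA : (⟨j, hj⟩ : L) ∈ A
          · right; left; exact ⟨_, hjA, rfl⟩
          · right; right
            refine ⟨⟨i, hi⟩ * ⟨j, hj⟩, ?_, rfl⟩
            exact (Subgroup.mul_mem_iff_of_index_two h1).mpr (iff_of_false hiA hjA)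
  · right
    refine ⟨m, N, _, hD, ?_⟩
    intro x hx y
    obtain ⟨μ, hμ⟩ := (mem_scalarSub x).mp hx
    have : x * y = y * x := by
      apply hσ.injective
      rw [map_mul, map_mul, hμ]; simp
    exact congrArg Subtype.val this

/-- two dimensional span from an eigenvector of `i` -/
lemma span_W (hρ : FPF ρ) (h : Ctx G z) {i j : G} (q : QP z i j) {v : V} (hv : v ≠ 0) {c : K}
    (hc : ρ i v = c • v) :
    Module.finrank K (Submodule.span K ({v, ρ j v} : Set V)) = 2 ∧
    (∀ w ∈ Submodule.span K ({v, ρ j v} : Set V), ρ i w ∈ Submodule.span K ({v, ρ j v} : Set V)) ∧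
    (∀ w ∈ Submodule.span K ({v, ρ j v} : Set V), ρ j w ∈ Submodule.span K ({v, ρ j v} : Set V)) ∧
    (∀ (u : G) (b : K), ρ u v = b • v → j * u * j⁻¹ = u⁻¹ →
      ∀ w ∈ Submodule.span K ({v, ρ j v} : Set V), ρ u w ∈ Submodule.span K ({v, ρ j v} : Set V)) := by
  have hz := hρ.rho_z h
  have hmap : ∀ x : G, ρ x v ∈ Submodule.span K ({v, ρ j v} : Set V) →
      ρ x (ρ j v) ∈ Submodule.span K ({v, ρ j v} : Set V) →
      ∀ w ∈ Submodule.span K ({v, ρ j v} : Set V), ρ x w ∈ Submodule.span K ({v, ρ j v} : Set V) := by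
    intro x h1 h2 w hw
    obtain ⟨a, b, rfl⟩ := Submodule.mem_span_pair.mp hw
    rw [map_add, map_smul, map_smul]
    exact add_mem (Submodule.smul_mem _ _ h1) (Submodule.smul_mem _ _ h2)
  have hvm : v ∈ Submodule.span K ({v, ρ j v} : Set V) := Submodule.subset_span (by simp)
  have hjm : ρ j v ∈ Submodule.span K ({v, ρ j v} : Set V) := Submodule.subset_span (by simp)
  have hcc : c * c = -1 := by
    have : ρ i (ρ i v) = -v := by
      rw [← Module.End.mul_apply, ← map_mul, q.ii, hz]; simp
    rw [hc, map_smul, hc, smul_smul] at this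
    have h3 : (c * c - (-1)) • v = 0 := by rw [sub_smul, this]; simp
    rcases smul_eq_zero.mp h3 with h4 | h4
    · exact sub_eq_zero.mp h4
    · exact absurd h4 hv
  have hinvv : ∀ (u : G) (b : K), ρ u v = b • v → ρ u⁻¹ v = b⁻¹ • v := by
    intro u b hb
    have h1 : ρ u⁻¹ (ρ u v) = v := by rw [← Module.End.mul_apply, ← map_mul]; simp
    rw [hb, map_smul] at h1
    have hb0 : b ≠ 0 := by rintro rfl; rw [zero_smul] at h1; exact hv h1.symm
    rw [← h1, smul_smul, inv_mul_cancel₀ hb0, one_smul, h1]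
  have huj : ∀ (u : G) (b : K), ρ u v = b • v → j * u * j⁻¹ = u⁻¹ → ρ u (ρ j v) = b⁻¹ • ρ j v := by
    intro u b hb hju
    have e : u * j = j * u⁻¹ := by
      have : (j * u * j⁻¹)⁻¹ = u := by rw [hju, inv_inv]
      nth_rw 1 [← this]; group
    rw [← Module.End.mul_apply, ← map_mul, e, map_mul, Module.End.mul_apply, hinvv u b hb, map_smul]
  have hij : ρ i (ρ j v) = c⁻¹ • ρ j v := huj i c hc q.ji
  have hjv : ρ j v ≠ 0 := by
    intro h0
    apply hv
    have : ρ j⁻¹ (ρ j v) = v := by rw [← Module.End.mul_apply, ← map_mul]; simp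
    rw [← this, h0, map_zero]
  have hc0 : c ≠ 0 := by rintro rfl; simp at hcc
  have hcinv : c⁻¹ = -c := by
    rw [inv_eq_iff_eq_inv, eq_comm, inv_eq_of_mul_eq_one_left]
    rw [mul_neg, hcc, neg_neg]
  refine ⟨?_, ?_, ?_, ?_⟩
  · have hli : LinearIndependent K ![v, ρ j v] := by
      rw [LinearIndependent.pair_iff' hv]
      intro a ha
      have h3 := hij
      rw [← ha, map_smul, hc, hcinv, smul_smul, smul_smul] at h3
      have h4 : (a * c - -c * a) • v = 0 := by rw [sub_smul, h3, sub_self]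
      have h5 : a * c - -c * a = 2 * (a * c) := by ring
      rw [h5] at h4
      have ha0 : a ≠ 0 := by rintro rfl; rw [zero_smul] at ha; exact hjv ha.symm
      exact (smul_ne_zero (mul_ne_zero (hρ.two_ne h) (mul_ne_zero ha0 hc0)) hv) h4
    have := finrank_span_eq_card hli
    rw [← Matrix.range_cons_cons_empty v (ρ j v) ![]]
    simpa using this
  · apply hmap
    · rw [hc]; exact Submodule.smul_mem _ _ hvm
    · rw [hij]; exact Submodule.smul_mem _ _ hjm
  · apply hmap
    · exact hjm
    · rw [← Module.End.mul_apply, ← map_mul, q.jj, hz]; simpa using hvm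
  · intro u b hb hju
    apply hmap
    · rw [hb]; exact Submodule.smul_mem _ _ hvm
    · rw [huj u b hb hju]; exact Submodule.smul_mem _ _ hjm

/-- an element of order three cyclically permuting -/
structure G3 (z i j a : G) : Prop where
  ord : orderOf a = 3
  ai : pm z (a * i * a⁻¹) j
  aj : pm z (a * j * a⁻¹) (i * j)

lemma G3.not_comm (h : Ctx G z) {i j a : G} (q : QP z i j) (g : G3 z i j a) :
    a * i ≠ i * a ∧ a * j ≠ j * a ∧ a * (i * j) ≠ (i * j) * a := by
  have ak : pm z (a * (i * j) * a⁻¹) i := by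
    have e : a * (i * j) * a⁻¹ = (a * i * a⁻¹) * (a * j * a⁻¹) := by group
    rw [e]
    exact (g.ai.mul' h g.aj).trans' h (q.jk_pm h)
  have key : ∀ x y, a * x = x * a → pm z (a * x * a⁻¹) y → pm z x y := by
    intro x y hxy hh
    rwa [hxy, mul_inv_cancel_right] at hh
  refine ⟨fun hh => ?_, fun hh => ?_, fun hh => ?_⟩
  · exact q.not_pm h (key _ _ hh g.ai)
  · exact (q.jk h).not_pm h (key _ _ hh g.aj)
  · exact (q.k h).not_pm h ((key _ _ hh ak).symm' h)

/-- no abelian subgroup as in the first case of `dick2` -/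
lemma G3.no_abel (h : Ctx G z) {i j a : G} (q : QP z i j) (g : G3 z i j a) (A : Subgroup G)
    (hA : ∀ x ∈ A, ∀ y ∈ A, x * y = y * x) (haa : a * a ∈ A) (hs : i ∈ A ∨ j ∈ A ∨ i * j ∈ A) : False := by
  have ha : a ∈ A := by
    have h3 : a ^ 3 = 1 := by rw [← g.ord, pow_orderOf_eq_one]
    have : a = (a * a) * (a * a) := by
      calc a = a ^ 3 * a := by rw [h3, one_mul]
        _ = _ := by rw [pow_succ, pow_two]; group
    rw [this]; exact mul_mem haa haa
  obtain ⟨n1, n2, n3⟩ := g.not_comm h q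
  rcases hs with hs | hs | hs
  · exact n1 (hA _ ha _ hs)
  · exact n2 (hA _ ha _ hs)
  · exact n3 (hA _ ha _ hs)

lemma angle [IsAlgClosed K] [FiniteDimensional K V] [Nontrivial V] (hρ : FPF ρ) (h : Ctx G z)
    {i j a : G} (q : QP z i j) (g : G3 z i j a) {u : G} (hu : Odd (orderOf u)) (hui : u * i = i * u)
    (hju : j * u * j⁻¹ = u⁻¹) : u = 1 := by
  have hcomm := comm_sup_zpowers (Subgroup.zpowers i) u
    (fun x hx y hy => comm_zpowers hx hy) (by
      rintro y ⟨n, rfl⟩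
      exact ((show Commute u i from hui).zpow_right n).eq)
  obtain ⟨v, hv, χ, -, hχ⟩ := hρ.exists_char _ hcomm
  have hiA : i ∈ Subgroup.zpowers i ⊔ Subgroup.zpowers u :=
    (le_sup_left : Subgroup.zpowers i ≤ _) (Subgroup.mem_zpowers i)
  have huA : u ∈ Subgroup.zpowers i ⊔ Subgroup.zpowers u :=
    (le_sup_right : Subgroup.zpowers u ≤ _) (Subgroup.mem_zpowers u)
  have hci := hχ ⟨i, hiA⟩
  have hcu := hχ ⟨u, huA⟩
  obtain ⟨hW2, hWi, hWj, hWu⟩ := span_W hρ h q hv hci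
  set W := Submodule.span K ({v, ρ j v} : Set V)
  have hWa := good_inv hρ h q g.ord g.ai g.aj W hWi hWj
  set L := Subgroup.closure ({i, j, a, u} : Set G) with hL
  have hLW : ∀ g ∈ L, ∀ w ∈ W, ρ g w ∈ W := by
    apply closure_inv
    rintro x (rfl | rfl | rfl | rfl)
    · exact hWi
    · exact hWj
    · exact hWa
    · exact hWu _ _ hcu hju
  have mi : i ∈ L := Subgroup.subset_closure (by simp)
  have mj : j ∈ L := Subgroup.subset_closure (by simp)
  have ma : a ∈ L := Subgroup.subset_closure (by simp)
  have mu : u ∈ L := Subgroup.subset_closure (by simp)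
  rcases dick2 hρ h q L mi mj W hW2 hLW with ⟨A, hA, hsq, hs⟩ | ⟨m, N, Z, hD, hZ⟩
  · exact (g.no_abel h q A hA (hsq a ma) hs).elim
  · have hiZ : (⟨i, mi⟩ : L) ∉ Z := by
      intro hh
      have := hZ _ hh ⟨j, mj⟩
      simp only at this
      have e := q.ij h
      rw [← this] at e
      exact h.z1 (by simpa using e.symm)
    obtain ⟨e, he, -, hpow⟩ := hD.cent _ hiZ
    have h4 : (⟨i, mi⟩ : L) ^ 4 = 1 := by
      ext
      have := h.orderJ q.ii
      simp only [SubmonoidClass.mk_pow, OneMemClass.coe_one]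
      rw [← this, pow_orderOf_eq_one]
    have hie := hpow _ rfl
    have hme : e = 2 ∨ e = 4 := by
      have h3 : e ≠ 3 := by
        rintro rfl
        apply hiZ
        have := inv_mem hie
        have e3 : ((⟨i, mi⟩ : L) ^ 3)⁻¹ = ⟨i, mi⟩ := by
          rw [inv_eq_iff_mul_eq_one, ← pow_succ, h4]
        rwa [e3] at this
      have h5 : e ≠ 5 := by
        rintro rfl
        apply hiZ
        rwa [pow_succ, h4, one_mul] at hie
      have := hD.mN
      omega
    have hue : (⟨u, mu⟩ : L) ^ e ∈ Z := hpow _ (by ext; exact hui)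
    have hc := hZ _ hue ⟨j, mj⟩
    simp only [SubmonoidClass.mk_pow] at hc
    have e1 : j * u ^ e * j⁻¹ = (u ^ e)⁻¹ := by
      rw [← conj_pow, hju, inv_pow]
    rw [← hc, mul_inv_cancel_right] at e1
    have e2 : u ^ (2 * e) = 1 := by
      rw [two_mul, pow_add]
      nth_rw 1 [e1]
      exact inv_mul_cancel _
    have e3 := orderOf_dvd_of_pow_eq_one e2
    have hcop : Nat.Coprime (orderOf u) (2 * e) := by
      rcases hme with rfl | rfl
      · exact (Nat.Coprime.pow_right 2 (Nat.coprime_two_right.mpr hu) : Nat.Coprime (orderOf u) (2 ^ 2))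
      · exact (Nat.Coprime.pow_right 3 (Nat.coprime_two_right.mpr hu) : Nat.Coprime (orderOf u) (2 ^ 3))
    exact orderOf_eq_one_iff.mp (Nat.Coprime.eq_one_of_dvd hcop e3)

end


section
variable {G : Type*} [Group G] [Finite G] {z : G}

open scoped Pointwise in
lemma syl_smul_mem {p : ℕ} (S : Sylow p G) (g y : G) :
    y ∈ ((g • S : Sylow p G) : Subgroup G) ↔ g⁻¹ * y * g ∈ (S : Subgroup G) := by
  change y ∈ MulAut.conj g • (S : Subgroup G) ↔ _
  rw [Subgroup.mem_pointwise_smul_iff_inv_smul_mem]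
  simp [← map_inv]

lemma syl_in {p : ℕ} [Fact p.Prime] (X : Subgroup G) (S : Sylow p G) (hSX : (S : Subgroup G) ≤ X)
    (H : Subgroup G) (hH : IsPGroup p H) (hHX : H ≤ X) :
    ∃ x ∈ X, ∀ y ∈ H, x⁻¹ * y * x ∈ (S : Subgroup G) := by
  have h1 : IsPGroup p (H.subgroupOf X) := hH.comap_of_injective X.subtype X.subtype_injective
  obtain ⟨T, hT⟩ := h1.exists_le_sylow
  obtain ⟨m, hm⟩ := MulAction.exists_smul_eq X (S.subtype hSX) T
  refine ⟨m, m.2, fun y hy => ?_⟩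
  have h2 : (⟨y, hHX hy⟩ : X) ∈ (T : Subgroup X) := hT (by simpa [Subgroup.mem_subgroupOf] using hy)
  rw [← hm, syl_smul_mem, Sylow.coe_subtype, Subgroup.mem_subgroupOf] at h2
  simpa using h2

lemma zpowers_pgroup {p : ℕ} [Fact p.Prime] {x : G} {n : ℕ} (h : orderOf x = p ^ n) :
    IsPGroup p (Subgroup.zpowers x) :=
  IsPGroup.iff_card.mpr ⟨n, by rw [Nat.card_zpowers, h]⟩

lemma mem_norm_zpowers (h : Ctx G z) {i : G} (hi : i * i = z) (g : G) :
    g ∈ Subgroup.normalizer (Subgroup.zpowers i : Set G) ↔ pm z (g * i * g⁻¹) i := by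
  have hz : z ∈ Subgroup.zpowers i := by
    rw [← hi]; exact mul_mem (Subgroup.mem_zpowers i) (Subgroup.mem_zpowers i)
  have key : ∀ g : G, pm z (g * i * g⁻¹) i → ∀ x ∈ Subgroup.zpowers i, g * x * g⁻¹ ∈ Subgroup.zpowers i := by
    rintro g hg _ ⟨n, rfl⟩
    have h1 : g * i * g⁻¹ ∈ Subgroup.zpowers i := by
      rcases hg with hg | hg
      · rw [hg]; exact Subgroup.mem_zpowers i
      · rw [hg]; exact mul_mem (Subgroup.mem_zpowers i) hz
    simp only
    rw [← conj_zpow]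
    exact zpow_mem h1 n
  constructor
  · intro hg
    have h1 := (Subgroup.mem_normalizer_iff.mp hg i).mp (Subgroup.mem_zpowers i)
    exact h.commJ (h.conjJ hi g) hi (comm_zpowers h1 (Subgroup.mem_zpowers i))
  · intro hg
    rw [Subgroup.mem_normalizer_iff]
    intro x
    refine ⟨key g hg x, fun hx => ?_⟩
    have hg' : pm z (g⁻¹ * i * g⁻¹⁻¹) i := by
      have := (hg.symm' h).conj' h g⁻¹
      have e : g⁻¹ * (g * i * g⁻¹) * g⁻¹⁻¹ = i := by group
      rwa [e] at this
    have := key g⁻¹ hg' _ hx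
    have e : g⁻¹ * (g * x * g⁻¹) * g⁻¹⁻¹ = x := by group
    rwa [e] at this

lemma QP.Qs_le (h : Ctx G z) {i j : G} (q : QP z i j) :
    Qs i j ≤ Subgroup.normalizer (Subgroup.zpowers i : Set G) := by
  rw [Qs, Subgroup.closure_le]
  rintro x (rfl | rfl)
  · exact (mem_norm_zpowers h q.ii _).mpr (by rw [mul_inv_cancel_right]; exact pm.refl _)
  · refine (mem_norm_zpowers h q.ii _).mpr ?_
    rw [q.ji, h.jinv q.ii]; exact Or.inr rfl

lemma QP.conj_fix (h : Ctx G z) {i j : G} (q : QP z i j) {x : G} (hx : x ∈ Qs i j) :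
    pm z (x * i * x⁻¹) i := (mem_norm_zpowers h q.ii x).mp (q.Qs_le h hx)

lemma Qs_comm (i j : G) : Qs i j = Qs j i := by rw [Qs, Qs, Set.pair_comm]

lemma QP.pgroup (h : Ctx G z) {i j : G} (q : QP z i j) : IsPGroup 2 (Qs i j) := by
  have h2 : Fact (Nat.Prime 2) := ⟨Nat.prime_two⟩
  exact IsPGroup.iff_card.mpr ⟨3, by rw [q.card h]; norm_num⟩

lemma QP.z_mem {i j : G} (q : QP z i j) : z ∈ Qs i j := by
  rw [← q.ii]; exact mul_mem (mem_Qs_i i j) (mem_Qs_i i j)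

lemma QP.pm_mem (_h : Ctx G z) {i j : G} (q : QP z i j) {x y : G} (hy : y ∈ Qs i j) (hxy : pm z x y) :
    x ∈ Qs i j := by
  rcases hxy with rfl | rfl
  · exact hy
  · exact mul_mem hy q.z_mem

/-- elements normalizing `Q`, checked on the generators -/
lemma QP.mem_norm {i j : G} {c : G} (hi : c * i * c⁻¹ ∈ Qs i j) (hj : c * j * c⁻¹ ∈ Qs i j) :
    c ∈ Subgroup.normalizer (Qs i j : Set G) := by
  have hle : (Qs i j).map (MulAut.conj c).toMonoidHom ≤ Qs i j := by
    rw [Subgroup.map_le_iff_le_comap]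
    nth_rw 1 [Qs]
    rw [Subgroup.closure_le]
    rintro x (rfl | rfl)
    · exact hi
    · exact hj
  have heq : (Qs i j).map (MulAut.conj c).toMonoidHom = Qs i j := by
    apply Subgroup.eq_of_le_of_card_ge hle
    rw [Subgroup.card_map_of_injective (MulAut.conj c).injective]
  rw [Subgroup.mem_normalizer_iff]
  intro x
  constructor
  · intro hx
    apply hle
    exact ⟨x, hx, rfl⟩
  · intro hx
    rw [← heq] at hx
    obtain ⟨y, hy, hyx⟩ := hx
    have : c * y * c⁻¹ = c * x * c⁻¹ := hyx
    have : y = x := by simpa using this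
    rwa [← this]

lemma GQ.order_pow {S : Subgroup G} {s : G} (hS : IsPGroup 2 S) (q : GQ z S s) : ∃ n, orderOf s = 2 ^ n := by
  obtain ⟨n, hn⟩ := (IsPGroup.iff_orderOf.mp hS) ⟨s, q.mem⟩
  exact ⟨n, by rw [← hn, ← Subgroup.orderOf_coe]⟩

lemma GQ.eight {S : Subgroup G} {s : G} (hS : IsPGroup 2 S) (q : GQ z S s) (h4 : orderOf s ≠ 4) :
    8 ∣ orderOf s := by
  obtain ⟨n, hn⟩ := q.order_pow hS
  have h1 := q.four
  rw [hn] at h1 h4 ⊢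
  have h2 : 2 ≤ n := by
    by_contra hh
    interval_cases n <;> revert h1 <;> decide
  have h3 : n ≠ 2 := by rintro rfl; exact h4 (by norm_num)
  exact (pow_dvd_pow 2 (by omega : 3 ≤ n) : 2 ^ 3 ∣ 2 ^ n)

lemma GQ.out_mul {S : Subgroup G} {s : G} (q : GQ z S s) {t y : G} (ht : t ∈ S) (hy : y ∈ S)
    (hts : t ∉ Subgroup.zpowers s) (hys : y ∉ Subgroup.zpowers s) : t * y ∈ Subgroup.zpowers s := by
  by_contra hh
  have h1 := (q.anti _ (mul_mem ht hy) hh).1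
  have h2 := (q.anti _ ht hts).1
  have h3 := (q.anti _ hy hys).1
  have e : t * y * s * (t * y)⁻¹ = (t * (y * s * y⁻¹)⁻¹ * t⁻¹)⁻¹ := by group
  rw [e, h3, inv_inv, h2, inv_inv] at h1
  have h4 : s ^ 2 = 1 := by rw [pow_two]; nth_rw 1 [h1]; group
  exact absurd (q.four.trans (orderOf_dvd_of_pow_eq_one h4)) (by decide)

lemma GQ.s8 {S : Subgroup G} {s : G} (_q : GQ z S s) (h8 : 8 ∣ orderOf s) :
    s ^ (orderOf s / 8) * s ^ (orderOf s / 8) = s ^ (orderOf s / 4) := by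
  obtain ⟨m, hm⟩ := h8
  rw [hm, ← pow_add]
  congr 1
  omega

lemma perfect_dich (h : Ctx G z) (hP : commutator G = ⊤) (hS : ∀ S : Sylow 2 G, ∃ s, GQ z S s)
    {i j : G} (q : QP z i j) :
    (∃ S : Sylow 2 G, (S : Subgroup G) = Qs i j) ∨ ∃ t, pm z (t * t) i ∧ j * t * j⁻¹ = t⁻¹ := by
  have h2 : Fact (Nat.Prime 2) := ⟨Nat.prime_two⟩
  obtain ⟨S1⟩ : Nonempty (Sylow 2 G) := inferInstance
  obtain ⟨s1, q1⟩ := hS S1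
  obtain ⟨g, hg⟩ := perfect_conj h hP S1 q1 (q1.i0 h) q.ii
  set X := Subgroup.normalizer (Subgroup.zpowers i : Set G) with hX
  have hS0 : ((g • S1 : Sylow 2 G) : Subgroup G) ≤ X := by
    intro y hy
    rw [syl_smul_mem] at hy
    rw [hX, mem_norm_zpowers h q.ii, ← hg]
    have hm := Subgroup.npow_mem_zpowers s1 (orderOf s1 / 4)
    set i0 := s1 ^ (orderOf s1 / 4) with hi0
    set w := g⁻¹ * y * g with hw
    have e : y * (g * i0 * g⁻¹) * y⁻¹ = g * (w * i0 * w⁻¹) * g⁻¹ := by rw [hw]; group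
    rw [e]
    apply pm.conj' h
    by_cases hws : w ∈ Subgroup.zpowers s1
    · rw [comm_zpowers hws hm, mul_inv_cancel_right]; exact pm.refl _
    · rw [q1.inv_all hy hws hm, h.jinv (q1.i0 h)]; exact Or.inr rfl
  obtain ⟨x, hx, hxQ⟩ := syl_in X (g • S1) hS0 (Qs i j) (q.pgroup h) (q.Qs_le h)
  set S : Sylow 2 G := x • (g • S1) with hSdef
  have hQS : Qs i j ≤ (S : Subgroup G) := fun y hy => by
    rw [hSdef, syl_smul_mem]; exact hxQ y hy
  have hSX : (S : Subgroup G) ≤ X := fun y hy => by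
    rw [hSdef, syl_smul_mem] at hy
    have := mul_mem (mul_mem hx (hS0 hy)) (inv_mem hx)
    have e : x * (x⁻¹ * y * x) * x⁻¹ = y := by group
    rwa [e] at this
  obtain ⟨s, qs⟩ := hS S
  by_cases h4 : orderOf s = 4
  · left
    refine ⟨S, (Subgroup.eq_of_le_of_card_ge hQS ?_).symm⟩
    rw [qs.card, h4, q.card h]
  · right
    have h8 := qs.eight S.2 h4
    have hiS := hQS (mem_Qs_i i j)
    have hjS := hQS (mem_Qs_j i j)
    have his : i ∈ Subgroup.zpowers s := by
      by_contra hh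
      have h3 := (qs.anti i hiS hh).1
      have h5 := (mem_norm_zpowers h q.ii s).mp (hSX qs.mem)
      have e : s * i * s⁻¹ = i * (i⁻¹ * s * i) * s⁻¹ := by group
      have e2 : i⁻¹ * s * i = s⁻¹ := by
        have : i * s⁻¹ * i⁻¹ = s := by
          rw [← conj_inv, h3, inv_inv]
        nth_rw 1 [← this]; group
      rw [e, e2] at h5
      have h6 : (s ^ 2) ^ 2 = 1 := by
        have h7 : (s⁻¹ * s⁻¹) = 1 ∨ s⁻¹ * s⁻¹ = z := by
          rcases h5 with h5 | h5
          · left; rw [mul_assoc] at h5; simpa using h5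
          · right; rw [mul_assoc] at h5; simpa using h5
        have h8 : (s ^ 2) ^ 2 = ((s⁻¹ * s⁻¹) * (s⁻¹ * s⁻¹))⁻¹ := by
          rw [pow_two, pow_two]; simp only [mul_inv_rev, inv_inv, mul_assoc]
        rw [h8]
        rcases h7 with h7 | h7
        · rw [h7]; simp
        · rw [h7, h.z2]; simp
      rw [← pow_mul] at h6
      exact absurd (h8.trans (orderOf_dvd_of_pow_eq_one h6)) (by decide)
    have hjs : j ∉ Subgroup.zpowers s := by
      intro hh
      have := comm_zpowers hh his
      rw [q.ij h] at this
      exact h.z1 (by simpa using this)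
    refine ⟨s ^ (orderOf s / 8), ?_, ?_⟩
    · rw [qs.s8 h8]
      exact h.commJ (qs.i0 h) q.ii (comm_zpowers (Subgroup.npow_mem_zpowers _ _) his)
    · exact qs.inv_all hjS hjs (Subgroup.npow_mem_zpowers _ _)

lemma pm_pow_fix (h : Ctx G z) {d x : G} (hd : pm z (d * x * d⁻¹) x) (n : ℕ) :
    pm z (d ^ n * x * (d ^ n)⁻¹) x := by
  induction n with
  | zero => simp; exact pm.refl _
  | succ n ih =>
    have e : d ^ (n + 1) * x * (d ^ (n + 1))⁻¹ = d ^ n * (d * x * d⁻¹) * (d ^ n)⁻¹ := by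
      rw [pow_succ]; group
    rw [e]
    exact (hd.conj' h _).trans' h ih

lemma pm_comp (h : Ctx G z) {c d x y w : G} (h1 : pm z (c * x * c⁻¹) y) (h2 : pm z (d * y * d⁻¹) w) :
    pm z (d * c * x * (d * c)⁻¹) w := by
  have e : d * c * x * (d * c)⁻¹ = d * (c * x * c⁻¹) * d⁻¹ := by group
  rw [e]
  exact (h1.conj' h d).trans' h h2

lemma pm_inv (h : Ctx G z) {c x y : G} (h1 : pm z (c * x * c⁻¹) y) : pm z (c⁻¹ * y * c⁻¹⁻¹) x := by
  have := (h1.symm' h).conj' h c⁻¹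
  have e : c⁻¹ * (c * x * c⁻¹) * c⁻¹⁻¹ = x := by group
  rwa [e] at this

lemma pm_mulc (h : Ctx G z) {c x y x' y' : G} (h1 : pm z (c * x * c⁻¹) x') (h2 : pm z (c * y * c⁻¹) y') :
    pm z (c * (x * y) * c⁻¹) (x' * y') := by
  have e : c * (x * y) * c⁻¹ = (c * x * c⁻¹) * (c * y * c⁻¹) := by group
  rw [e]; exact h1.mul' h h2

/-- no transpositions when `Q` is a Sylow subgroup -/
lemma no_transp (h : Ctx G z) {i j : G} (q : QP z i j) (S : Sylow 2 G) (hSQ : (S : Subgroup G) = Qs i j)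
    {c : G} (h1 : pm z (c * i * c⁻¹) j) (h2 : pm z (c * j * c⁻¹) i) : False := by
  have hf : Fact (Nat.Prime 2) := ⟨Nat.prime_two⟩
  obtain ⟨m, r, hr, hor⟩ := Nat.exists_eq_pow_mul_and_not_dvd (orderOf_pos c).ne' 2 (by norm_num)
  have hcN : c ∈ Subgroup.normalizer (Qs i j : Set G) :=
    QP.mem_norm (q.pm_mem h (mem_Qs_j i j) h1) (q.pm_mem h (mem_Qs_i i j) h2)
  have hod : orderOf (c ^ r) = 2 ^ m := by
    rw [orderOf_pow_of_dvd (by rintro rfl; simp at hr) (hor ▸ Dvd.intro_left _ rfl), hor,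
      Nat.mul_div_cancel _ (Nat.pos_of_ne_zero (by rintro rfl; simp at hr))]
  have hdQ : c ^ r ∈ Qs i j := by
    have := (zpowers_pgroup hod).inf_normalizer_sylow S
    have h3 : c ^ r ∈ Subgroup.zpowers (c ^ r) ⊓ Subgroup.normalizer (S : Set G) := by
      refine ⟨Subgroup.mem_zpowers _, ?_⟩
      have e : (S : Set G) = (Qs i j : Set G) := by rw [← hSQ]; rfl
      rw [e]
      exact pow_mem hcN r
    rw [this] at h3
    rw [← hSQ]; exact h3.2
  obtain ⟨k, hk⟩ : Odd r := by rwa [← Nat.not_even_iff_odd, even_iff_two_dvd]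
  have h3 : pm z (c ^ r * i * (c ^ r)⁻¹) j := by
    have e : c ^ r = c * (c * c) ^ k := by rw [hk, pow_succ', pow_mul, pow_two]
    rw [e]
    exact pm_comp h (pm_pow_fix h (pm_comp h h1 h2) k) h1
  exact q.not_pm h (((q.conj_fix h hdQ).symm' h).trans' h h3)

lemma perfect_C4 (h : Ctx G z) (hP : commutator G = ⊤) (hS : ∀ S : Sylow 2 G, ∃ s, GQ z S s)
    {i j : G} (q : QP z i j) :
    ∃ c, pm z (c * i * c⁻¹) j ∧ pm z (c * j * c⁻¹) (i * j) := by
  have h2 : Fact (Nat.Prime 2) := ⟨Nat.prime_two⟩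
  by_cases hQ : ∃ S : Sylow 2 G, (S : Subgroup G) = Qs i j
  · obtain ⟨S, hSQ⟩ := hQ
    obtain ⟨s, qs⟩ := hS S
    obtain ⟨g, hg⟩ := perfect_conj h hP S qs q.jj q.ii
    set X := Subgroup.normalizer (Subgroup.zpowers i : Set G) with hX
    obtain ⟨x, hx, hxS⟩ := syl_in X S (hSQ ▸ q.Qs_le h) ((g • S : Sylow 2 G) : Subgroup G) (g • S).2 (by
      intro y hy
      rw [syl_smul_mem, hSQ, Qs_comm] at hy
      have h3 := (q.symm h).conj_fix h hy
      rw [hX, mem_norm_zpowers h q.ii, ← hg]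
      have := h3.conj' h g
      have e : g * (g⁻¹ * y * g * j * (g⁻¹ * y * g)⁻¹) * g⁻¹ = y * (g * j * g⁻¹) * y⁻¹ := by group
      rwa [e] at this)
    have hcQ : ∀ y ∈ Qs i j, (x⁻¹ * g) * y * (x⁻¹ * g)⁻¹ ∈ Qs i j := by
      intro y hy
      rw [← hSQ]
      have := hxS (g * y * g⁻¹) (by
        rw [syl_smul_mem, hSQ]
        have e : g⁻¹ * (g * y * g⁻¹) * g = y := by group
        rwa [e])
      have e : x⁻¹ * g * y * (x⁻¹ * g)⁻¹ = x⁻¹ * (g * y * g⁻¹) * x := by group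
      rwa [e]
    set c := x⁻¹ * g with hc
    have hcj : pm z (c * j * c⁻¹) i := by
      have h3 := (mem_norm_zpowers h q.ii _).mp (inv_mem hx)
      rw [← hg] at h3 ⊢
      have e : c * j * c⁻¹ = x⁻¹ * (g * j * g⁻¹) * x⁻¹⁻¹ := by rw [hc]; group
      rw [e]; exact h3
    rcases q.mem_J h _ (hcQ i (mem_Qs_i i j)) (h.conjJ q.ii c) with h3 | h3 | h3
    · exfalso
      exact (q.conj h c).not_pm h (pm.trans' h h3 (hcj.symm' h))
    · exact (no_transp h q S hSQ h3 hcj).elim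
    · refine ⟨c⁻¹, pm_inv h hcj, ?_⟩
      have h4 : pm z (c * (i * j) * c⁻¹) j := by
        refine (pm_mulc h h3 hcj).trans' h ?_
        have := ((q.k h).symm h).ij h
        refine pm.trans' h (y := i * (i * j)) ?_ (q.ik_pm h)
        right
        rw [this, mul_assoc _ z z, h.z2, mul_one]
      exact pm_inv h h4
  · obtain ⟨t, ht1, ht2⟩ := (perfect_dich h hP hS q).resolve_left hQ
    obtain ⟨t', ht1', ht2'⟩ := (perfect_dich h hP hS (q.symm h)).resolve_left (by rwa [Qs_comm])
    have key : ∀ {i j t : G}, QP z i j → pm z (t * t) i → j * t * j⁻¹ = t⁻¹ →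
        pm z (t * i * t⁻¹) i ∧ pm z (t * j * t⁻¹) (i * j) := by
      intro i j t q ht1 ht2
      constructor
      · have := ht1.conj' h t
        have e : t * (t * t) * t⁻¹ = t * t := by group
        rw [e] at this
        exact ((ht1.symm' h).trans' h this).symm' h
      · have e : t * j * t⁻¹ = t * t * j := by
          have : j * t * j⁻¹ * j = t⁻¹ * j := by rw [ht2]
          have e1 : t⁻¹ * j = j * t := by rw [← this]; group
          have e2 : j * t⁻¹ = t * j := by
            calc j * t⁻¹ = t * (t⁻¹ * j) * t⁻¹ := by group
              _ = t * j := by rw [e1]; group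
          rw [mul_assoc, e2, mul_assoc]
        rw [e]
        exact ht1.mul' h (pm.refl j)
    obtain ⟨a1, a2⟩ := key q ht1 ht2
    obtain ⟨b1, b2⟩ := key (q.symm h) ht1' ht2'
    have b2' : pm z (t' * i * t'⁻¹) (i * j) := b2.trans' h (Or.inr (q.ij h))
    refine ⟨t * t', ?_, ?_⟩
    · refine pm_comp h b2' ?_
      exact (pm_mulc h a1 a2).trans' h (q.ik_pm h)
    · exact pm_comp h b1 a2

lemma perfect_gb (h : Ctx G z) (hP : commutator G = ⊤) (hS : ∀ S : Sylow 2 G, ∃ s, GQ z S s)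
    {i j : G} (q : QP z i j) :
    (∃ a, G3 z i j a) ∨ ∃ b, orderOf b = 3 ∧ b * i = i * b ∧ b * j = j * b := by
  have hf : Fact (Nat.Prime 3) := ⟨Nat.prime_three⟩
  obtain ⟨c, hci, hcj⟩ := perfect_C4 h hP hS q
  have hck : pm z (c * (i * j) * c⁻¹) i := (pm_mulc h hci hcj).trans' h (q.jk_pm h)
  obtain ⟨m, r, hr, hor⟩ := Nat.exists_eq_pow_mul_and_not_dvd (orderOf_pos c).ne' 3 (by norm_num)
  obtain ⟨r', hrr', n, hn⟩ : ∃ r', r ∣ r' ∧ ∃ n, r' = 3 * n + 1 := by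
    have : r % 3 = 1 ∨ r % 3 = 2 := by omega
    rcases this with h1 | h1
    · exact ⟨r, dvd_rfl, r / 3, by omega⟩
    · exact ⟨r * 2, dvd_mul_right _ _, r * 2 / 3, by omega⟩
  have c3 : ∀ {d : G}, pm z (d * i * d⁻¹) j → pm z (d * j * d⁻¹) (i * j) →
      pm z (d ^ 3 * i * (d ^ 3)⁻¹) i ∧ pm z (d ^ 3 * j * (d ^ 3)⁻¹) j := by
    intro d hi hj
    have hk : pm z (d * (i * j) * d⁻¹) i := (pm_mulc h hi hj).trans' h (q.jk_pm h)
    have e : d ^ 3 = d * (d * d) := by rw [pow_succ', pow_two]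
    rw [e]
    exact ⟨pm_comp h (pm_comp h hi hj) hk, pm_comp h (pm_comp h hj hk) hi⟩
  obtain ⟨c3i, c3j⟩ := c3 hci hcj
  set d := c ^ r' with hd
  have ed : d = c * (c ^ 3) ^ n := by rw [hd, hn, pow_succ', pow_mul]
  have hdi : pm z (d * i * d⁻¹) j := by rw [ed]; exact pm_comp h (pm_pow_fix h c3i n) hci
  have hdj : pm z (d * j * d⁻¹) (i * j) := by rw [ed]; exact pm_comp h (pm_pow_fix h c3j n) hcj
  have hd1 : d ^ 3 ^ m = 1 := by
    obtain ⟨y, rfl⟩ := hrr'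
    rw [hd, ← pow_mul, mul_comm, ← mul_assoc, ← hor, pow_mul, pow_orderOf_eq_one, one_pow]
  obtain ⟨m', -, hm'⟩ := (Nat.dvd_prime_pow Nat.prime_three).mp (orderOf_dvd_of_pow_eq_one hd1)
  rcases m' with _ | _ | m'
  · exfalso
    rw [pow_zero, orderOf_eq_one_iff] at hm'
    rw [hm'] at hdi
    simp at hdi
    exact q.not_pm h hdi
  · left
    exact ⟨d, by simpa using hm', hdi, hdj⟩
  · right
    have ho : orderOf (d ^ 3 ^ (m' + 1)) = 3 := by
      rw [orderOf_pow_of_dvd (by positivity) (hm' ▸ pow_dvd_pow 3 (by omega)), hm',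
        Nat.pow_div (by omega) (by norm_num)]
      simp
    have e : ∀ x : G, x ^ 3 ^ (m' + 1) = (x ^ 3) ^ 3 ^ m' := fun x => by rw [← pow_mul, ← pow_succ']
    obtain ⟨d3i, d3j⟩ := c3 hdi hdj
    refine ⟨_, ho, pm_comm_of_odd h ?_ (by rw [ho]; decide), pm_comm_of_odd h ?_ (by rw [ho]; decide)⟩
    · rw [e]; exact pm_pow_fix h d3i _
    · rw [e]; exact pm_pow_fix h d3j _

end


lemma inv_pow_odd {G : Type*} [Group G] {g b : G} (h : g * b * g⁻¹ = b⁻¹) {n : ℕ} (hn : Odd n) :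
    g ^ n * b * (g ^ n)⁻¹ = b⁻¹ := by
  have := conj_pow_exp b g (-1) (by simpa using h) n
  rw [this, hn.neg_one_pow]; simp

lemma comm_sq_of_inv {G : Type*} [Group G] {g b : G} (h : g * b * g⁻¹ = b⁻¹) {n : ℕ} (hn : Even n) :
    g ^ n * b = b * g ^ n := by
  have := conj_pow_exp b g (-1) (by simpa using h) n
  rw [hn.neg_one_pow, zpow_one, mul_inv_eq_iff_eq_mul] at this
  exact this

lemma odd_inv_sq {G : Type*} [Group G] {g b : G} (h : g * b * g⁻¹ = b⁻¹) (ho : Odd (orderOf g)) :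
    b * b = 1 := by
  have := inv_pow_odd h ho
  rw [pow_orderOf_eq_one] at this
  have h2 : b = b⁻¹ := by simpa using this
  nth_rw 2 [h2]; simp

lemma cyc_mem {S : Type*} [Group S] [Finite S] [IsCyclic S] {x y : S} (h : x ^ orderOf y = 1) :
    x ∈ Subgroup.zpowers y := by
  classical
  have := Fintype.ofFinite S
  have h1 := IsCyclic.card_pow_eq_one_le (α := S) (orderOf_pos y)
  have h2 : (Finset.univ.filter (fun a : S => a ∈ Subgroup.zpowers y)) ⊆
      (Finset.univ.filter (fun a : S => a ^ orderOf y = 1)) := by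
    intro a ha
    simp only [Finset.mem_filter, Finset.mem_univ, true_and] at ha ⊢
    obtain ⟨n, rfl⟩ := ha
    simp only
    rw [← zpow_natCast, zpow_comm, zpow_natCast, pow_orderOf_eq_one, one_zpow]
  have h3 : (Finset.univ.filter (fun a : S => a ∈ Subgroup.zpowers y)).card = orderOf y := by
    rw [← Nat.card_zpowers, Nat.card_eq_fintype_card, Fintype.card_subtype]
  have h4 := Finset.eq_of_subset_of_card_le h2 (by rw [h3]; exact h1)
  have : x ∈ (Finset.univ.filter (fun a : S => a ^ orderOf y = 1)) := by simpa using h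
  rw [← h4] at this
  simpa using this

lemma ord_conj {G : Type*} [Group G] [Finite G] (hF : FC G) {t : ℕ} (ht : t.Prime) (ht2 : t ≠ 2)
    {b b' : G} (hb : orderOf b = t) (hb' : orderOf b' = t) :
    ∃ c : G, c * b * c⁻¹ ∈ Subgroup.zpowers b' := by
  have := Fact.mk ht
  obtain ⟨S, hS⟩ := (zpowers_pgroup (p := t) (x := b') (n := 1) (by simpa using hb')).exists_le_sylow
  obtain ⟨T, hT⟩ := (zpowers_pgroup (p := t) (x := b) (n := 1) (by simpa using hb)).exists_le_sylow
  obtain ⟨g, hg⟩ := MulAction.exists_smul_eq G T S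
  have hbS : g * b * g⁻¹ ∈ (S : Subgroup G) := by
    rw [← hg, syl_smul_mem]
    have : g⁻¹ * (g * b * g⁻¹) * g = b := by group
    rw [this]; exact hT (Subgroup.mem_zpowers b)
  have hb'S : b' ∈ (S : Subgroup G) := hS (Subgroup.mem_zpowers b')
  have hc : IsCyclic S := (hF.subgroup (S : Subgroup G)).odd_cyclic S.isPGroup' ht2
  have := cyc_mem (S := (S : Subgroup G)) (x := ⟨_, hbS⟩) (y := ⟨b', hb'S⟩) (by
    rw [Subgroup.orderOf_mk, hb']
    have hbt : b ^ t = 1 := by rw [← hb]; exact pow_orderOf_eq_one b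
    ext
    simp [conj_pow, hbt])
  obtain ⟨n, hn⟩ := this
  refine ⟨g, n, ?_⟩
  have := congrArg Subtype.val hn
  simpa using this

lemma ord_conj_sub {G : Type*} [Group G] [Finite G] (hF : FC G) (O : Subgroup G) {t : ℕ} (ht : t.Prime)
    (ht2 : t ≠ 2) {b b' : G} (hbO : b ∈ O) (hbO' : b' ∈ O) (hb : orderOf b = t) (hb' : orderOf b' = t) :
    ∃ c ∈ O, c * b * c⁻¹ ∈ Subgroup.zpowers b' := by
  obtain ⟨c, n, hn⟩ := ord_conj (hF.subgroup O) ht ht2 (b := ⟨b, hbO⟩) (b' := ⟨b', hbO'⟩)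
    (by rw [Subgroup.orderOf_mk, hb]) (by rw [Subgroup.orderOf_mk, hb'])
  refine ⟨c, c.2, n, ?_⟩
  have := congrArg Subtype.val hn
  simpa using this

section
variable {G K V : Type*} [Group G] [Finite G] [Field K] [AddCommGroup V] [Module K V]
  {ρ : G →* Module.End K V} {z : G}

lemma ord3_inv {b x : G} (hb : orderOf b = 3) (hx : x ∈ Subgroup.zpowers b) : x = 1 ∨ x = b ∨ x = b⁻¹ := by
  obtain ⟨n, rfl⟩ := hx
  simp only
  have h3 : b ^ (3 : ℤ) = 1 := by
    have := pow_orderOf_eq_one b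
    rw [hb] at this; exact_mod_cast this
  have h : b ^ n = b ^ (n % 3) := by
    conv_lhs => rw [← Int.emod_add_mul_ediv n 3, zpow_add, zpow_mul, h3, one_zpow, mul_one]
  have : n % 3 = 0 ∨ n % 3 = 1 ∨ n % 3 = 2 := by omega
  rcases this with e | e | e <;> rw [h, e]
  · left; simp
  · right; left; simp
  · right; right
    rw [eq_inv_iff_mul_eq_one, ← zpow_add_one]; exact h3

/-- a two-element part: odd power which is a 2-element -/
lemma two_part (g : G) : ∃ r, Odd r ∧ ∃ n, orderOf (g ^ r) = 2 ^ n := by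
  obtain ⟨n, r, hr, h⟩ := Nat.exists_eq_pow_mul_and_not_dvd (orderOf_pos g).ne' 2 (by norm_num)
  refine ⟨r, by rw [← Nat.not_even_iff_odd, even_iff_two_dvd]; exact hr, n, ?_⟩
  rw [orderOf_pow_of_dvd (by rintro rfl; simp at hr) (h ▸ Dvd.intro_left _ rfl), h,
    Nat.mul_div_cancel _ (Nat.pos_of_ne_zero (by rintro rfl; simp at hr))]

lemma perfect_C5 [IsAlgClosed K] [FiniteDimensional K V] [Nontrivial V] (hρ : FPF ρ)
    (h : Ctx G z) (hP : commutator G = ⊤) (hS : ∀ S : Sylow 2 G, ∃ s, GQ z S s)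
    {i j : G} (q : QP z i j) {b : G} (hb : orderOf b = 3) (hbi : b * i = i * b) (hbj : b * j = j * b) :
    False := by
  have h2 : Fact (Nat.Prime 2) := ⟨Nat.prime_two⟩
  have hb1 : b ≠ 1 := by rintro rfl; simp at hb
  have hbb : b * b ≠ 1 := by
    intro h0
    have := orderOf_dvd_of_pow_eq_one (x := b) (n := 2) (by rw [pow_two, h0])
    rw [hb] at this; norm_num at this
  obtain ⟨g, hg1, hg2⟩ := perfect_F2 h.fc hP Nat.prime_three (by norm_num) hb
  have hg : g * b * g⁻¹ = b⁻¹ := by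
    rcases ord3_inv hb hg1 with e | e | e
    · exact absurd (by simpa using e) hb1
    · exact absurd (by rw [mul_inv_eq_iff_eq_mul] at e; exact e) hg2
    · exact e
  set N := Subgroup.normalizer (Subgroup.zpowers b : Set G) with hN
  have hNmem : ∀ x, (x * b * x⁻¹ = b ∨ x * b * x⁻¹ = b⁻¹) → x ∈ N := by
    intro x hx
    have hle : Subgroup.map (MulAut.conj x).toMonoidHom (Subgroup.zpowers b) ≤ Subgroup.zpowers b := by
      rw [MonoidHom.map_zpowers, Subgroup.zpowers_le]
      rcases hx with e | e
      · simp [e]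
      · simp [e]
    rw [hN, Subgroup.mem_normalizer_iff_map_conj_eq]
    exact Subgroup.eq_of_le_of_card_ge hle (by
      rw [Subgroup.card_map_of_injective (MulAut.conj x).injective])
  have hNinv : ∀ x ∈ N, x * b * x⁻¹ = b ∨ x * b * x⁻¹ = b⁻¹ := by
    intro x hx
    rcases ord3_inv hb ((Subgroup.mem_normalizer_iff.mp hx b).mp (Subgroup.mem_zpowers b)) with e | e | e
    · exact absurd (by simpa using e) hb1
    · exact Or.inl e
    · exact Or.inr e
  obtain ⟨r, hr, n, hn⟩ := two_part g
  set y0 := g ^ r with hy0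
  have hy0b : y0 * b * y0⁻¹ = b⁻¹ := inv_pow_odd hg hr
  have hiN : i ∈ N := hNmem _ (Or.inl (by rw [← hbi]; group))
  have hjN : j ∈ N := hNmem _ (Or.inl (by rw [← hbj]; group))
  have hQN : Qs i j ≤ N := by
    rw [Qs, Subgroup.closure_le]
    rintro x (rfl | rfl)
    · exact hiN
    · exact hjN
  obtain ⟨T, hT⟩ := ((q.pgroup h).comap_of_injective N.subtype N.subtype_injective :
    IsPGroup 2 ((Qs i j).subgroupOf N)).exists_le_sylow
  obtain ⟨x, -, hx⟩ := syl_in (G := N) ⊤ T le_top ((Subgroup.zpowers y0).subgroupOf N)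
    ((zpowers_pgroup hn).comap_of_injective N.subtype N.subtype_injective) le_top
  set S1 : Subgroup G := (T : Subgroup N).map N.subtype with hS1
  have hQS : Qs i j ≤ S1 := by
    intro w hw
    exact ⟨⟨w, hQN hw⟩, hT (by simpa [Subgroup.mem_subgroupOf] using hw), rfl⟩
  have hS1p : IsPGroup 2 S1 := T.isPGroup'.map N.subtype
  have hy : ∃ y ∈ S1, y * b * y⁻¹ = b⁻¹ := by
    have := hx ⟨y0, hNmem _ (Or.inr hy0b)⟩ (by simp [Subgroup.mem_subgroupOf])
    refine ⟨_, ⟨_, this, rfl⟩, ?_⟩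
    have e : (N.subtype (x⁻¹ * ⟨y0, hNmem _ (Or.inr hy0b)⟩ * x)) = (x : G)⁻¹ * y0 * x := by simp
    rw [e]
    have e1 : ((x : G)⁻¹ * y0 * x) * b * ((x : G)⁻¹ * y0 * x)⁻¹
        = (x : G)⁻¹ * (y0 * (x * b * (x : G)⁻¹) * y0⁻¹) * x := by group
    rw [e1]
    rcases hNinv x x.2 with e2 | e2
    · rw [e2, hy0b]
      rw [mul_inv_eq_iff_eq_mul] at e2
      have e3 : b⁻¹ * (x : G) = x * b⁻¹ := by
        have := e2
        rw [eq_comm, ← eq_inv_mul_iff_mul_eq] at this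
        rw [inv_mul_eq_iff_eq_mul, ← mul_assoc, e2.symm]; group
      rw [mul_assoc, e3]; group
    · rw [e2]
      have e4 : y0 * b⁻¹ * y0⁻¹ = b := by rw [← conj_inv, hy0b, inv_inv]
      rw [e4]
      rw [mul_inv_eq_iff_eq_mul] at e2
      have e5 : b * (x : G) = x * b⁻¹ := by
        have : b * (x * b) * b⁻¹ = b * (b⁻¹ * x) * b⁻¹ := by rw [e2]
        simpa [mul_assoc] using this
      rw [mul_assoc, e5]; group
  obtain ⟨y, hyS, hyb⟩ := hy
  have hij : i * j ≠ j * i := by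
    intro e
    exact q.not_pm h (h.commJ q.ii q.jj e)
  have hyc : ¬ y * b = b * y := by
    intro e
    rw [e, mul_inv_cancel_right] at hyb
    apply hbb; nth_rw 2 [hyb]; simp
  rcases two_sub h S1 hS1p with ⟨s, hs⟩ | ⟨s, qs⟩
  · exact hij (comm_zpowers (hs ▸ hQS (mem_Qs_i i j)) (hs ▸ hQS (mem_Qs_j i j)))
  have ht : ∃ t ∈ Qs i j, t ∉ Subgroup.zpowers s ∧ b * t = t * b := by
    by_cases h1 : i ∈ Subgroup.zpowers s
    · by_cases h2 : j ∈ Subgroup.zpowers s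
      · exact absurd (comm_zpowers h1 h2) hij
      · exact ⟨j, mem_Qs_j i j, h2, hbj⟩
    · exact ⟨i, mem_Qs_i i j, h1, hbi⟩
  obtain ⟨t, htQ, hts, htb⟩ := ht
  have hS1N : S1 ≤ N := by
    rintro _ ⟨w, -, rfl⟩; exact w.2
  have hzc : ∀ w ∈ Subgroup.zpowers s, s * b = b * s → w * b = b * w := by
    rintro _ ⟨n, rfl⟩ hsb
    exact ((Commute.zpow_left (show Commute s b from hsb) n) : _)
  have hsb : s * b * s⁻¹ = b⁻¹ := by
    rcases hNinv s (hS1N qs.mem) with e | e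
    · exfalso
      have hsb : s * b = b * s := by rw [mul_inv_eq_iff_eq_mul] at e; exact e
      by_cases hys : y ∈ Subgroup.zpowers s
      · exact hyc (hzc y hys hsb)
      · have := hzc _ (qs.out_mul (hQS htQ) hyS hts hys) hsb
        apply hyc
        rw [mul_assoc, ← mul_assoc b, htb, mul_assoc] at this
        exact mul_left_cancel this
    · exact e
  have hsc : ¬ s * b = b * s := by
    intro e
    rw [e, mul_inv_cancel_right] at hsb
    apply hbb; nth_rw 2 [hsb]; simp
  have hQb : ∀ w ∈ Qs i j, w * b = b * w := by
    intro w hw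
    have : Qs i j ≤ Subgroup.centralizer {b} := by
      rw [Qs, Subgroup.closure_le]
      rintro x (rfl | rfl)
      · exact Subgroup.mem_centralizer_singleton_iff.mpr hbi.symm
      · exact Subgroup.mem_centralizer_singleton_iff.mpr hbj.symm
    exact Subgroup.mem_centralizer_singleton_iff.mp (this hw)
  have h8 : 8 ∣ orderOf s := by
    apply qs.eight hS1p
    intro h4
    have : Qs i j = S1 := Subgroup.eq_of_le_of_card_ge hQS (by rw [q.card h, qs.card, h4])
    exact hsc (hQb s (this ▸ qs.mem))
  set i1 := s ^ (orderOf s / 4) with hi1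
  have hi1b : b * i1 = i1 * b := (comm_sq_of_inv hsb (by
    obtain ⟨c, hc⟩ := h8
    rw [hc]; exact ⟨c, by omega⟩)).symm
  set j' := s * t with hj'
  have hj'S : j' ∈ S1 := mul_mem qs.mem (hQS htQ)
  have hj's : j' ∉ Subgroup.zpowers s := by
    intro e
    apply hts
    exact ((Subgroup.zpowers s).mul_mem_cancel_left (Subgroup.mem_zpowers s)).mp e
  have hj'b : j' * b * j'⁻¹ = b⁻¹ := by
    have : j' * b * j'⁻¹ = s * (t * b * t⁻¹) * s⁻¹ := by rw [hj']; group
    rw [this, ← htb, mul_inv_cancel_right, hsb]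
  have q' : QP z i1 j' := ⟨qs.i0 h, (qs.anti j' hj'S hj's).2,
    qs.inv_all hj'S hj's (Subgroup.npow_mem_zpowers s _)⟩
  rcases perfect_gb h hP hS q' with ⟨a, ga⟩ | ⟨b', hb', hb'i, hb'j⟩
  · exact hb1 (angle hρ h q' ga (by rw [hb]; decide) hi1b hj'b)
  obtain ⟨O, hO, -⟩ := odd_sub h q'.ii
  obtain ⟨c, hcO, hc⟩ := ord_conj_sub h.fc O Nat.prime_three (by norm_num)
    ((hO b).mpr ⟨hi1b, by rw [hb]; decide⟩) ((hO b').mpr ⟨hb'i, by rw [hb']; decide⟩) hb hb'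
  have hcj : j' * (c * b * c⁻¹) * j'⁻¹ = c * b * c⁻¹ := by
    obtain ⟨n, hn⟩ := hc
    rw [← hn]
    simp only
    rw [mul_inv_eq_iff_eq_mul]
    exact (Commute.zpow_right (show Commute j' b' from hb'j.symm) n)
  have hc' : j' * c * j'⁻¹ ∈ O := by
    rw [hO] at hcO ⊢
    refine ⟨?_, by rw [← MulAut.conj_apply, MulEquiv.orderOf_eq]; exact hcO.2⟩
    have e1 : j'⁻¹ * i1 * j' = i1⁻¹ := by
      have := q'.ji
      have h3 : j' * i1⁻¹ * j'⁻¹ = i1 := by rw [← conj_inv, this, inv_inv]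
      nth_rw 1 [← h3]; group
    have e2 : j' * c * j'⁻¹ * i1 = j' * (c * (j'⁻¹ * i1 * j')) * j'⁻¹ := by group
    have e3 : c * i1⁻¹ = i1⁻¹ * c := (Commute.inv_right (show Commute c i1 from hcO.1))
    rw [e2, e1, e3]
    have h3 : j' * i1⁻¹ * j'⁻¹ = i1 := by rw [← conj_inv, q'.ji, inv_inv]
    have e4 : i1 * (j' * c * j'⁻¹) = (j' * i1⁻¹ * j'⁻¹) * (j' * c * j'⁻¹) := by rw [h3]
    rw [e4]; group
  have ho : c⁻¹ * (j' * c * j'⁻¹) ∈ O := mul_mem (inv_mem hcO) hc'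
  refine hbb (odd_inv_sq (g := c⁻¹ * (j' * c * j'⁻¹)) ?_ ((hO _).mp ho).2)
  have e1 : j' * (c * b * c⁻¹) * j'⁻¹ = (j' * c * j'⁻¹) * (j' * b * j'⁻¹) * (j' * c * j'⁻¹)⁻¹ := by group
  rw [e1, hj'b] at hcj
  have e2 : (j' * c * j'⁻¹) * b * (j' * c * j'⁻¹)⁻¹ = (c * b * c⁻¹)⁻¹ := by
    rw [← hcj]; simp [mul_assoc]
  have e3 : (c⁻¹ * (j' * c * j'⁻¹)) * b * (c⁻¹ * (j' * c * j'⁻¹))⁻¹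
    = c⁻¹ * ((j' * c * j'⁻¹) * b * (j' * c * j'⁻¹)⁻¹) * c := by simp only [mul_inv_rev, mul_assoc, inv_inv]
  rw [e3, e2]; group

lemma perfect_good [IsAlgClosed K] [FiniteDimensional K V] [Nontrivial V] (hρ : FPF ρ)
    (h : Ctx G z) (hP : commutator G = ⊤) (hS : ∀ S : Sylow 2 G, ∃ s, GQ z S s)
    {i j : G} (q : QP z i j) : ∃ a, G3 z i j a := by
  rcases perfect_gb h hP hS q with h1 | ⟨b, hb, h1, h2⟩
  · exact h1
  · exact (perfect_C5 hρ h hP hS q hb h1 h2).elim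
end


section
variable {G K V : Type*} [Group G] [Finite G] [Field K] [AddCommGroup V] [Module K V]
  {ρ : G →* Module.End K V} {z : G}

lemma G3.norm (h : Ctx G z) {i j a : G} (q : QP z i j) (g : G3 z i j a) :
    a ∈ Subgroup.normalizer (Qs i j : Set G) :=
  QP.mem_norm (q.pm_mem h (mem_Qs_j i j) g.ai)
    (q.pm_mem h (mul_mem (mem_Qs_i i j) (mem_Qs_j i j)) g.aj)

lemma perfect_C6 [IsAlgClosed K] [FiniteDimensional K V] [Nontrivial V] (hρ : FPF ρ)
    (h : Ctx G z) (hP : commutator G = ⊤) (hS : ∀ S : Sylow 2 G, ∃ s, GQ z S s)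
    {t j : G} (q : QP z (t * t) j) (htj : j * t * j⁻¹ = t⁻¹) : False := by
  have htj' : t * j * t⁻¹ = t * t * j := by
    have e : t⁻¹ * j = j * t := by rw [← htj]; group
    have : j * t⁻¹ = t * j := by
      calc j * t⁻¹ = t * (t⁻¹ * j) * t⁻¹ := by group
        _ = t * j := by rw [e]; group
    rw [mul_assoc, this, mul_assoc]
  have q2 : QP z (t * t) (t * j) := by
    refine ⟨q.ii, ?_, ?_⟩
    · have : t * j * (t * j) = t * (j * t * j⁻¹) * (j * j) := by group
      rw [this, htj, q.jj]; simp
    · have : t * j * (t * t) * (t * j)⁻¹ = t * (j * (t * t) * j⁻¹) * t⁻¹ := by group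
      rw [this, q.ji]; group
  obtain ⟨a, ga⟩ := perfect_good hρ h hP hS q
  obtain ⟨a2, ga2⟩ := perfect_good hρ h hP hS q2
  obtain ⟨v, hv, χ, -, hχ⟩ := hρ.exists_char (Subgroup.zpowers t)
    (fun x hx y hy => comm_zpowers hx hy)
  have ht : ρ t v = χ ⟨t, Subgroup.mem_zpowers t⟩ • v := hχ ⟨t, Subgroup.mem_zpowers t⟩
  have hi : ρ (t * t) v = χ ⟨t * t, mul_mem (Subgroup.mem_zpowers t) (Subgroup.mem_zpowers t)⟩ • v :=
    hχ ⟨t * t, mul_mem (Subgroup.mem_zpowers t) (Subgroup.mem_zpowers t)⟩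
  obtain ⟨hW2, hWi, hWj, hWu⟩ := span_W hρ h q hv hi
  have hWt := hWu t _ ht htj
  set W := Submodule.span K ({v, ρ j v} : Set V) with hW
  have hWtj : ∀ w ∈ W, ρ (t * j) w ∈ W := by
    intro w hw
    rw [map_mul]; exact hWt _ (hWj w hw)
  have hWa := good_inv hρ h q ga.ord ga.ai ga.aj W hWi hWj
  have hWa2 := good_inv hρ h q2 ga2.ord ga2.ai ga2.aj W hWi hWtj
  set X : Set G := {t, j, a, a2} with hX
  set L := Subgroup.closure X with hL
  have tL : t ∈ L := Subgroup.subset_closure (by simp [hX])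
  have jL : j ∈ L := Subgroup.subset_closure (by simp [hX])
  have aL : a ∈ L := Subgroup.subset_closure (by simp [hX])
  have a2L : a2 ∈ L := Subgroup.subset_closure (by simp [hX])
  have hLW : ∀ g ∈ L, ∀ w ∈ W, ρ g w ∈ W := by
    apply closure_inv
    rintro g (rfl | rfl | rfl | rfl)
    · exact hWt
    · exact hWj
    · exact hWa
    · exact hWa2
  have hijc : j * (t * t) ≠ t * t * j := fun e => q.not_pm h (h.commJ q.ii q.jj e.symm)
  have ht8 : t ^ 8 = 1 := by
    have : t ^ 8 = (t * t * (t * t)) * (t * t * (t * t)) := by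
      simp only [pow_succ, pow_zero, one_mul, mul_assoc]
    rw [this, q.ii, h.z2]
  have htt : t * t ≠ 1 := h.j_ne_one q.ii
  have hodd : ∀ n, Odd n → t ^ n * j ≠ j * t ^ n := by
    intro n hn e
    have h1 : j * t ^ n * j⁻¹ = (t ^ n)⁻¹ := by rw [← conj_pow, htj, inv_pow]
    rw [← e, mul_inv_cancel_right] at h1
    have h2 : t ^ (2 * n) = 1 := by
      rw [two_mul, pow_add]; nth_rw 2 [h1]; simp
    have h3 : orderOf t ∣ 2 := by
      have h4 := Nat.dvd_gcd (orderOf_dvd_of_pow_eq_one h2) (orderOf_dvd_of_pow_eq_one ht8)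
      have h5 : Nat.gcd (2 * n) 8 = 2 := by
        have : Nat.Coprime n 4 := Nat.Coprime.pow_right 2 (Nat.coprime_two_right.mpr hn)
        rw [show (8 : ℕ) = 2 * 4 by norm_num, Nat.gcd_mul_left, this.gcd_eq_one]
      rwa [h5] at h4
    apply htt
    rw [← pow_two]; exact orderOf_dvd_iff_pow_eq_one.mp h3
  rcases dick2 hρ h q L (mul_mem tL tL) jL W hW2 hLW with ⟨A, hA, hLA, hs⟩ | ⟨m, N, Z, hD, hZ⟩
  · exact ga.no_abel h q A hA (hLA a aL) hs
  have htZ : (⟨t, tL⟩ : L) ∉ Z := by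
    intro e
    have := hZ _ e ⟨j, jL⟩
    exact hodd 1 (by decide) (by simpa using this)
  obtain ⟨e, he, -, hce⟩ := hD.cent _ htZ
  have hte : (⟨t, tL⟩ : L) ^ e ∈ Z := hce _ rfl
  have htec : t ^ e * j = j * t ^ e := by
    have := hZ _ hte ⟨j, jL⟩
    simpa using this
  have hNe : N = 24 ∧ e = 4 := by
    have h1 : e ≠ 3 := by rintro rfl; exact hodd 3 (by decide) htec
    have h2 : e ≠ 5 := by rintro rfl; exact hodd 5 (by decide) htec
    have h3 : e ≠ 2 := by
      rintro rfl; rw [pow_two] at htec; exact hijc htec.symm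
    have := hD.mN
    omega
  obtain ⟨rfl, rfl⟩ := hNe
  have hZn : Z.Normal := ⟨fun n hn g => by
    have : g * n * g⁻¹ = n := by
      ext
      have := hZ n hn g
      simp [← this]
    rwa [this]⟩
  set f := QuotientGroup.mk' Z with hf
  set M : Subgroup L := (Subgroup.normalizer (Qs (t * t) j : Set G)).subgroupOf L with hM
  have hZM : Z ≤ M := by
    intro x hx
    rw [hM, Subgroup.mem_subgroupOf]
    apply QP.mem_norm
    · have := hZ x hx ⟨t * t, mul_mem tL tL⟩
      simp only at this
      rw [this, mul_inv_cancel_right]; exact mem_Qs_i _ _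
    · have := hZ x hx ⟨j, jL⟩
      simp only at this
      rw [this, mul_inv_cancel_right]; exact mem_Qs_j _ _
  have htM : (⟨t, tL⟩ : L) ∈ M := by
    rw [hM, Subgroup.mem_subgroupOf]
    apply QP.mem_norm
    · have : t * (t * t) * t⁻¹ = t * t := by group
      simp only; rw [this]; exact mem_Qs_i _ _
    · simp only; rw [htj']; exact mul_mem (mem_Qs_i _ _) (mem_Qs_j _ _)
  have haM : (⟨a, aL⟩ : L) ∈ M := by
    rw [hM, Subgroup.mem_subgroupOf]; exact ga.norm h q
  have haZ : (⟨a, aL⟩ : L) ∉ Z := by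
    intro e
    have := hZ _ e ⟨j, jL⟩
    exact (ga.not_comm h q).2.1 this
  have o1 : orderOf (f ⟨a, aL⟩) = 3 := by
    apply orderOf_eq_prime
    · rw [← map_pow]
      have : (⟨a, aL⟩ : L) ^ 3 = 1 := by
        ext; simp [← ga.ord, pow_orderOf_eq_one]
      rw [this, map_one]
    · rw [hf, QuotientGroup.mk'_apply, Ne, QuotientGroup.eq_one_iff]; exact haZ
  have o2 : orderOf (f ⟨t, tL⟩) = 4 := by
    have hfz : ∀ x, f x = 1 ↔ x ∈ Z := fun x => by
      rw [hf, QuotientGroup.mk'_apply, QuotientGroup.eq_one_iff]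
    have : orderOf (f ⟨t, tL⟩) = 2 ^ (1 + 1) := by
      apply orderOf_eq_prime_pow
      · rw [← map_pow, hfz]
        intro e
        have := hZ _ e ⟨j, jL⟩
        apply hijc
        rw [pow_one] at this
        rw [← pow_two]
        simpa using this.symm
      · rw [← map_pow, hfz]; exact hte
    simpa using this
  have hfM : ∀ x ∈ M, orderOf (f x) ∣ Nat.card (M.map f) := by
    intro x hx
    have := orderOf_dvd_natCard (⟨f x, x, hx, rfl⟩ : M.map f)
    rwa [← Subgroup.orderOf_coe] at this
  have d1 := hfM _ haM
  have d2 := hfM _ htM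
  rw [o1] at d1
  rw [o2] at d2
  have hcq : Nat.card (L ⧸ Z) = 24 := by
    have h1 := Subgroup.card_eq_card_quotient_mul_card_subgroup Z
    rw [hD.card] at h1
    exact (Nat.eq_of_mul_eq_mul_right Nat.card_pos h1).symm
  have h12 : Nat.card (M.map f) * (M.map f).index = 24 := by
    rw [Subgroup.card_mul_index, hcq]
  have hidx : (M.map f).index = M.index :=
    Subgroup.index_map_eq M (QuotientGroup.mk'_surjective Z) (by rw [QuotientGroup.ker_mk']; exact hZM)
  have hi2 : M.index = 1 ∨ M.index = 2 := by
    rw [← hidx]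
    obtain ⟨c, hc⟩ : 12 ∣ Nat.card (M.map f) := by
      have := Nat.Coprime.mul_dvd_of_dvd_of_dvd (by norm_num : Nat.Coprime 3 4) d1 d2
      simpa using this
    rw [hc] at h12
    have : c * (M.map f).index = 2 := by
      have : 12 * (c * (M.map f).index) = 12 * 2 := by rw [← mul_assoc, h12]
      exact Nat.eq_of_mul_eq_mul_left (by norm_num) this
    exact (Nat.dvd_prime Nat.prime_two).mp (Dvd.intro_left _ this)
  have hsq : ∀ x : L, x * x ∈ M := by
    intro x
    rcases hi2 with h1 | h1
    · rw [Subgroup.index_eq_one] at h1; rw [h1]; trivial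
    · exact Subgroup.mul_self_mem_of_index_two h1 x
  have ha2 : (⟨a2, a2L⟩ : L) ∈ M := by
    have h3 : a2 ^ 3 = 1 := by rw [← ga2.ord]; exact pow_orderOf_eq_one a2
    have : (⟨a2, a2L⟩ : L) = (⟨a2, a2L⟩ * ⟨a2, a2L⟩) * (⟨a2, a2L⟩ * ⟨a2, a2L⟩) := by
      ext
      simp only [MulMemClass.mk_mul_mk]
      calc a2 = a2 ^ 3 * a2 := by rw [h3, one_mul]
        _ = _ := by simp only [pow_succ, pow_zero, one_mul, mul_assoc]
    rw [this]
    exact mul_mem (hsq _) (hsq _)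
  rw [hM, Subgroup.mem_subgroupOf] at ha2
  have h1 : a2 * (t * t) * a2⁻¹ ∈ Qs (t * t) j := (Subgroup.mem_normalizer_iff.mp ha2 _).mp (mem_Qs_i _ _)
  have h2 : t * j ∈ Qs (t * t) j := q.pm_mem h h1 (ga2.ai.symm' h)
  have h3 : t ∈ Qs (t * t) j := (Subgroup.mul_mem_cancel_right _ (mem_Qs_j _ _)).mp h2
  rcases q.not_J h t h3 (h.j_ne_z q.ii) with rfl | rfl
  · simp at htt
  · exact htt h.z2

lemma perfect_syl [IsAlgClosed K] [FiniteDimensional K V] [Nontrivial V] (hρ : FPF ρ)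
    (h : Ctx G z) (hP : commutator G = ⊤) (hS : ∀ S : Sylow 2 G, ∃ s, GQ z S s)
    {i j : G} (q : QP z i j) : ∃ S : Sylow 2 G, (S : Subgroup G) = Qs i j := by
  rcases perfect_dich h hP hS q with h1 | ⟨t, h1, h2⟩
  · exact h1
  · exact (perfect_C6 hρ h hP hS (q.pm_of h h1 (pm.refl j)) h2).elim

lemma exists_QP (h : Ctx G z) (hS : ∀ S : Sylow 2 G, ∃ s, GQ z S s) : ∃ i j : G, QP z i j := by
  obtain ⟨s, hs⟩ := hS (default : Sylow 2 G)
  obtain ⟨g, hg, hgs⟩ := hs.exists_out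
  exact ⟨s ^ (orderOf s / 4), g, hs.i0 h, (hs.anti g hg hgs).2,
    hs.inv_all hg hgs (Subgroup.npow_mem_zpowers s _)⟩
end


lemma act_coprime {G : Type*} [Group G] [Finite G] {t : ℕ} (ht : t.Prime) {ε c : G} (hε : orderOf ε = t)
    (hc : c * ε * c⁻¹ ∈ Subgroup.zpowers ε) {n : ℕ} (hn : c ^ n * ε = ε * c ^ n)
    (hco : Nat.Coprime n (t - 1)) : c * ε = ε * c := by
  have := Fact.mk ht
  rw [← mem_powers_iff_mem_zpowers] at hc
  obtain ⟨k, hk⟩ := hc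
  simp only at hk
  have h1 := conj_pow_exp ε c k (by rw [← hk]; simp) n
  rw [hn, mul_inv_cancel_right] at h1
  have h2 : (k : ZMod t) ^ n = 1 := by
    have : ε ^ (k ^ n) = ε ^ 1 := by rw [pow_one]; conv_rhs => rw [h1]
                                     rw [← zpow_natCast]; push_cast; rfl
    rw [pow_eq_pow_iff_modEq, hε] at this
    have := (ZMod.natCast_eq_natCast_iff _ _ _).mpr this
    push_cast at this; exact this
  have hn0 : n ≠ 0 ∨ n = 0 := by tauto
  have hk0 : (k : ZMod t) ≠ 0 := by
    intro h0
    have hk' : t ∣ k := (ZMod.natCast_eq_zero_iff _ _).mp h0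
    obtain ⟨l, rfl⟩ := hk'
    rw [pow_mul, ← hε, pow_orderOf_eq_one, one_pow] at hk
    have : ε = 1 := by simpa using hk.symm
    rw [this, orderOf_one] at hε
    exact ht.one_lt.ne hε
  have h3 : (k : ZMod t) ^ (t - 1) = 1 := ZMod.pow_card_sub_one_eq_one hk0
  have h4 : orderOf (k : ZMod t) ∣ 1 := by
    rw [← hco.gcd_eq_one]
    exact Nat.dvd_gcd (orderOf_dvd_of_pow_eq_one h2) (orderOf_dvd_of_pow_eq_one h3)
  have h5 : (k : ZMod t) = 1 := orderOf_eq_one_iff.mp (Nat.dvd_one.mp h4)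
  have h6 : k ≡ 1 [MOD t] := (ZMod.natCast_eq_natCast_iff _ _ _).mp (by simpa using h5)
  rw [← hε] at h6
  have h7 : ε ^ k = ε ^ 1 := pow_eq_pow_iff_modEq.mpr h6
  rw [pow_one, hk, mul_inv_eq_iff_eq_mul] at h7
  exact h7

lemma three_part {G : Type*} [Group G] [Finite G] (m : G) :
    ∃ n a, orderOf (m ^ (3 * n + 1)) = 3 ^ a := by
  obtain ⟨a, r, hr, h⟩ := Nat.exists_eq_pow_mul_and_not_dvd (orderOf_pos m).ne' 3 (by norm_num)
  have hr2 : r * r % 3 = 1 := by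
    have : r % 3 = 1 ∨ r % 3 = 2 := by omega
    rcases this with e | e <;> simp [Nat.mul_mod, e]
  refine ⟨r * r / 3, ?_⟩
  have e : 3 * (r * r / 3) + 1 = r * r := by omega
  rw [e]
  have : orderOf (m ^ (r * r)) ∣ 3 ^ a := by
    apply orderOf_dvd_of_pow_eq_one
    rw [← pow_mul, show r * r * 3 ^ a = (3 ^ a * r) * r by ring, ← h, pow_mul, pow_orderOf_eq_one, one_pow]
  obtain ⟨b, -, hb⟩ := (Nat.dvd_prime_pow Nat.prime_three).mp this
  exact ⟨b, hb⟩

section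
variable {G K V : Type*} [Group G] [Finite G] [Field K] [AddCommGroup V] [Module K V]
  {ρ : G →* Module.End K V} {z : G}

lemma odd_comm [IsAlgClosed K] [FiniteDimensional K V] [Nontrivial V] (hρ : FPF ρ)
    (h : Ctx G z) {i j a : G} (q : QP z i j) (g : G3 z i j a)
    {c : G} (hci : c * i = i * c) (hco : Odd (orderOf c)) : c * j = j * c := by
  obtain ⟨O, hO, -⟩ := odd_sub h q.ii
  have hcO : c ∈ O := (hO c).mpr ⟨hci, hco⟩
  have h3 : j * i⁻¹ * j⁻¹ = i := by rw [← conj_inv, q.ji, inv_inv]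
  have hc' : j * c * j⁻¹ ∈ O := by
    rw [hO]
    refine ⟨?_, by rw [← MulAut.conj_apply, MulEquiv.orderOf_eq]; exact hco⟩
    have e3 : c * i⁻¹ = i⁻¹ * c := (Commute.inv_right (show Commute c i from hci))
    calc j * c * j⁻¹ * i = j * c * j⁻¹ * (j * i⁻¹ * j⁻¹) := by rw [h3]
      _ = j * (c * i⁻¹) * j⁻¹ := by group
      _ = (j * i⁻¹ * j⁻¹) * (j * c * j⁻¹) := by rw [e3]; group
      _ = _ := by rw [h3]
  have hu : c⁻¹ * (j * c * j⁻¹) ∈ O := mul_mem (inv_mem hcO) hc'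
  have := angle hρ h q g (u := c⁻¹ * (j * c * j⁻¹)) ((hO _).mp hu).2 ((hO _).mp hu).1 (by
    have hz : z * c * z⁻¹ = c := by rw [← h.zc, mul_inv_cancel_right]
    calc j * (c⁻¹ * (j * c * j⁻¹)) * j⁻¹ = j * c⁻¹ * j⁻¹ * ((j * j) * c * (j * j)⁻¹) := by group
      _ = j * c⁻¹ * j⁻¹ * c := by rw [q.jj, hz]
      _ = _ := by group)
  rw [inv_mul_eq_one] at this
  nth_rw 1 [this]; group

lemma two_el (h : Ctx G z) {i j : G} (q : QP z i j) (hS : ∃ S : Sylow 2 G, (S : Subgroup G) = Qs i j)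
    {c : G} {n : ℕ} (hc : orderOf c = 2 ^ n) : c = 1 ∨ c = z ∨ c * c = z := by
  have h2 : Fact (Nat.Prime 2) := ⟨Nat.prime_two⟩
  obtain ⟨S, hS⟩ := hS
  obtain ⟨x, -, hx⟩ := syl_in ⊤ S le_top (Subgroup.zpowers c) (zpowers_pgroup hc) le_top
  have h1 := hx c (Subgroup.mem_zpowers c)
  rw [hS] at h1
  have hcc : c = x * (x⁻¹ * c * x) * x⁻¹ := by group
  by_cases h3 : (x⁻¹ * c * x) * (x⁻¹ * c * x) = z
  · right; right
    rw [hcc]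
    exact h.conjJ h3 x
  · rcases q.not_J h _ h1 h3 with e | e
    · left; rw [hcc, e]; simp
    · right; left; rw [hcc, e, h.zc, mul_inv_cancel_right]

/-- 2-part of an element commuting with `i`. -/
lemma two_cent (h : Ctx G z) {i j : G} (q : QP z i j) (hS : ∃ S : Sylow 2 G, (S : Subgroup G) = Qs i j)
    {c : G} (hci : c * i = i * c) {n : ℕ} (hc : orderOf c = 2 ^ n) : c = 1 ∨ c = z ∨ pm z c i := by
  rcases two_el h q hS hc with e | e | e
  · exact Or.inl e
  · exact Or.inr (Or.inl e)
  · exact Or.inr (Or.inr (h.commJ e q.ii hci))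

lemma norm_cases (h : Ctx G z) {i j : G} (q : QP z i j) {m x : G}
    (hm : m ∈ Subgroup.normalizer (Qs i j : Set G)) (hx : x ∈ Qs i j) (hxx : x * x = z) :
    pm z (m * x * m⁻¹) i ∨ pm z (m * x * m⁻¹) j ∨ pm z (m * x * m⁻¹) (i * j) :=
  q.mem_J h _ ((Subgroup.mem_normalizer_iff.mp hm x).mp hx) (h.conjJ hxx m)

lemma pm_conj_inj (h : Ctx G z) {m x y w : G} (h1 : pm z (m * x * m⁻¹) w) (h2 : pm z (m * y * m⁻¹) w) :
    pm z x y := by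
  have h3 : pm z (m * x * m⁻¹) (m * y * m⁻¹) := h1.trans' h (h2.symm' h)
  have := h3.conj' h m⁻¹
  have e : ∀ u : G, m⁻¹ * (m * u * m⁻¹) * m⁻¹⁻¹ = u := fun u => by group
  rwa [e, e] at this

lemma norm_cube (h : Ctx G z) {i j : G} (q : QP z i j)
    (hall : ∀ {i j : G}, QP z i j → ∃ S : Sylow 2 G, (S : Subgroup G) = Qs i j) {m : G}
    (hm : m ∈ Subgroup.normalizer (Qs i j : Set G)) :
    pm z (m ^ 3 * i * (m ^ 3)⁻¹) i ∧ pm z (m ^ 3 * j * (m ^ 3)⁻¹) j := by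
  have hij : ¬ pm z i j := q.not_pm h
  have hik : ¬ pm z i (i * j) := (q.k h).not_pm h
  have hjk : ¬ pm z j (i * j) := (q.jk h).not_pm h
  have e3 : m ^ 3 = m * (m * m) := by simp only [pow_succ, pow_zero, one_mul, mul_assoc]
  have cyc : ∀ {x y w : G}, pm z (m * x * m⁻¹) y → pm z (m * y * m⁻¹) w → pm z (m * w * m⁻¹) x →
      pm z (m ^ 3 * x * (m ^ 3)⁻¹) x := by
    intro x y w h1 h2 h3
    rw [e3]
    exact pm_comp h (pm_comp h h1 h2) h3
  have fx : ∀ {x : G}, pm z (m * x * m⁻¹) x → pm z (m ^ 3 * x * (m ^ 3)⁻¹) x := fun h1 => cyc h1 h1 h1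
  have hkQ : i * j ∈ Qs i j := mul_mem (mem_Qs_i i j) (mem_Qs_j i j)
  have tr : ∀ {x y : G}, QP z x y → pm z (m * x * m⁻¹) y → pm z (m * y * m⁻¹) x → False := by
    intro x y q' h1 h2
    obtain ⟨S, hS⟩ := hall q'
    exact no_transp h q' S hS h1 h2
  rcases norm_cases h q hm (mem_Qs_i i j) q.ii with a1 | a1 | a1 <;>
  rcases norm_cases h q hm (mem_Qs_j i j) q.jj with b1 | b1 | b1 <;>
  rcases norm_cases h q hm hkQ (q.kk h) with c1 | c1 | c1 <;>
  first
  | exact (hij (pm_conj_inj h a1 b1)).elim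
  | exact (hik (pm_conj_inj h a1 c1)).elim
  | exact (hjk (pm_conj_inj h b1 c1)).elim
  | exact ⟨fx a1, fx b1⟩
  | exact (tr q a1 b1).elim
  | exact (tr (q.k h) a1 c1).elim
  | exact (tr (q.jk h) b1 c1).elim
  | exact ⟨cyc a1 b1 c1, cyc b1 c1 a1⟩
  | exact ⟨cyc a1 c1 b1, cyc b1 a1 c1⟩

lemma perfect_O1 [IsAlgClosed K] [FiniteDimensional K V] [Nontrivial V] (hρ : FPF ρ)
    (h : Ctx G z) (hP : commutator G = ⊤) (hS : ∀ S : Sylow 2 G, ∃ s, GQ z S s)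
    {i j : G} (q : QP z i j) {c : G} (hci : c * i = i * c) (hco : Odd (orderOf c)) : c = 1 := by
  classical
  have h2 : Fact (Nat.Prime 2) := ⟨Nat.prime_two⟩
  by_contra hc1
  have hall : ∀ {i j : G}, QP z i j → ∃ S : Sylow 2 G, (S : Subgroup G) = Qs i j :=
    fun q => perfect_syl hρ h hP hS q
  obtain ⟨a, ga⟩ := perfect_good hρ h hP hS q
  have key : ∀ c : G, c * i = i * c → ∀ ℓ, ℓ ∣ orderOf c → ∃ n, orderOf (c ^ n) = ℓ ∧ c ^ n * i = i * c ^ n := by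
    intro c hci ℓ hl
    obtain ⟨k, hk⟩ := hl
    have hk0 : k ≠ 0 := by rintro rfl; rw [mul_zero] at hk; exact (orderOf_pos c).ne' hk
    refine ⟨k, ?_, (Commute.pow_left (show Commute c i from hci) k)⟩
    rw [orderOf_pow_of_dvd hk0 ⟨ℓ, by rw [hk, mul_comm]⟩, hk, Nat.mul_div_cancel _ (Nat.pos_of_ne_zero hk0)]
  have hex : ∃ t, t.Prime ∧ t ≠ 2 ∧ ∃ ε : G, orderOf ε = t ∧ ε * i = i * ε := by
    have h1 : orderOf c ≠ 1 := by rwa [Ne, orderOf_eq_one_iff]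
    obtain ⟨n, hn, hn2⟩ := key c hci _ (Nat.minFac_dvd (orderOf c))
    refine ⟨_, Nat.minFac_prime h1, ?_, _, hn, hn2⟩
    intro e
    rw [Nat.minFac_eq_two_iff] at e
    exact (Nat.not_even_iff_odd.mpr hco) (even_iff_two_dvd.mpr e)
  obtain ⟨ht, ht2, ε, hε, hεi⟩ := Nat.find_spec hex
  have hmin := fun {m} => Nat.find_min hex (m := m)
  set t := Nat.find hex with htdef
  have hεo : Odd (orderOf ε) := by rw [hε]; exact ht.odd_of_ne_two ht2
  have hεj : ε * j = j * ε := odd_comm hρ h q ga hεi hεo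
  have hQε : Qs i j ≤ Subgroup.centralizer {ε} := by
    rw [Qs, Subgroup.closure_le]
    rintro x (rfl | rfl)
    · exact Subgroup.mem_centralizer_singleton_iff.mpr hεi.symm
    · exact Subgroup.mem_centralizer_singleton_iff.mpr hεj.symm
  obtain ⟨g, hg1, hg2⟩ := perfect_F2 h.fc hP ht ht2 hε
  obtain ⟨S, hSQ⟩ := hall q
  have hgo : orderOf (g * ε * g⁻¹) = orderOf ε := by rw [← MulAut.conj_apply, MulEquiv.orderOf_eq]
  have hzp : Subgroup.zpowers (g * ε * g⁻¹) = Subgroup.zpowers ε :=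
    Subgroup.eq_of_le_of_card_ge (by rw [Subgroup.zpowers_le]; exact hg1)
      (by rw [Nat.card_zpowers, Nat.card_zpowers, hgo])
  have hconj : Qs (g * i * g⁻¹) (g * j * g⁻¹) ≤ Subgroup.centralizer {ε} := by
    have hin : ∀ x : G, ε * x = x * ε → ε * (g * x * g⁻¹) = (g * x * g⁻¹) * ε := by
      intro x hx
      have hm : ε ∈ Subgroup.zpowers (g * ε * g⁻¹) := by rw [hzp]; exact Subgroup.mem_zpowers ε
      obtain ⟨n, hn⟩ := hm
      have : Commute (g * ε * g⁻¹) (g * x * g⁻¹) := by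
        change (g * ε * g⁻¹) * (g * x * g⁻¹) = (g * x * g⁻¹) * (g * ε * g⁻¹)
        calc (g * ε * g⁻¹) * (g * x * g⁻¹) = g * (ε * x) * g⁻¹ := by group
          _ = _ := by rw [hx]; group
      have h4 := Commute.zpow_left this n
      simp only at hn
      rw [hn] at h4
      exact h4
    rw [Qs, Subgroup.closure_le]
    rintro x (rfl | rfl)
    · exact Subgroup.mem_centralizer_singleton_iff.mpr (hin i hεi).symm
    · exact Subgroup.mem_centralizer_singleton_iff.mpr (hin j hεj).symm
  obtain ⟨x, hxX, hx⟩ := syl_in (Subgroup.centralizer {ε}) S (hSQ ▸ hQε) _ ((q.conj h g).pgroup h) hconj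
  rw [hSQ] at hx
  rw [Subgroup.mem_centralizer_singleton_iff] at hxX
  set m := x⁻¹ * g with hm
  have hmQ : m ∈ Subgroup.normalizer (Qs i j : Set G) := by
    apply QP.mem_norm
    · have := hx _ (mem_Qs_i _ _)
      convert this using 1; rw [hm]; group
    · have := hx _ (mem_Qs_j _ _)
      convert this using 1; rw [hm]; group
  have hmε : m * ε * m⁻¹ = g * ε * g⁻¹ := by
    have h1 : Commute x (g * ε * g⁻¹) := by
      obtain ⟨n, hn⟩ := hg1
      rw [← hn]
      exact Commute.zpow_right (show Commute x ε from hxX) n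
    have : m * ε * m⁻¹ = x⁻¹ * ((g * ε * g⁻¹) * x) := by rw [hm]; group
    rw [this, ← h1.eq]; simp
  have hm1 : m * ε * m⁻¹ ∈ Subgroup.zpowers ε := hmε ▸ hg1
  have hm2 : m * ε ≠ ε * m := by
    intro e
    apply hg2
    rw [e, mul_inv_cancel_right] at hmε
    rw [eq_comm, mul_inv_eq_iff_eq_mul] at hmε; exact hmε
  have hpow : ∀ n : ℕ, m ^ n * ε * (m ^ n)⁻¹ ∈ Subgroup.zpowers ε := by
    intro n
    obtain ⟨k, hk⟩ := hm1
    rw [conj_pow_exp ε m k hk.symm n]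
    exact Subgroup.zpow_mem_zpowers _ _
  obtain ⟨hc3i, hc3j⟩ := norm_cube h q hall hmQ
  -- elements commuting with i and normalizing ε centralize it
  have hcent : ∀ w : G, w * i = i * w → w * ε * w⁻¹ ∈ Subgroup.zpowers ε → w * ε = ε * w := by
    intro w hw hwε
    obtain ⟨r, hr, n, hn⟩ := two_part w
    have hwr : w ^ r * ε = ε * w ^ r := by
      rcases two_cent h q (hall q) (Commute.pow_left (show Commute w i from hw) r : _) hn with e | e | e
      · rw [e]; simp
      · rw [e, h.zc]
      · rcases e with e | e
        · rw [e, hεi]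
        · rw [e, mul_assoc, ← h.zc, ← mul_assoc, ← mul_assoc, hεi]
    -- split: w^(2^n) is odd order
    have hodd : w ^ 2 ^ n * ε = ε * w ^ 2 ^ n := by
      have h5 : (w ^ 2 ^ n) * i = i * w ^ 2 ^ n := (Commute.pow_left (show Commute w i from hw) _)
      have hoo : Odd (orderOf (w ^ 2 ^ n)) := by
        have : orderOf (w ^ 2 ^ n) ∣ r := by
          apply orderOf_dvd_of_pow_eq_one
          rw [← pow_mul, mul_comm, pow_mul, ← hn, pow_orderOf_eq_one]
        exact Odd.of_dvd_nat hr this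
      refine act_coprime ht hε ?_ (n := orderOf (w ^ 2 ^ n)) (by rw [pow_orderOf_eq_one]; simp) ?_
      · obtain ⟨k, hk⟩ := hwε
        rw [conj_pow_exp ε w k hk.symm _]
        exact Subgroup.zpow_mem_zpowers _ _
      · rw [Nat.coprime_iff_gcd_eq_one]
        by_contra hne
        set ℓ := (Nat.gcd (orderOf (w ^ 2 ^ n)) (t - 1)).minFac with hl
        have hlp : ℓ.Prime := Nat.minFac_prime hne
        have hl1 : ℓ ∣ orderOf (w ^ 2 ^ n) := (Nat.minFac_dvd _).trans (Nat.gcd_dvd_left _ _)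
        have hl2 : ℓ ∣ t - 1 := (Nat.minFac_dvd _).trans (Nat.gcd_dvd_right _ _)
        have hlt : ℓ < t := by
          have := Nat.le_of_dvd (by have := ht.two_le; omega) hl2
          have := ht.two_le; omega
        obtain ⟨n', hn', hn2'⟩ := key _ h5 ℓ hl1
        refine hmin hlt ⟨hlp, ?_, _, hn', hn2'⟩
        rintro e
        rw [e] at hl1
        exact (Nat.not_even_iff_odd.mpr hoo) (even_iff_two_dvd.mpr hl1)
    have hcop : IsCoprime (r : ℤ) ((2 ^ n : ℕ) : ℤ) := by
      rw [Nat.isCoprime_iff_coprime]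
      exact Nat.Coprime.pow_right n (Nat.coprime_two_right.mpr hr)
    obtain ⟨u, v, huv⟩ := hcop
    have hfin : w = (w ^ r) ^ u * (w ^ 2 ^ n) ^ v := by
      rw [← zpow_natCast, ← zpow_natCast, ← zpow_mul, ← zpow_mul, ← zpow_add, mul_comm (r : ℤ), mul_comm _ v, huv, zpow_one]
    have h6 : Commute ((w ^ r) ^ u * (w ^ 2 ^ n) ^ v) ε :=
      (Commute.zpow_left (show Commute (w ^ r) ε from hwr) u).mul_left
        (Commute.zpow_left (show Commute (w ^ 2 ^ n) ε from hodd) v)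
    rw [← hfin] at h6
    exact h6
  have hm3 : m ^ 3 * ε = ε * m ^ 3 := by
    rcases hc3i with e | e
    · exact hcent _ (by rw [mul_inv_eq_iff_eq_mul] at e; exact e) (hpow 3)
    · have h7 : m ^ 3 * j * ε = ε * (m ^ 3 * j) := by
        apply hcent
        · have h8 : m ^ 3 * i = i * z * m ^ 3 := by rw [mul_inv_eq_iff_eq_mul] at e; exact e
          rw [mul_assoc, q.ij h]
          calc m ^ 3 * (i * j * z) = (m ^ 3 * i) * (j * z) := by simp only [mul_assoc]
            _ = i * z * m ^ 3 * (j * z) := by rw [h8]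
            _ = i * (z * (m ^ 3 * j) * z) := by simp only [mul_assoc]
            _ = _ := by rw [← h.zc, mul_assoc (m ^ 3 * j), h.z2, mul_one]
        · have : m ^ 3 * j * ε * (m ^ 3 * j)⁻¹ = m ^ 3 * ε * (m ^ 3)⁻¹ := by
            rw [mul_assoc (m ^ 3), ← hεj]; group
          rw [this]; exact hpow 3
      rw [mul_assoc, ← hεj, ← mul_assoc, ← mul_assoc] at h7
      exact mul_right_cancel h7
  obtain ⟨n, b, hb⟩ := three_part m
  set μ := m ^ (3 * n + 1) with hμ
  have hμε : μ * ε * μ⁻¹ = m * ε * m⁻¹ := by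
    have h9 : (m ^ 3) ^ n * ε = ε * (m ^ 3) ^ n := (Commute.pow_left (show Commute (m ^ 3) ε from hm3) n)
    have : μ * ε * μ⁻¹ = m * ((m ^ 3) ^ n * ε * ((m ^ 3) ^ n)⁻¹) * m⁻¹ := by
      rw [hμ, pow_succ', pow_mul]; group
    rw [this, h9, mul_inv_cancel_right]
  have hμc : μ * ε ≠ ε * μ := by
    intro e
    rw [e, mul_inv_cancel_right] at hμε
    exact hm2 (by rw [eq_comm, mul_inv_eq_iff_eq_mul] at hμε; exact hμε)
  rcases b with _ | _ | b
  · rw [pow_zero, orderOf_eq_one_iff] at hb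
    rw [hb] at hμc; simp at hμc
  · exact hμc (h.fc.pq μ ε (by rw [hb]; norm_num) (by rw [hμε]; exact hm1))
  · have ho : orderOf (μ ^ 3 ^ (b + 1)) = 3 := by
      rw [orderOf_pow_of_dvd (by positivity) (hb ▸ pow_dvd_pow 3 (by omega)), hb,
        Nat.pow_div (by omega) (by norm_num)]
      simp
    have e : μ ^ 3 ^ (b + 1) = (m ^ 3) ^ ((3 * n + 1) * 3 ^ b) := by
      rw [hμ, ← pow_mul, ← pow_mul]; congr 1; ring
    refine perfect_C5 hρ h hP hS q ho (pm_comm_of_odd h ?_ (by rw [ho]; decide))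
      (pm_comm_of_odd h ?_ (by rw [ho]; decide))
    · rw [e]; exact pm_pow_fix h hc3i _
    · rw [e]; exact pm_pow_fix h hc3j _

lemma perfect_cent [IsAlgClosed K] [FiniteDimensional K V] [Nontrivial V] (hρ : FPF ρ)
    (h : Ctx G z) (hP : commutator G = ⊤) (hS : ∀ S : Sylow 2 G, ∃ s, GQ z S s)
    {i j : G} (q : QP z i j) {c : G} (hci : c * i = i * c) : c = 1 ∨ c = z ∨ pm z c i := by
  obtain ⟨n, r, hr, hor⟩ := Nat.exists_eq_pow_mul_and_not_dvd (orderOf_pos c).ne' 2 (by norm_num)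
  have h1 : c ^ 2 ^ n = 1 := by
    apply perfect_O1 hρ h hP hS q (Commute.pow_left (show Commute c i from hci) _)
    have : orderOf (c ^ 2 ^ n) ∣ r := by
      apply orderOf_dvd_of_pow_eq_one
      rw [← pow_mul, ← hor, pow_orderOf_eq_one]
    exact Odd.of_dvd_nat (by rwa [← Nat.not_even_iff_odd, even_iff_two_dvd]) this
  obtain ⟨b, -, hb⟩ := (Nat.dvd_prime_pow Nat.prime_two).mp (orderOf_dvd_of_pow_eq_one h1)
  exact two_cent h q (perfect_syl hρ h hP hS q) hci hb
end


section
variable {G : Type*} [Group G] [Finite G] {z : G}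

lemma J_cases (h : Ctx G z) {i j : G} (q : QP z i j) {x : G} (hx : x ∈ Qs i j) (hxx : x * x = z) :
    ∃ y, QP z x y ∧ Qs x y = Qs i j := by
  have key : ∀ y, QP z x y → y ∈ Qs i j → ∃ y, QP z x y ∧ Qs x y = Qs i j := by
    intro y q' hy
    refine ⟨y, q', Subgroup.eq_of_le_of_card_ge ?_ (by rw [q'.card h, q.card h])⟩
    rw [Qs, Subgroup.closure_le]
    rintro w (rfl | rfl)
    · exact hx
    · exact hy
  rcases q.mem_J h x hx hxx with e | e | e
  · exact key j (q.pm_of h e (pm.refl j)) (mem_Qs_j i j)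
  · exact key i ((q.symm h).pm_of h e (pm.refl i)) (mem_Qs_i i j)
  · exact key j (((q.jk h).symm h).pm_of h e (pm.refl j)) (mem_Qs_j i j)

/-- The self-centralizing property. -/
def SC (z : G) : Prop := ∀ {i j : G}, QP z i j → ∀ c, c * i = i * c → c = 1 ∨ c = z ∨ pm z c i

lemma norm1 (h : Ctx G z) (hC : SC z) {i j : G} (q : QP z i j) {g : G} (hg : pm z (g * i * g⁻¹) i) :
    g ∈ Qs i j := by
  have h0 : ∀ c, c * i = i * c → c ∈ Qs i j := by
    intro c hc
    rcases hC q c hc with rfl | rfl | e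
    · exact one_mem _
    · exact q.z_mem
    · exact q.pm_mem h (mem_Qs_i i j) e
  rcases hg with e | e
  · exact h0 g (by rw [mul_inv_eq_iff_eq_mul] at e; exact e)
  · have h8 : g * i = i * z * g := by rw [mul_inv_eq_iff_eq_mul] at e; exact e
    have : g * j ∈ Qs i j := by
      apply h0
      rw [mul_assoc, q.ij h]
      calc g * (i * j * z) = (g * i) * (j * z) := by simp only [mul_assoc]
        _ = i * z * g * (j * z) := by rw [h8]
        _ = i * (z * (g * j) * z) := by simp only [mul_assoc]
        _ = _ := by rw [← h.zc, mul_assoc (g * j), h.z2, mul_one]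
    exact (Subgroup.mul_mem_cancel_right _ (mem_Qs_j i j)).mp this

lemma Qs_unique (h : Ctx G z) (hC : SC z) {i j i' j' : G} (q : QP z i j) (q' : QP z i' j') {x : G}
    (hx : x ∈ Qs i j) (hx' : x ∈ Qs i' j') (hxx : x * x = z) : Qs i j = Qs i' j' := by
  obtain ⟨y, r, hr⟩ := J_cases h q hx hxx
  obtain ⟨y', r', hr'⟩ := J_cases h q' hx' hxx
  rw [← hr, ← hr']
  exact le_antisymm (fun w hw => norm1 h hC r' (r.conj_fix h hw)) (fun w hw => norm1 h hC r (r'.conj_fix h hw))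

lemma M_cases (h : Ctx G z) (hC : SC z) {i j a : G} (q : QP z i j) (ga : G3 z i j a) {g : G}
    (hg : g ∈ Subgroup.normalizer (Qs i j : Set G)) : g ∈ Qs i j ∨ a⁻¹ * g ∈ Qs i j ∨ a * g ∈ Qs i j := by
  rcases norm_cases h q hg (mem_Qs_i i j) q.ii with e | e | e
  · exact Or.inl (norm1 h hC q e)
  · right; left
    exact norm1 h hC q (pm_comp h e (pm_inv h ga.ai))
  · right; right
    exact norm1 h hC q (pm_comp h e ((pm_mulc h ga.ai ga.aj).trans' h (q.jk_pm h)))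

lemma M_card (h : Ctx G z) (hC : SC z) {i j a : G} (q : QP z i j) (ga : G3 z i j a) :
    Nat.card (Subgroup.normalizer (Qs i j : Set G)) = 24 := by
  have hM := fun g => M_cases h hC q ga (g := g)
  have haN := ga.norm h q
  have hQM : Qs i j ≤ Subgroup.normalizer (Qs i j : Set G) := Subgroup.le_normalizer
  set M := Subgroup.normalizer (Qs i j : Set G) with hMd
  have d8 : 8 ∣ Nat.card M := by
    rw [← q.card h]; exact Subgroup.card_dvd_of_le hQM
  have d3 : 3 ∣ Nat.card M := by
    rw [← ga.ord, ← Nat.card_zpowers]; exact Subgroup.card_dvd_of_le (by rw [Subgroup.zpowers_le]; exact haN)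
  have hle : Nat.card M ≤ Nat.card (Fin 3 × Qs i j) := by
    have : ∀ g : M, ∃ p : Fin 3 × Qs i j, (g : G) = (![1, a, a⁻¹] p.1) * p.2 := by
      intro g
      rcases hM g g.2 with e | e | e
      · exact ⟨(0, ⟨g, e⟩), by simp⟩
      · exact ⟨(1, ⟨_, e⟩), by simp⟩
      · exact ⟨(2, ⟨_, e⟩), by simp⟩
    choose f hf using this
    apply Nat.card_le_card_of_injective f
    intro g g' e
    ext
    rw [hf g, hf g', e]
  rw [Nat.card_prod, q.card h, Nat.card_fin] at hle
  have h24 : 24 ∣ Nat.card M := by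
    have := Nat.Coprime.mul_dvd_of_dvd_of_dvd (by norm_num : Nat.Coprime 3 8) d3 d8
    simpa using this
  have := Nat.le_of_dvd Nat.card_pos h24
  omega

lemma M_relIndex (h : Ctx G z) (hC : SC z) {i j a : G} (q : QP z i j) (ga : G3 z i j a) :
    (Qs i j).relIndex (Subgroup.normalizer (Qs i j : Set G)) = 3 := by
  have h1 := Subgroup.card_mul_index ((Qs i j).subgroupOf (Subgroup.normalizer (Qs i j : Set G)))
  rw [M_card h hC q ga, Nat.card_congr (Subgroup.subgroupOfEquivOfLe Subgroup.le_normalizer).toEquiv,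
    q.card h] at h1
  rw [Subgroup.relIndex]; omega

lemma M_cube (h : Ctx G z) (hC : SC z) {i j a : G} (q : QP z i j) (ga : G3 z i j a) {g : G}
    (hg : g ∈ Subgroup.normalizer (Qs i j : Set G)) : g ^ 3 ∈ Qs i j := by
  have hn : ((Qs i j).subgroupOf (Subgroup.normalizer (Qs i j : Set G))).Normal :=
    Subgroup.normal_in_normalizer
  have h1 := Subgroup.pow_index_mem ((Qs i j).subgroupOf (Subgroup.normalizer (Qs i j : Set G))) ⟨g, hg⟩
  have h2 := M_relIndex h hC q ga
  rw [Subgroup.relIndex] at h2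
  rw [h2, Subgroup.mem_subgroupOf] at h1
  simpa using h1

lemma M_J (h : Ctx G z) (hC : SC z) {i j a : G} (q : QP z i j) (ga : G3 z i j a) {g : G}
    (hg : g ∈ Subgroup.normalizer (Qs i j : Set G)) (hgg : g * g = z) : g ∈ Qs i j := by
  have h3 := M_cube h hC q ga hg
  have : g = (g ^ 3)⁻¹ := by
    rw [eq_inv_iff_mul_eq_one]
    calc g * g ^ 3 = (g * g) * (g * g) := by simp only [pow_succ, pow_zero, one_mul, mul_assoc]
      _ = 1 := by rw [hgg, h.z2]
  rw [this]; exact inv_mem h3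

lemma M_noinv (h : Ctx G z) (hC : SC z) {i j a : G} (q : QP z i j) (ga : G3 z i j a) {m c : G}
    (hm : m ∈ Subgroup.normalizer (Qs i j : Set G)) (hc : c ∈ Subgroup.normalizer (Qs i j : Set G))
    (hmc : m * c * m⁻¹ = c⁻¹) : c ∈ Qs i j := by
  have hn : ((Qs i j).subgroupOf (Subgroup.normalizer (Qs i j : Set G))).Normal :=
    Subgroup.normal_in_normalizer
  have h3 := M_cube h hC q ga hc
  have h2 := M_relIndex h hC q ga
  set M := Subgroup.normalizer (Qs i j : Set G) with hM
  set Q' := (Qs i j).subgroupOf M with hQ'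
  have hcq : Nat.card (M ⧸ Q') = 3 := h2
  have hf : Fact (Nat.Prime 3) := ⟨Nat.prime_three⟩
  have hcyc : IsCyclic (M ⧸ Q') := isCyclic_of_prime_card hcq
  have hcomm : ∀ x y : M ⧸ Q', x * y = y * x := fun x y => (IsCyclic.isMulCommutative (α := M ⧸ Q')).is_comm.comm x y
  have e1 : (⟨m, hm⟩ : M) * ⟨c, hc⟩ * (⟨m, hm⟩ : M)⁻¹ = (⟨c, hc⟩ : M)⁻¹ := by ext; simpa using hmc
  have e2 := congrArg (QuotientGroup.mk' Q') e1
  rw [map_mul, map_mul, map_inv, hcomm, ← mul_assoc, inv_mul_cancel, one_mul, map_inv] at e2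
  have e3 : (⟨c, hc⟩ : M) ^ 2 ∈ Q' := by
    rw [← QuotientGroup.eq_one_iff]
    change QuotientGroup.mk' Q' (⟨c, hc⟩ ^ 2) = 1
    rw [map_pow, pow_two]; nth_rw 2 [e2]; simp
  rw [hQ', Subgroup.mem_subgroupOf] at e3
  have e4 : c ^ 2 ∈ Qs i j := by simpa using e3
  have : c = c ^ 3 * (c ^ 2)⁻¹ := by group
  rw [this]; exact mul_mem h3 (inv_mem e4)

/-- `D_y = M ∩ y⁻¹ M y`. -/
def Dy (M : Subgroup G) (y : G) : Subgroup G := M ⊓ M.comap (MulAut.conj y).toMonoidHom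

lemma mem_Dy (M : Subgroup G) (y d : G) : d ∈ Dy M y ↔ d ∈ M ∧ y * d * y⁻¹ ∈ M := by
  simp [Dy]

lemma Dy_card (h : Ctx G z) (hC : SC z) {i j a : G} (q : QP z i j) (ga : G3 z i j a) {y : G}
    (hy : y ∉ Subgroup.normalizer (Qs i j : Set G)) :
    Nat.card (Dy (Subgroup.normalizer (Qs i j : Set G)) y) ≤ 6 := by
  have hrel := M_relIndex h hC q ga
  have hJ := fun g => M_J h hC q ga (g := g)
  set M := Subgroup.normalizer (Qs i j : Set G) with hM
  set D := Dy M y with hD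
  have hDM : D ≤ M := inf_le_left
  have h1 : (Qs i j).relIndex D ≤ 3 := by
    rw [← hrel]; exact Subgroup.relIndex_le_of_le_right hDM (by rw [hrel]; norm_num)
  have h2 : ∀ d ∈ D, d ∈ Qs i j → d = 1 ∨ d = z := by
    intro d hd hdQ
    by_contra hne
    have hdd : d * d = z := by
      by_contra hdd
      exact hne (q.not_J h d hdQ hdd)
    have hd2 := ((mem_Dy M y d).mp hd).2
    have hdQ2 := hJ _ hd2 (h.conjJ hdd y)
    have hmem : ∀ w ∈ Qs i j, y * w * y⁻¹ ∈ Qs (y * i * y⁻¹) (y * j * y⁻¹) := by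
      intro w hw
      have hle : Qs i j ≤ (Qs (y * i * y⁻¹) (y * j * y⁻¹)).comap (MulAut.conj y).toMonoidHom := by
        rw [Qs, Subgroup.closure_le]
        rintro x (rfl | rfl)
        · exact mem_Qs_i _ _
        · exact mem_Qs_j _ _
      exact hle hw
    have heq := Qs_unique h hC q (q.conj h y) hdQ2 (hmem d hdQ) (h.conjJ hdd y)
    apply hy
    exact QP.mem_norm (heq ▸ mem_Qs_i _ _) (heq ▸ mem_Qs_j _ _)
  have h3 : Nat.card ((Qs i j).subgroupOf D) ≤ 2 := by
    classical
    have : Nat.card ((Qs i j).subgroupOf D) ≤ Nat.card Bool := by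
      apply Nat.card_le_card_of_injective (fun d : (Qs i j).subgroupOf D => decide ((d : D) = 1))
      intro d d' e
      simp only [decide_eq_decide] at e
      have a1 := h2 _ d.1.2 (Subgroup.mem_subgroupOf.mp d.2)
      have a2 := h2 _ d'.1.2 (Subgroup.mem_subgroupOf.mp d'.2)
      have b1 : ∀ d : D, (d : G) = 1 ↔ d = 1 := fun d => by simp
      apply Subtype.ext
      apply Subtype.ext
      rcases a1 with a1 | a1
      · rw [a1, ((b1 _).mpr (e.mp ((b1 _).mp a1)))]
      · rcases a2 with a2 | a2
        · rw [a2, ((b1 _).mpr (e.mpr ((b1 _).mp a2)))]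
        · rw [a1, a2]
    simpa using this
  have h4 := Subgroup.card_mul_index ((Qs i j).subgroupOf D)
  rw [← h4]
  calc _ ≤ 2 * 3 := Nat.mul_le_mul h3 h1
    _ = 6 := rfl

lemma J_mul (h : Ctx G z) {y m : G} (hy : y * y = z) (hym : (y * m) * (y * m) = z) : y * m * y⁻¹ = m⁻¹ := by
  have : y * (m * y * m) = y * y := by rw [hy, ← hym]; group
  have h2 := mul_left_cancel this
  rw [mul_inv_eq_iff_eq_mul, eq_inv_mul_iff_mul_eq, ← mul_assoc]
  exact h2

lemma fiber_le (h : Ctx G z) (hC : SC z) {i j a : G} (q : QP z i j) (ga : G3 z i j a)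
    (x0 : G ⧸ Subgroup.normalizer (Qs i j : Set G)) :
    Nat.card {y : G // y * y = z ∧ (y : G ⧸ Subgroup.normalizer (Qs i j : Set G)) = x0} ≤ 6 := by
  classical
  have hJ := fun g => M_J h hC q ga (g := g)
  have hDy := fun y => Dy_card h hC q ga (y := y)
  revert x0
  set M := Subgroup.normalizer (Qs i j : Set G) with hM
  intro x0
  set F := {y : G // y * y = z ∧ (y : G ⧸ M) = x0} with hF
  by_cases hne : IsEmpty F
  · simp
  rw [not_isEmpty_iff] at hne
  obtain ⟨y, hyy, hy0⟩ := hne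
  have hfM : ∀ w : F, y⁻¹ * w.1 ∈ M := by
    rintro ⟨w, hw, hw0⟩
    rw [← QuotientGroup.eq, hw0, hy0]
  by_cases hyM : y ∈ M
  · have hwQ : ∀ w : F, w.1 ∈ Qs i j := by
      intro w
      exact hJ _ ((Subgroup.mul_mem_cancel_left _ (inv_mem hyM)).mp (hfM w)) w.2.1
    have : Nat.card (F ⊕ Bool) ≤ Nat.card (Qs i j) := by
      apply Nat.card_le_card_of_injective (fun s => match s with
        | .inl w => (⟨w.1, hwQ w⟩ : Qs i j)
        | .inr true => 1
        | .inr false => ⟨z, q.z_mem⟩)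
      rintro (w | b | b) (w' | b' | b') e <;> simp only [Subtype.mk.injEq] at e
      · congr 1; exact Subtype.ext e
      · exact absurd e (h.j_ne_z w.2.1)
      · exact absurd (by simpa using congrArg Subtype.val e) (h.j_ne_one w.2.1)
      · exact absurd e.symm (h.j_ne_z w'.2.1)
      · rfl
      · exact absurd (by simpa using congrArg Subtype.val e) h.z1
      · exact absurd (by simpa using (congrArg Subtype.val e).symm) (h.j_ne_one w'.2.1)
      · exact absurd (by simpa using (congrArg Subtype.val e).symm) h.z1
      · rfl
    rw [q.card h, Nat.card_sum] at this
    simp at this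
    omega
  · refine le_trans ?_ (hDy y hyM)
    apply Nat.card_le_card_of_injective (fun w : F => (⟨y⁻¹ * w.1, (mem_Dy M y _).mpr ⟨hfM w, by
      rw [J_mul h hyy (m := y⁻¹ * w.1) (by simpa using w.2.1)]; exact inv_mem (hfM w)⟩⟩ : Dy M y))
    intro w w' e
    have := congrArg Subtype.val e
    simp only at this
    exact Subtype.ext (mul_left_cancel this)

lemma fiber_eq (h : Ctx G z) (hC : SC z) {i j a : G} (q : QP z i j) (ga : G3 z i j a)
    (hconj : ∀ x : G, x * x = z → ∃ g, g * i * g⁻¹ = x)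
    (x0 : G ⧸ Subgroup.normalizer (Qs i j : Set G)) :
    Nat.card {y : G // y * y = z ∧ (y : G ⧸ Subgroup.normalizer (Qs i j : Set G)) = x0} = 6 := by
  classical
  have hle := fiber_le h hC q ga
  have hMc := M_card h hC q ga
  revert x0
  set M := Subgroup.normalizer (Qs i j : Set G) with hM
  intro x0
  have := Fintype.ofFinite G
  have := Fintype.ofFinite (G ⧸ M)
  set J := Finset.univ.filter (fun y : G => y * y = z) with hJ
  have h1 : J.card = ∑ b : G ⧸ M, (J.filter (fun y : G => (QuotientGroup.mk y : G ⧸ M) = b)).card :=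
    Finset.card_eq_sum_card_fiberwise (f := fun y : G => (QuotientGroup.mk y : G ⧸ M)) (t := Finset.univ) (fun _ _ => by simp)
  have h2 : ∀ b : G ⧸ M, (J.filter (fun y : G => (QuotientGroup.mk y : G ⧸ M) = b)).card =
      Nat.card {y : G // y * y = z ∧ (y : G ⧸ M) = b} := by
    intro b
    rw [Nat.card_eq_fintype_card, Fintype.card_subtype, hJ, Finset.filter_filter]
  have h3 : Nat.card G ≤ J.card * 4 := by
    have : ∀ x : J, ∃ g, g * i * g⁻¹ = x.1 := fun x => hconj x (Finset.mem_filter.mp x.2).2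
    choose f hf using this
    have hin : ∀ g : G, g * i * g⁻¹ ∈ J := fun g => by
      rw [hJ, Finset.mem_filter]; exact ⟨Finset.mem_univ _, h.conjJ q.ii g⟩
    have hz4 : ∀ g : G, (f ⟨_, hin g⟩)⁻¹ * g ∈ Subgroup.zpowers i := by
      intro g
      have e := hf ⟨_, hin g⟩
      simp only at e
      set u := f ⟨_, hin g⟩ with hu
      have hc : u⁻¹ * g * i = i * (u⁻¹ * g) := by
        have : g * i = (u * i * u⁻¹) * g := by rw [e]; group
        rw [mul_assoc, this]; group
      have hzi : z ∈ Subgroup.zpowers i := by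
        rw [← q.ii]; exact mul_mem (Subgroup.mem_zpowers i) (Subgroup.mem_zpowers i)
      rcases hC q _ hc with e | e | e | e
      · rw [e]; exact one_mem _
      · rw [e]; exact hzi
      · rw [e]; exact Subgroup.mem_zpowers i
      · rw [e]; exact mul_mem (Subgroup.mem_zpowers i) hzi
    have : Nat.card G ≤ Nat.card (J × Subgroup.zpowers i) := by
      apply Nat.card_le_card_of_injective (fun g => ((⟨_, hin g⟩, ⟨_, hz4 g⟩) : J × Subgroup.zpowers i))
      intro g g' e
      simp only [Prod.mk.injEq] at e
      have e2 := congrArg Subtype.val e.2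
      simp only at e2
      rw [e.1] at e2
      exact mul_left_cancel e2
    rw [Nat.card_prod, Nat.card_zpowers, h.orderJ q.ii] at this
    simpa using this
  have h4 : Nat.card G = Nat.card (G ⧸ M) * 24 := by
    rw [Subgroup.card_eq_card_quotient_mul_card_subgroup M, hMc]
  have h5 : ∑ b : G ⧸ M, Nat.card {y : G // y * y = z ∧ (y : G ⧸ M) = b} = ∑ b : G ⧸ M, 6 := by
    apply le_antisymm (Finset.sum_le_sum (fun b _ => hle b))
    rw [Finset.sum_congr rfl (fun b _ => h2 b)] at h1
    rw [← h1, Finset.sum_const, Finset.card_univ, ← Nat.card_eq_fintype_card, smul_eq_mul]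
    omega
  exact (Finset.sum_eq_sum_iff_of_le (fun b _ => hle b)).mp h5 x0 (Finset.mem_univ _)

lemma Dy_inv (h : Ctx G z) (hC : SC z) {i j a : G} (q : QP z i j) (ga : G3 z i j a)
    (hconj : ∀ x : G, x * x = z → ∃ g, g * i * g⁻¹ = x) {y : G} (hyy : y * y = z)
    (hy : y ∉ Subgroup.normalizer (Qs i j : Set G)) :
    Nat.card (Dy (Subgroup.normalizer (Qs i j : Set G)) y) = 6 ∧
    ∀ d ∈ Dy (Subgroup.normalizer (Qs i j : Set G)) y, y * d * y⁻¹ = d⁻¹ := by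
  have h6 := fiber_eq h hC q ga hconj y
  have hDy := Dy_card h hC q ga hy
  set M := Subgroup.normalizer (Qs i j : Set G) with hM
  set F := {w : G // w * w = z ∧ (w : G ⧸ M) = y} with hF
  have hfM : ∀ w : F, y⁻¹ * w.1 ∈ M := by
    rintro ⟨w, hw, hw0⟩
    rw [← QuotientGroup.eq, hw0]
  set f : F → Dy M y := fun w : F => (⟨y⁻¹ * w.1, (mem_Dy M y _).mpr ⟨hfM w, by
      rw [J_mul h hyy (m := y⁻¹ * w.1) (by simpa using w.2.1)]; exact inv_mem (hfM w)⟩⟩ : Dy M y) with hfd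
  have hinj : Function.Injective f := by
    intro w w' e
    have := congrArg Subtype.val e
    simp only [hfd] at this
    exact Subtype.ext (mul_left_cancel this)
  have hb := hinj.bijective_of_nat_card_le (by rw [h6]; exact hDy)
  refine ⟨le_antisymm hDy (by rw [← h6]; exact Nat.card_le_card_of_injective f hinj), ?_⟩
  intro d hd
  obtain ⟨w, hw⟩ := hb.2 ⟨d, hd⟩
  have e := congrArg Subtype.val hw
  simp only [hfd] at e
  apply J_mul h hyy
  rw [← e]; simpa using w.2.1

lemma index_le_five (h : Ctx G z) (hC : SC z) {i j a : G} (q : QP z i j) (ga : G3 z i j a)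
    (hconj : ∀ x : G, x * x = z → ∃ g, g * i * g⁻¹ = x) :
    (Subgroup.normalizer (Qs i j : Set G)).index ≤ 5 := by
  classical
  have h6 := fiber_eq h hC q ga hconj
  have hDy := fun y => Dy_inv h hC q ga hconj (y := y)
  have hMc := fun g => M_cases h hC q ga (g := g)
  have haN := ga.norm h q
  have hnoinv := fun m c => M_noinv h hC q ga (m := m) (c := c)
  have hnorm : ∀ g ∈ Subgroup.normalizer (Qs i j : Set G), ∀ w, w ∈ Qs i j ↔ g * w * g⁻¹ ∈ Qs i j :=
    fun g hg w => Subgroup.mem_normalizer_iff.mp hg w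
  have hQM : Qs i j ≤ Subgroup.normalizer (Qs i j : Set G) := Subgroup.le_normalizer
  set M := Subgroup.normalizer (Qs i j : Set G) with hM
  have hex : ∀ x0 : G ⧸ M, ∃ y : G, y * y = z ∧ (y : G ⧸ M) = x0 := by
    intro x0
    by_contra hne
    have : IsEmpty {y : G // y * y = z ∧ (y : G ⧸ M) = x0} := ⟨fun y => hne ⟨y.1, y.2⟩⟩
    have h := h6 x0
    rw [Nat.card_of_isEmpty] at h
    norm_num at h
  have h3Q : ∀ c : G, c ∈ Qs i j → c ^ 3 = 1 → c = 1 := by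
    intro c hc h3
    have h8 : c ^ 8 = 1 := by
      have := pow_card_eq_one' (x := (⟨c, hc⟩ : Qs i j))
      rw [q.card h] at this
      simpa using congrArg Subtype.val this
    have : orderOf c ∣ 1 := by
      have := Nat.dvd_gcd (orderOf_dvd_of_pow_eq_one h3) (orderOf_dvd_of_pow_eq_one h8)
      simpa using this
    exact orderOf_eq_one_iff.mp (Nat.dvd_one.mp this)
  have hpick : ∀ x0 : {x : G ⧸ M // x ≠ ((1 : G) : G ⧸ M)}, ∃ c y : G, y * y = z ∧ (y : G ⧸ M) = x0.1 ∧
      c ^ 3 = 1 ∧ c ≠ 1 ∧ a⁻¹ * c ∈ Qs i j ∧ c ∈ M ∧ y * c * y⁻¹ = c⁻¹ := by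
    rintro ⟨x0, hx0⟩
    obtain ⟨y, hyy, hy0⟩ := hex x0
    have hyM : y ∉ M := by
      intro e
      apply hx0
      rw [← hy0, eq_comm, QuotientGroup.eq]
      simpa using e
    obtain ⟨hD6, hDinv⟩ := hDy y hyy hyM
    have hf : Fact (Nat.Prime 3) := ⟨Nat.prime_three⟩
    obtain ⟨⟨c, hcD⟩, hc⟩ := exists_prime_orderOf_dvd_card' (G := Dy M y) 3 (by rw [hD6]; norm_num)
    rw [Subgroup.orderOf_mk] at hc
    have hc3 : c ^ 3 = 1 := by rw [← hc]; exact pow_orderOf_eq_one c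
    have hc1 : c ≠ 1 := by rintro rfl; simp at hc
    have hcM := ((mem_Dy M y c).mp hcD).1
    rcases hMc c hcM with e | e | e
    · exact absurd (h3Q c e hc3) hc1
    · exact ⟨c, y, hyy, hy0, hc3, hc1, e, hcM, hDinv c hcD⟩
    · refine ⟨c⁻¹, y, hyy, hy0, by rw [inv_pow, hc3, inv_one], by simpa using hc1, ?_, inv_mem hcM,
        by rw [← conj_inv, hDinv c hcD]⟩
      have := (hnorm a⁻¹ (inv_mem haN) _).mp e
      have e2 : a⁻¹ * c⁻¹ = (a⁻¹ * (a * c) * a⁻¹⁻¹)⁻¹ := by group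
      rw [e2]; exact inv_mem this
  choose c y hyy hy0 hc3 hc1 hca hcM hyc using hpick
  set T := {c : G // a⁻¹ * c ∈ Qs i j ∧ c ^ 3 = 1} with hT
  have hT4 : Nat.card T ≤ 4 := by
    have : Nat.card (T × Bool) ≤ Nat.card (Qs i j) := by
      apply Nat.card_le_card_of_injective (fun t => (⟨a⁻¹ * t.1.1 * (if t.2 then z else 1),
        mul_mem t.1.2.1 (by split_ifs; exacts [q.z_mem, one_mem _])⟩ : Qs i j))
      rintro ⟨⟨t, ht, ht3⟩, b⟩ ⟨⟨t', ht', ht3'⟩, b'⟩ e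
      have e := congrArg Subtype.val e
      simp only [mul_assoc] at e
      have e := mul_left_cancel e
      have hz3 : ∀ t : G, t ^ 3 = 1 → (t * z) ^ 3 = z := by
        intro t ht
        rw [(show Commute t z from h.zc t).mul_pow, ht, one_mul]
        calc z ^ 3 = z * z * z := by simp only [pow_succ, pow_zero, one_mul]
          _ = z := by rw [h.z2, one_mul]
      cases b <;> cases b' <;> simp at e
      · simp [e]
      · rw [e, hz3 t' ht3'] at ht3; exact absurd ht3 h.z1
      · rw [← e, hz3 t ht3] at ht3'; exact absurd ht3' h.z1
      · simp [e]
    rw [Nat.card_prod, q.card h] at this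
    simp at this
    omega
  have hinj : Nat.card {x : G ⧸ M // x ≠ ((1 : G) : G ⧸ M)} ≤ Nat.card T := by
    apply Nat.card_le_card_of_injective (fun x => (⟨c x, hca x, hc3 x⟩ : T))
    intro x x' e
    have e : c x = c x' := congrArg Subtype.val e
    apply Subtype.ext
    rw [← hy0 x, ← hy0 x', QuotientGroup.eq]
    set g := (y x)⁻¹ * y x' with hg
    by_contra hgM
    have hgc : g * c x * g⁻¹ = c x := by
      have e1 := hyc x
      have e2 := hyc x'
      rw [← e] at e2
      have : g * c x * g⁻¹ = (y x)⁻¹ * (y x' * c x * (y x')⁻¹) * y x := by rw [hg]; group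
      rw [this, e2, ← e1]; group
    obtain ⟨y1, hy1, hy10⟩ := hex g
    have hmM : g⁻¹ * y1 ∈ M := by rw [← QuotientGroup.eq, hy10]
    set m := g⁻¹ * y1 with hm
    have hy1m : y1 = g * m := by rw [hm]; group
    clear_value m
    have hy1M : y1 ∉ M := by
      rw [hy1m]
      intro e3
      exact hgM ((Subgroup.mul_mem_cancel_right _ hmM).mp e3)
    have e5 : y1 * (m⁻¹ * c x * m) * y1⁻¹ = c x := by
      calc y1 * (m⁻¹ * c x * m) * y1⁻¹ = g * c x * g⁻¹ := by rw [hy1m]; group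
        _ = c x := hgc
    have hd := (hDy y1 hy1 hy1M).2 (m⁻¹ * c x * m) ((mem_Dy M y1 _).mpr
      ⟨mul_mem (mul_mem (inv_mem hmM) (hcM x)) hmM, by rw [e5]; exact hcM x⟩)
    rw [e5] at hd
    have hfin : m * c x * m⁻¹ = (c x)⁻¹ := by
      nth_rw 1 [hd]; group
    exact hc1 x (h3Q _ (hnoinv m (c x) hmM (hcM x) hfin) (hc3 x))
  have := Fintype.ofFinite (G ⧸ M)
  rw [Subgroup.index, Nat.card_eq_fintype_card]
  rw [Nat.card_eq_fintype_card, Fintype.card_subtype_compl, Fintype.card_subtype_eq] at hinj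
  omega
end

theorem perfect_main {G K V : Type*} [Group G] [Finite G] [Field K] [AddCommGroup V] [Module K V]
    {ρ : G →* Module.End K V} [IsAlgClosed K] [FiniteDimensional K V] [Nontrivial V] (hρ : FPF ρ)
    (hP : commutator G = ⊤) [Nontrivial G] :
    ∃ z i j : G, Ctx G z ∧ QP z i j ∧ (∃ S : Sylow 2 G, (S : Subgroup G) = Qs i j) ∧
      (Subgroup.normalizer (Qs i j : Set G)).index ≤ 5 ∧ 3 ∣ Nat.card G := by
  obtain ⟨z, h, hS⟩ := perfect_ctx hρ.fc hP
  obtain ⟨i, j, q⟩ := exists_QP h hS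
  obtain ⟨a, ga⟩ := perfect_good hρ h hP hS q
  obtain ⟨s, hs⟩ := hS (default : Sylow 2 G)
  refine ⟨z, i, j, h, q, perfect_syl hρ h hP hS q, ?_, ?_⟩
  · exact index_le_five h (fun q c hc => perfect_cent hρ h hP hS q hc) q ga
      (fun x hx => perfect_conj h hP _ hs q.ii hx)
  · rw [← ga.ord]; exact orderOf_dvd_natCard a


/-- a regular linear group -/
structure Reg {p : ℕ} {G V : Type*} [Group G] [AddCommGroup V] [Module (ZMod p) V]
    (σ : G →* Module.End (ZMod p) V) : Prop where
  trans : ∀ v w : V, v ≠ 0 → w ≠ 0 → ∃ g, σ g v = w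
  free : ∀ g : G, g ≠ 1 → ∀ v : V, σ g v = v → v = 0

section
variable {p : ℕ} {G V : Type*} [Group G] [AddCommGroup V] [Module (ZMod p) V]
  {σ : G →* Module.End (ZMod p) V}

lemma Reg.inj (h : Reg σ) {v : V} (hv : v ≠ 0) {g g' : G} (e : σ g v = σ g' v) : g = g' := by
  by_contra hne
  apply hv
  apply h.free (g'⁻¹ * g) (fun h1 => hne (by rw [inv_mul_eq_one] at h1; exact h1.symm))
  rw [map_mul, Module.End.mul_apply, e, ← Module.End.mul_apply, ← map_mul]
  simp

lemma sigma_ne (σ : G →* Module.End (ZMod p) V) {v : V} (hv : v ≠ 0) (g : G) : σ g v ≠ 0 := by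
  intro h0
  apply hv
  have : σ g⁻¹ (σ g v) = v := by rw [← Module.End.mul_apply, ← map_mul]; simp
  rw [← this, h0, map_zero]

/-- a regular group is in bijection with the nonzero vectors -/
noncomputable def Reg.equiv (h : Reg σ) {v : V} (hv : v ≠ 0) : G ≃ {w : V // w ≠ 0} :=
  Equiv.ofBijective (fun g => ⟨σ g v, sigma_ne σ hv g⟩) ⟨fun g g' e => h.inj hv (congrArg Subtype.val e),
    fun w => by
      obtain ⟨g, hg⟩ := h.trans v w.1 hv w.2
      exact ⟨g, Subtype.ext hg⟩⟩

lemma Reg.card [Finite V] [Nontrivial V] (h : Reg σ) : Nat.card G = Nat.card V - 1 := by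
  classical
  obtain ⟨v, hv⟩ := exists_ne (0 : V)
  have := Fintype.ofFinite V
  rw [Nat.card_congr (h.equiv hv), Nat.card_eq_fintype_card, Fintype.card_subtype_compl,
    Fintype.card_subtype_eq, Nat.card_eq_fintype_card]

lemma Reg.finite [Finite V] [Nontrivial V] (h : Reg σ) : Finite G := by
  obtain ⟨v, hv⟩ := exists_ne (0 : V)
  exact Finite.of_equiv _ (h.equiv hv).symm

lemma Reg.cast_card [Fact p.Prime] [Finite V] [Nontrivial V] (h : Reg σ) {d : ℕ} (hd : d ≠ 0)
    (hV : Nat.card V = p ^ d) : (Nat.card G : ZMod p) = -1 := by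
  rw [h.card, hV, Nat.cast_sub (Nat.one_le_pow _ _ (Fact.out : p.Prime).pos)]
  simp [hd]

lemma Reg.fpf [Fact p.Prime] [Finite V] [Nontrivial V] (h : Reg σ) {d : ℕ} (hd : d ≠ 0)
    (hV : Nat.card V = p ^ d) : FPF σ where
  fpf := h.free
  ne := by rw [h.cast_card hd hV]; simp

end

lemma free_card_dvd {H k V : Type*} [Group H] [Field k] [AddCommGroup V] [Module k V]
    (τ : H →* Module.End k V) (hfree : ∀ g : H, g ≠ 1 → ∀ v : V, τ g v = v → v = 0)
    (U : Submodule k V) [Finite U] (hU : ∀ g, ∀ u ∈ U, τ g u ∈ U) : Nat.card H ∣ Nat.card U - 1 := by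
  classical
  have hne : ∀ (g : H) (u : V), u ≠ 0 → τ g u ≠ 0 := by
    intro g v hv h0
    apply hv
    have : τ g⁻¹ (τ g v) = v := by rw [← Module.End.mul_apply, ← map_mul]; simp
    rw [← this, h0, map_zero]
  let X := {u : U // u ≠ 0}
  let inst : MulAction H X :=
    { smul := fun g x => ⟨⟨τ g x.1.1, hU g _ x.1.2⟩, fun h0 => hne g x.1.1
        (fun h1 => x.2 (Subtype.ext h1)) (congrArg Subtype.val h0)⟩
      one_smul := fun x => Subtype.ext (Subtype.ext (by change τ 1 x.1.1 = _; simp))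
      mul_smul := fun g g' x => Subtype.ext (Subtype.ext (by
        change τ (g * g') x.1.1 = τ g (τ g' x.1.1); simp)) }
  have hst : ∀ x : X, MulAction.stabilizer H x = ⊥ := by
    intro x
    rw [eq_bot_iff]
    intro g hg
    rw [MulAction.mem_stabilizer_iff] at hg
    rw [Subgroup.mem_bot]
    by_contra hg1
    exact x.2 (Subtype.ext (hfree g hg1 x.1.1 (congrArg (fun y : X => y.1.1) hg)))
  have e := Nat.card_congr (MulAction.selfEquivOrbitsQuotientProd hst)
  rw [Nat.card_prod] at e
  have := Fintype.ofFinite U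
  have e2 : Nat.card X = Nat.card U - 1 := by
    rw [Nat.card_eq_fintype_card, Fintype.card_subtype_compl, Fintype.card_subtype_eq,
      Nat.card_eq_fintype_card]
  rw [← e2, e]
  exact dvd_mul_left _ _

lemma half_dim {p : ℕ} [Fact p.Prime] (hp2 : p ≠ 2) {V : Type*} [AddCommGroup V] [Module (ZMod p) V]
    (I J : Module.End (ZMod p) V) (hI : I * I = -1) (hJ : J * J = -1) (hJI : J * I = -(I * J)) :
    ∃ U : Submodule (ZMod p) V, Nat.card V = Nat.card U * Nat.card U ∧
      ∀ c : Module.End (ZMod p) V, c * I = I * c → c * J = J * c → ∀ u ∈ U, c u ∈ U := by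
  obtain ⟨α, β, hab⟩ := ZMod.sq_add_sq p (-1)
  have h2 : (2 : ZMod p) ≠ 0 := by
    intro h0
    have : ((2 : ℕ) : ZMod p) = 0 := by exact_mod_cast h0
    rw [ZMod.natCast_eq_zero_iff] at this
    exact hp2 ((Nat.prime_dvd_prime_iff_eq Fact.out Nat.prime_two).mp this)
  have hII : ∀ v, I (I v) = -v := fun v => by
    rw [← Module.End.mul_apply, hI]; rfl
  have hJJ : ∀ v, J (J v) = -v := fun v => by
    rw [← Module.End.mul_apply, hJ]; rfl
  have hji : ∀ v, J (I v) = -(I (J v)) := fun v => by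
    rw [← Module.End.mul_apply, hJI]; rfl
  set w : Module.End (ZMod p) V := α • I + β • J with hw
  have hwv : ∀ v, w v = α • I v + β • J v := fun v => rfl
  have hww : ∀ v, w (w v) = v := by
    intro v
    rw [hwv, hwv, map_add, map_add, map_smul, map_smul, map_smul, map_smul, hII, hJJ, hji]
    have : α • (α • -v + β • I (J v)) + β • (α • -(I (J v)) + β • -v) = (-(α ^ 2 + β ^ 2)) • v := by
      module
    rw [this, hab]; simp
  set k : Module.End (ZMod p) V := I * J with hk
  have hkv : ∀ v, k v = I (J v) := fun v => rfl
  have hkk : ∀ v, k (k v) = -v := by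
    intro v
    rw [hkv, hkv, hji, hJJ, map_neg, map_neg, map_neg, hII]; simp
  have hwk : ∀ v, w (k v) = -(k (w v)) := by
    intro v
    rw [hkv, hkv, hwv, hwv, hII, hji, hJJ, map_add, map_smul, map_smul, hji, hJJ, map_add, map_smul,
      map_smul, map_neg, map_neg, hII]
    module
  refine ⟨LinearMap.ker (w - 1), ?_, ?_⟩
  · have hU : ∀ u, u ∈ LinearMap.ker (w - 1) ↔ w u = u := by
      intro u
      rw [LinearMap.mem_ker, LinearMap.sub_apply, Module.End.one_apply, sub_eq_zero]
    rw [← Nat.card_prod]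
    symm
    apply Nat.card_congr
    refine Equiv.ofBijective (fun x => x.1.1 + k x.2.1) ⟨?_, ?_⟩
    · rintro ⟨⟨a, ha⟩, ⟨b, hb⟩⟩ ⟨⟨a', ha'⟩, ⟨b', hb'⟩⟩ e
      rw [hU] at ha hb ha' hb'
      simp only at e
      have e2 := congrArg w e
      rw [map_add, map_add, hwk, hwk, ha, hb, ha', hb'] at e2
      have e3 : (2 : ZMod p) • a = (2 : ZMod p) • a' := by
        have := congrArg₂ (· + ·) e e2
        rw [two_smul, two_smul]
        calc a + a = a + k b + (a + -k b) := by abel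
          _ = _ := this
          _ = a' + a' := by abel
      have e4 : a = a' := smul_right_injective V h2 e3
      subst e4
      have e5 : k b = k b' := add_left_cancel e
      have e6 := congrArg k e5
      rw [hkk, hkk, neg_inj] at e6
      subst e6
      rfl
    · intro v
      refine ⟨⟨⟨(2 : ZMod p)⁻¹ • (v + w v), ?_⟩, ⟨(2 : ZMod p)⁻¹ • (-(k (v - w v))), ?_⟩⟩, ?_⟩
      · rw [hU, map_smul, map_add, hww, add_comm]
      · rw [hU, map_smul, map_neg, hwk, map_sub, hww, neg_neg, ← map_neg, neg_sub]
      · simp only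
        rw [map_smul, map_neg, hkk, ← smul_add]
        have : v + w v + - -(v - w v) = (2 : ZMod p) • v := by rw [two_smul]; abel
        rw [this, smul_smul, inv_mul_cancel₀ h2, one_smul]
  · intro c hcI hcJ u hu
    rw [LinearMap.mem_ker, LinearMap.sub_apply, Module.End.one_apply, sub_eq_zero] at hu ⊢
    have hc : c * w = w * c := by
      rw [hw, mul_add, add_mul, mul_smul_comm, mul_smul_comm, smul_mul_assoc, smul_mul_assoc, hcI, hcJ]
    rw [← Module.End.mul_apply, ← hc, Module.End.mul_apply, hu]

lemma autQ {Q : Type*} [Group Q] [Finite Q] (hQ : Nat.card Q = 8) (f : MulAut Q) {l : ℕ} (hl : l = 5 ∨ l = 7)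
    (hf : f ^ l = 1) {z : Q} (hz : z ≠ 1) (hfz : f z = z) : f = 1 := by
  classical
  have := Fintype.ofFinite Q
  have hp : Fact l.Prime := ⟨by rcases hl with rfl | rfl <;> norm_num⟩
  let F : Subgroup Q := MonoidHom.eqLocus f.toMonoidHom (MonoidHom.id Q)
  have hF : ∀ x, x ∈ F ↔ f x = x := fun x => Iff.rfl
  let fe : Function.End Q := fun x => f x
  have hpow : ∀ n : ℕ, ∀ x, (fe ^ n) x = (f ^ n) x := by
    intro n
    induction n with
    | zero => intro x; rfl
    | succ n ih =>
      intro x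
      rw [pow_succ, pow_succ]
      change (fe ^ n) (f x) = (f ^ n) (f x)
      exact ih _
  have h1 := Equiv.Perm.card_fixedPoints_modEq (f := fe) (p := l) (n := 1) (by
    funext x
    rw [pow_one, hpow, hf]; rfl)
  have h2 : Fintype.card (fe.fixedPoints) = Nat.card F := by
    rw [← Nat.card_eq_fintype_card]; rfl
  rw [h2, ← Nat.card_eq_fintype_card, hQ] at h1
  have h3 : Nat.card F ∣ 8 := hQ ▸ Subgroup.card_subgroup_dvd_card F
  have h4 : Nat.card F ≠ 1 := by
    intro h
    have := Subgroup.card_eq_one.mp h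
    have hzF : z ∈ F := hfz
    rw [this, Subgroup.mem_bot] at hzF
    exact hz hzF
  have h5 : Nat.card F = 8 := by
    have h6 : Nat.card F ≤ 8 := Nat.le_of_dvd (by norm_num) h3
    generalize Nat.card F = n at *
    unfold Nat.ModEq at h1
    rcases hl with rfl | rfl <;> interval_cases n <;> omega
  have h6 : F = ⊤ := Subgroup.eq_top_of_card_eq F (by rw [h5, hQ])
  ext x
  have : x ∈ F := h6 ▸ Subgroup.mem_top x
  exact this

lemma fin_arith {p e k j : ℕ} (hp : p.Prime) (hp2 : p ≠ 2) (hk : k ≤ 5) (hk0 : k ≠ 0) (hj : j ≤ 64) (hj0 : j ≠ 0)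
    (hj8 : j ∣ 40320) (h5 : ¬ 5 ∣ j) (h7 : ¬ 7 ∣ j) (hdvd : p ^ e + 1 ∣ k * j) (he : 2 ≤ e)
    (h3 : k = 1 ∨ 3 ∣ p ^ (2 * e) - 1) : False := by
  have hle : p ^ e + 1 ≤ k * j := Nat.le_of_dvd (by positivity) hdvd
  have hkj : k * j ≤ 5 * 64 := Nat.mul_le_mul hk hj
  have hp3 : 3 ≤ p := by
    have := hp.two_le
    omega
  have he5 : e ≤ 5 := by
    by_contra h
    have : 3 ^ 6 ≤ p ^ e := (Nat.pow_le_pow_left hp3 6).trans (Nat.pow_le_pow_right hp.pos (by omega))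
    omega
  have hp17 : p ≤ 17 := by
    by_contra h
    have : 18 ^ 2 ≤ p ^ e := (Nat.pow_le_pow_left (by omega) 2).trans (Nat.pow_le_pow_right hp.pos he)
    omega
  -- no large prime divides `k * j`
  have hbig : ∀ l : ℕ, l.Prime → 7 ≤ l → ¬ l ∣ p ^ e + 1 := by
    intro l hl hl7 hd
    rcases (Nat.Prime.dvd_mul hl).mp (hd.trans hdvd) with h | h
    · have := Nat.le_of_dvd (by omega) h
      omega
    · have h8 : l ∣ 40320 := h.trans hj8
      have : l ∈ Nat.primeFactors 40320 := Nat.mem_primeFactors.mpr ⟨hl, h8, by norm_num⟩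
      have h9 : l ∣ 7 := by
        have e : (40320 : ℕ) = 2 ^ 7 * 3 ^ 2 * 5 * 7 := by norm_num
        rw [e] at h8
        rcases (Nat.Prime.dvd_mul hl).mp h8 with h8 | h8
        · rcases (Nat.Prime.dvd_mul hl).mp h8 with h8 | h8
          · rcases (Nat.Prime.dvd_mul hl).mp h8 with h8 | h8
            · have := Nat.le_of_dvd (by norm_num) (hl.dvd_of_dvd_pow h8); omega
            · have := Nat.le_of_dvd (by norm_num) (hl.dvd_of_dvd_pow h8); omega
          · have := Nat.le_of_dvd (by norm_num) h8; omega
        · exact h8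
      have := (Nat.prime_dvd_prime_iff_eq hl (by norm_num)).mp h9
      subst this
      exact h7 h
  have h5k : 5 ∣ p ^ e + 1 → k = 5 := by
    intro h
    rcases (Nat.Prime.dvd_mul (by norm_num)).mp (h.trans hdvd) with h | h
    · have := Nat.le_of_dvd (by omega) h
      omega
    · exact absurd h h5
  have h25 : ¬ 25 ∣ p ^ e + 1 := by
    intro h
    have hk5 := h5k ((by norm_num : 5 ∣ 25).trans h)
    subst hk5
    have := h.trans hdvd
    apply h5
    rw [show 25 = 5 * 5 by norm_num] at this
    exact (Nat.mul_dvd_mul_iff_left (by norm_num)).mp this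
  have g7 := hbig 7 (by norm_num) (by norm_num)
  have g13 := hbig 13 (by norm_num) (by norm_num)
  have g41 := hbig 41 (by norm_num) (by norm_num)
  have g61 := hbig 61 (by norm_num) (by norm_num)
  have g17 := hbig 17 (by norm_num) (by norm_num)
  have g29 := hbig 29 (by norm_num) (by norm_num)
  clear hbig hdvd hj8 h5 h7
  interval_cases p <;> first | (exfalso; revert hp; norm_num; done) | (exfalso; interval_cases e <;> omega)


section
open scoped TensorProduct
variable {G F V : Type*} [Group G] [Field F] [AddCommGroup V] [Module F V]

/-- base change of a representation -/
noncomputable def bc (K : Type*) [Field K] [Algebra F K] (σ : G →* Module.End F V) :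
    G →* Module.End K (K ⊗[F] V) :=
  (Module.End.baseChangeHom F K V : Module.End F V →* Module.End K (K ⊗[F] V)).comp σ

lemma FPF.baseCh (K : Type*) [Field K] [Algebra F K] [FiniteDimensional F V] {σ : G →* Module.End F V}
    (h : FPF σ) : FPF (bc K σ) where
  fpf g hg v hv := by
    have hinj : Function.Injective (fun v : V => (σ g - 1 : Module.End F V) v) := by
      change Function.Injective (σ g - 1 : Module.End F V)
      rw [← LinearMap.ker_eq_bot, LinearMap.ker_eq_bot']
      intro m hm
      rw [LinearMap.sub_apply, Module.End.one_apply, sub_eq_zero] at hm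
      exact h.fpf g hg m hm
    have hu : IsUnit (σ g - 1) := by
      rw [Module.End.isUnit_iff]
      exact ⟨hinj, LinearMap.injective_iff_surjective.mp hinj⟩
    have hu2 := hu.map (Module.End.baseChangeHom F K V)
    rw [Module.End.isUnit_iff] at hu2
    apply hu2.1
    rw [map_sub, map_one, LinearMap.sub_apply, Module.End.one_apply, map_zero, sub_eq_zero]
    exact hv
  ne := by
    intro h0
    apply h.ne
    apply (algebraMap F K).injective
    rw [map_natCast, h0, map_zero]
end

theorem fin_two {p : ℕ} {G V : Type*} [Group G] [AddCommGroup V] [Module (ZMod p) V]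
    {σ : G →* Module.End (ZMod p) V} [Fact p.Prime] [Finite V] [Nontrivial V] (h : Reg σ) {d : ℕ}
    (hd : d ≠ 0) (hV : Nat.card V = p ^ d) {z i j : G} (hc : Ctx G z) (q : QP z i j)
    (hk : (Subgroup.normalizer (Qs i j : Set G)).index ≤ 5)
    (h3 : (Subgroup.normalizer (Qs i j : Set G)).index = 1 ∨ 3 ∣ Nat.card G) : d = 2 := by
  have hp : p.Prime := Fact.out
  have hG := h.finite
  have hcard := h.card
  rw [hV] at hcard
  have hzo : orderOf z = 2 := orderOf_eq_prime (by rw [pow_two, hc.z2]) hc.z1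
  have hp2 : p ≠ 2 := by
    rintro rfl
    have h1 : 2 ∣ Nat.card G := hzo ▸ orderOf_dvd_natCard z
    have h2 : 2 ∣ 2 ^ d := dvd_pow_self 2 hd
    have h3 : 0 < 2 ^ d := by positivity
    omega
  have hf := h.fpf hd hV
  have hz : σ z = -1 := hf.neg_one z hc.z1 (by rw [pow_two, hc.z2])
  have hI : σ i * σ i = -1 := by rw [← map_mul, q.ii, hz]
  have hJ : σ j * σ j = -1 := by rw [← map_mul, q.jj, hz]
  have hJI : σ j * σ i = -(σ i * σ j) := by
    rw [← map_mul, q.ij hc, map_mul, hz, map_mul]; simp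
  obtain ⟨U, hU, hUc⟩ := half_dim hp2 (σ i) (σ j) hI hJ hJI
  have hUd : Nat.card U ∣ p ^ d := by rw [← hV, hU]; exact dvd_mul_left _ _
  obtain ⟨e, he, hUe⟩ := (Nat.dvd_prime_pow hp).mp hUd
  have hd2 : d = 2 * e := by
    rw [hV, hUe, ← pow_add] at hU
    have := Nat.pow_right_injective hp.two_le hU
    omega
  have hk0 : (Subgroup.normalizer (Qs i j : Set G)).index ≠ 0 := Subgroup.index_ne_zero_of_finite
  have hci := Subgroup.card_mul_index (Subgroup.normalizer (Qs i j : Set G))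
  set φ := (Qs i j).normalizerMonoidHom with hφ
  have h1 := Subgroup.card_mul_index φ.ker
  rw [Subgroup.index_ker] at h1
  have hker : ∀ c ∈ φ.ker, (∀ x ∈ Qs i j, (c : G) * x = x * c) := by
    intro c hcm x hx
    rw [hφ, Subgroup.normalizerMonoidHom_ker, Subgroup.mem_subgroupOf, Subgroup.mem_centralizer_iff] at hcm
    exact (hcm x hx).symm
  have hkd : Nat.card φ.ker ∣ Nat.card U - 1 := by
    apply free_card_dvd ((σ.comp (Subgroup.subtype _)).comp φ.ker.subtype)
    · intro g hg v hv
      exact h.free g.1.1 (fun h0 => hg (Subtype.ext (Subtype.ext h0))) v hv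
    · intro g u hu
      apply hUc _ _ _ u hu
      · change σ g.1.1 * σ i = σ i * σ g.1.1
        rw [← map_mul, hker g.1 g.2 i (mem_Qs_i i j), map_mul]
      · change σ g.1.1 * σ j = σ j * σ g.1.1
        rw [← map_mul, hker g.1 g.2 j (mem_Qs_j i j), map_mul]
  have hj64 : Nat.card φ.range ≤ 64 := by
    have : Nat.card φ.range ≤ Nat.card (Qs i j × Qs i j) := by
      apply Nat.card_le_card_of_injective
        (fun f : φ.range => (f.1 ⟨i, mem_Qs_i i j⟩, f.1 ⟨j, mem_Qs_j i j⟩))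
      rintro ⟨f, g, rfl⟩ ⟨f', g', rfl⟩ e
      simp only [Prod.mk.injEq] at e
      have e1 : (g : G) * i * (g : G)⁻¹ = (g' : G) * i * (g' : G)⁻¹ := congrArg Subtype.val e.1
      have e2 : (g : G) * j * (g : G)⁻¹ = (g' : G) * j * (g' : G)⁻¹ := congrArg Subtype.val e.2
      apply Subtype.ext
      change φ g = φ g'
      ext x
      change (g : G) * x * (g : G)⁻¹ = (g' : G) * x * (g' : G)⁻¹
      have hle : Qs i j ≤ MonoidHom.eqLocus (MulAut.conj (g : G)).toMonoidHom (MulAut.conj (g' : G)).toMonoidHom := by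
        refine (Subgroup.closure_le _).mpr ?_
        rintro x (rfl | rfl)
        · exact e1
        · exact e2
      exact hle x.2
    rwa [Nat.card_prod, q.card hc] at this
  have hj8 : Nat.card φ.range ∣ 40320 := by
    have h1 : Nat.card φ.range ∣ Nat.card (MulAut (Qs i j)) := Subgroup.card_subgroup_dvd_card _
    have h2 : Nat.card (MulAut (Qs i j)) ∣ Nat.card (Equiv.Perm (Qs i j)) := by
      apply Subgroup.card_dvd_of_injective (MulAut.toPerm (Qs i j))
      intro f g e
      ext x
      exact congrArg Subtype.val (DFunLike.congr_fun e x)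
    rw [Nat.card_perm, q.card hc] at h2
    exact h1.trans h2
  have hzQ : z ∈ Qs i j := q.ii ▸ mul_mem (mem_Qs_i i j) (mem_Qs_i i j)
  have h57 : ∀ l, (l = 5 ∨ l = 7) → ¬ l ∣ Nat.card φ.range := by
    intro l hl hdv
    have : Fact l.Prime := ⟨by rcases hl with rfl | rfl <;> norm_num⟩
    obtain ⟨⟨f, g, rfl⟩, hx⟩ := exists_prime_orderOf_dvd_card' l hdv
    rw [← Subgroup.orderOf_coe] at hx
    have h1 : φ g = 1 := autQ (q.card hc) (φ g) hl (by rw [← hx]; exact pow_orderOf_eq_one _)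
      (z := ⟨z, hzQ⟩) (fun h0 => hc.z1 (congrArg Subtype.val h0)) (by
        apply Subtype.ext
        change (g : G) * z * (g : G)⁻¹ = z
        rw [hc.zc]; group)
    simp only at hx
    rw [h1, orderOf_one] at hx
    omega
  have hj0 : Nat.card φ.range ≠ 0 := Nat.card_pos.ne'
  have hc0 : 0 < Nat.card φ.ker := Nat.card_pos
  have hdv : p ^ e + 1 ∣ (Subgroup.normalizer (Qs i j : Set G)).index * Nat.card φ.range := by
    obtain ⟨t, ht⟩ := hkd
    rw [hUe] at ht
    refine ⟨t, ?_⟩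
    have hs : Nat.card G = (p ^ e + 1) * (p ^ e - 1) := by
      rw [hcard, hd2, mul_comm 2 e, pow_mul, ← Nat.sq_sub_sq]
    rw [← hci, ← h1, ht] at hs
    apply Nat.eq_of_mul_eq_mul_left hc0
    linarith
  by_contra hne
  apply fin_arith hp hp2 hk hk0 hj64 hj0 hj8 (h57 5 (Or.inl rfl)) (h57 7 (Or.inr rfl)) hdv (e := e)
    (by omega)
  rcases h3 with h3 | h3
  · left; exact h3
  · right; rwa [← hd2, ← hcard]

lemma comm_normal_sup {G : Type*} [Group G] (A R : Subgroup G) (hA : ∀ x ∈ A, ∀ y ∈ A, x * y = y * x)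
    (hR : ∀ x ∈ R, ∀ y ∈ R, x * y = y * x) (hAR : ∀ x ∈ A, ∀ y ∈ R, x * y = y * x) :
    ∀ x ∈ A ⊔ R, ∀ y ∈ A ⊔ R, x * y = y * x := by
  have h1 : ∀ u, (∀ y ∈ A, u * y = y * u) → (∀ y ∈ R, u * y = y * u) → ∀ y ∈ A ⊔ R, u * y = y * u := by
    intro u h1 h2 y hy
    have hle : A ⊔ R ≤ Subgroup.centralizer {u} := by
      rw [sup_le_iff]
      constructor
      · intro y hy; rw [Subgroup.mem_centralizer_singleton_iff]; exact (h1 y hy).symm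
      · intro y hy; rw [Subgroup.mem_centralizer_singleton_iff]; exact (h2 y hy).symm
    exact (Subgroup.mem_centralizer_singleton_iff.mp (hle hy)).symm
  intro x hx y hy
  apply h1 x _ _ y hy
  · intro a ha
    exact (h1 a (hA a ha) (hAR a ha) x hx).symm
  · intro r hr
    exact (h1 r (fun a ha => (hAR a ha r hr).symm) (hR r hr) x hx).symm

lemma exists_R {G : Type*} [Group G] [Finite G] (hs : ∃ n, derivedSeries G n = ⊥) :
    (∃ A : Subgroup G, A.Normal ∧ (∀ x ∈ A, ∀ y ∈ A, x * y = y * x) ∧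
      ∀ x, (∀ y ∈ A, x * y = y * x) → x ∈ A) ∨
    ∃ R : Subgroup G, R.Normal ∧ (¬ ∀ x ∈ R, ∀ y ∈ R, x * y = y * x) ∧
      ∀ x ∈ R, ∀ y ∈ R, ∀ w ∈ R, x * y * x⁻¹ * y⁻¹ * w = w * (x * y * x⁻¹ * y⁻¹) := by
  classical
  obtain ⟨A, hN, hA, hmax⟩ := exists_max_abelian_normal G
  by_cases hC : ∀ x, (∀ y ∈ A, x * y = y * x) → x ∈ A
  · exact Or.inl ⟨A, hN, hA, hC⟩
  right
  let C := Subgroup.centralizer (A : Set G)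
  let T : ℕ → Subgroup G := fun n => Nat.rec C (fun _ S => ⁅S, S⁆) n
  have hT1 : ∀ n, T (n + 1) = ⁅T n, T n⁆ := fun n => rfl
  have hTN : ∀ n, (T n).Normal := by
    intro n
    induction n with
    | zero => change C.Normal; infer_instance
    | succ n ih => rw [hT1]; exact @Subgroup.commutator_normal G _ (T n) (T n) ih ih
  have hTd : ∀ n, T n ≤ derivedSeries G n := by
    intro n
    induction n with
    | zero => exact le_top
    | succ n ih => rw [hT1, derivedSeries_succ]; exact Subgroup.commutator_mono ih ih
  have hTC : ∀ n, T n ≤ C := by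
    intro n
    induction n with
    | zero => exact le_rfl
    | succ n ih =>
      rw [hT1]
      have := hTN n
      exact (@Subgroup.commutator_le_left G _ (T n) (T n) (hTN n)).trans ih
  have hex : ∃ n, T n ≤ A := by
    obtain ⟨n, hn⟩ := hs
    refine ⟨n, (hTd n).trans ?_⟩
    rw [hn]; exact bot_le
  have h0 : ¬ T 0 ≤ A := by
    intro h0
    apply hC
    intro x hx
    exact h0 (Subgroup.mem_centralizer_iff.mpr (fun y hy => (hx y hy).symm))
  obtain ⟨n, hn2, hn1⟩ : ∃ n, ¬ T n ≤ A ∧ T (n + 1) ≤ A := by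
    by_contra hno
    push Not at hno
    have : ∀ n, ¬ T n ≤ A := by
      intro n
      induction n with
      | zero => exact h0
      | succ n ih => exact hno n ih
    obtain ⟨n, hn⟩ := hex
    exact this n hn
  have hcomm : ∀ x ∈ A, ∀ y ∈ T n, x * y = y * x := fun x hx y hy =>
    Subgroup.mem_centralizer_iff.mp (hTC n hy) x hx
  refine ⟨T n, hTN n, ?_, ?_⟩
  · intro hR
    apply hn2
    have := hTN n
    exact le_sup_right.trans (hmax (A ⊔ T n) (@Subgroup.sup_normal G _ A (T n) hN (hTN n)) (comm_normal_sup A _ hA hR hcomm) le_sup_left)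
  · intro x hx y hy w hw
    exact hcomm _ (hn1 (Subgroup.commutator_mem_commutator hx hy)) w hw

lemma class_two_Q {G : Type*} [Group G] [Finite G] (hF : FC G) {R : Subgroup G} (hN : R.Normal)
    (hna : ¬ ∀ x ∈ R, ∀ y ∈ R, x * y = y * x)
    (hcl : ∀ x ∈ R, ∀ y ∈ R, ∀ w ∈ R, x * y * x⁻¹ * y⁻¹ * w = w * (x * y * x⁻¹ * y⁻¹)) :
    ∃ z i j : G, Ctx G z ∧ QP z i j ∧ (Subgroup.normalizer (Qs i j : Set G)).index = 1 := by
  have : Fact (Nat.Prime 2) := ⟨Nat.prime_two⟩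
  have hnil : Group.IsNilpotent R := by
    apply Subgroup.isNilpotent_of_ker_le_center (Abelianization.of (G := R))
    rw [Abelianization.ker_of, commutator_def, Subgroup.commutator_le]
    intro x _ y _
    rw [Subgroup.mem_center_iff]
    intro w
    apply Subtype.ext
    exact (hcl x.1 x.2 y.1 y.2 w.1 w.2).symm
  have hFR := hF.subgroup R
  have hsyl : ∃ S : Sylow 2 R, ¬ IsCyclic S := by
    by_contra hno
    push Not at hno
    apply hna
    obtain ⟨e⟩ := (Group.isNilpotent_of_finite_tfae (G := R)).out 0 4 rfl rfl |>.mp hnil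
    have key : ∀ a b : (∀ p : (Nat.card R).primeFactors, ∀ P : Sylow p R, (↑P : Subgroup R)), a * b = b * a := by
      intro a b
      funext t P
      have ht : Fact (t : ℕ).Prime := ⟨Nat.prime_of_mem_primeFactors t.2⟩
      have hc : IsCyclic P := by
        by_cases h2 : (t : ℕ) = 2
        · obtain ⟨t, ht'⟩ := t
          simp only at h2
          subst h2
          exact hno P
        · exact (hFR.subgroup P).odd_cyclic P.isPGroup' h2
      have := IsCyclic.isMulCommutative (α := P)
      exact mul_comm' _ _
    intro x hx y hy
    have := key (e.symm ⟨x, hx⟩) (e.symm ⟨y, hy⟩)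
    rw [← map_mul, ← map_mul] at this
    exact congrArg Subtype.val (e.symm.injective this)
  obtain ⟨S, hS⟩ := hsyl
  have hSn : (S : Subgroup R).Normal := ((Group.isNilpotent_of_finite_tfae (G := R)).out 0 3 rfl rfl |>.mp hnil) 2 this S
  have hSc := S.characteristic_of_normal hSn
  have hSE : ((S : Subgroup R).map R.subtype).Normal := inferInstance
  rcases (hFR.subgroup S).two_group S.isPGroup' with hcy | ⟨s, hs4, hidx, hinv⟩
  · exact absurd hcy hS
  have hgex : ∃ g : S, g ∉ Subgroup.zpowers s := by
    by_contra hno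
    push Not at hno
    have : Subgroup.zpowers s = ⊤ := by rw [eq_top_iff]; exact fun x _ => hno x
    rw [this, Subgroup.index_top] at hidx
    omega
  obtain ⟨g, hg⟩ := hgex
  obtain ⟨h1, h2, h3⟩ := hinv g hg
  have hs4' : s ^ 4 = 1 := by
    have e := hcl g.1.1 g.1.2 s.1.1 s.1.2 g.1.1 g.1.2
    have e2 : g * s * g⁻¹ * s⁻¹ * g = g * (g * s * g⁻¹ * s⁻¹) := Subtype.ext (Subtype.ext e)
    rw [h1] at e2
    have e3 : g * (s⁻¹ * s⁻¹) * g⁻¹ = s * s := by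
      have : g * (s⁻¹ * s⁻¹) * g⁻¹ = (g * s * g⁻¹)⁻¹ * (g * s * g⁻¹)⁻¹ := by group
      rw [this, h1, inv_inv]
    have e4 : s⁻¹ * s⁻¹ = s * s := by
      rw [← e3, ← e2]; group
    calc s ^ 4 = (s * s) * (s * s) := by simp only [pow_succ, pow_zero, one_mul, mul_assoc]
      _ = (s⁻¹ * s⁻¹) * (s * s) := by rw [e4]
      _ = 1 := by group
  have hso : orderOf s = 4 := Nat.dvd_antisymm (orderOf_dvd_of_pow_eq_one hs4') hs4
  have hScard : Nat.card S = 8 := by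
    rw [← Subgroup.card_mul_index (Subgroup.zpowers s), hidx, Nat.card_zpowers, hso]
  have hs2 : s * s ≠ 1 := by
    intro h0
    have := orderOf_dvd_of_pow_eq_one (x := s) (n := 2) (by rw [pow_two, h0])
    rw [hso] at this
    omega
  have hc : Ctx S (s * s) := ⟨hFR.subgroup S, hs2, by rw [← hs4']; simp only [pow_succ, pow_zero, one_mul, mul_assoc]⟩
  have hgg : g * g = s * s := by
    apply hc.eq_z
    · rw [← pow_two]; exact h2
    · rw [← h3]; simp only [pow_succ, pow_zero, one_mul, mul_assoc]
  have hcG : Ctx G ((s * s : S) : R) := ⟨hF, fun h0 => hs2 (Subtype.ext (Subtype.ext h0)),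
    congrArg (fun x : S => ((x : R) : G)) hc.z2⟩
  have q : QP (((s * s : S) : R) : G) s g := ⟨rfl, congrArg (fun x : S => ((x : R) : G)) hgg,
    congrArg (fun x : S => ((x : R) : G)) h1⟩
  refine ⟨_, _, _, hcG, q, ?_⟩
  have hQ : Qs ((s : R) : G) ((g : R) : G) = (S : Subgroup R).map R.subtype := by
    apply Subgroup.eq_of_le_of_card_ge
    · rw [Qs, Subgroup.closure_le]
      rintro x (rfl | rfl)
      · exact ⟨s, s.2, rfl⟩
      · exact ⟨g, g.2, rfl⟩
    · rw [q.card hcG, Subgroup.card_map_of_injective R.subtype_injective]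
      exact hScard.le
  rw [hQ, Subgroup.normalizer_eq_top, Subgroup.index_top]

lemma perfect_core {G : Type*} [Group G] [Finite G] :
    (∃ n, derivedSeries G n = ⊥) ∨ ∃ P : Subgroup G, P.Normal ∧ P ≠ ⊥ ∧ commutator P = ⊤ := by
  by_cases hs : ∃ n, derivedSeries G n = ⊥
  · exact Or.inl hs
  right
  push Not at hs
  have hstab : ∃ n, derivedSeries G (n + 1) = derivedSeries G n := by
    by_contra hno
    push Not at hno
    have hdec : ∀ n, Nat.card (derivedSeries G n) + n ≤ Nat.card G := by
      intro n
      induction n with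
      | zero => simpa using Subgroup.card_le_card_group (derivedSeries G 0)
      | succ n ih =>
        have hle : derivedSeries G (n + 1) ≤ derivedSeries G n := by
          rw [derivedSeries_succ]; exact Subgroup.commutator_le_left _ _
        have : Nat.card (derivedSeries G (n + 1)) < Nat.card (derivedSeries G n) := by
          by_contra hge
          exact hno n (Subgroup.eq_of_le_of_card_ge hle (by omega))
        omega
    have := hdec (Nat.card G)
    have : 0 < Nat.card (derivedSeries G (Nat.card G)) := Nat.card_pos
    omega
  obtain ⟨n, hn⟩ := hstab
  refine ⟨derivedSeries G n, inferInstance, hs n, ?_⟩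
  apply Subgroup.map_injective (derivedSeries G n).subtype_injective
  rw [Subgroup.map_subtype_commutator, ← derivedSeries_succ, hn, ← MonoidHom.range_eq_map,
    Subgroup.range_subtype]

theorem partE {p : ℕ} {G V : Type*} [Group G] [AddCommGroup V] [Module (ZMod p) V]
    {σ : G →* Module.End (ZMod p) V} [Fact p.Prime] [Finite V] [Nontrivial V] (h : Reg σ) {d : ℕ}
    (hd : d ≠ 0) (hV : Nat.card V = p ^ d) : d = 2 ∨
    ∃ A : Subgroup G, A.Normal ∧ (∀ x ∈ A, ∀ y ∈ A, x * y = y * x) ∧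
      ∀ x, (∀ y ∈ A, x * y = y * x) → x ∈ A := by
  have hG := h.finite
  have hfd : FiniteDimensional (ZMod p) V := inferInstance
  let K := AlgebraicClosure (ZMod p)
  have hf := (h.fpf hd hV).baseCh K
  have hFC := hf.fc
  rcases perfect_core (G := G) with hs | ⟨P, hPN, hPb, hPc⟩
  · rcases exists_R hs with hA | ⟨R, hN, hna, hcl⟩
    · exact Or.inr hA
    · obtain ⟨z, i, j, hc, q, hi⟩ := class_two_Q hFC hN hna hcl
      exact Or.inl (fin_two h hd hV hc q (by omega) (Or.inl hi))
  · left
    have : Nontrivial P := (Subgroup.nontrivial_iff_ne_bot P).mpr hPb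
    have : Fact (Nat.Prime 2) := ⟨Nat.prime_two⟩
    obtain ⟨z, i, j, hc, q, ⟨S, hS⟩, hidx, h3⟩ := perfect_main (hf.subgroup P) hPc
    have hcG : Ctx G (z : G) := ⟨hFC, fun h0 => hc.z1 (Subtype.ext h0), congrArg Subtype.val hc.z2⟩
    have qG : QP (z : G) i j := ⟨congrArg Subtype.val q.ii, congrArg Subtype.val q.jj,
      congrArg Subtype.val q.ji⟩
    have hmap : (Qs i j).map P.subtype = Qs (i : G) (j : G) := by
      rw [Qs, MonoidHom.map_closure, Set.image_pair]; rfl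
    have hfr := Sylow.normalizer_sup_eq_top S
    rw [hS, hmap] at hfr
    refine fin_two h hd hV hcG qG ?_ (Or.inr (h3.trans (Subgroup.card_subgroup_dvd_card P)))
    refine le_trans ?_ hidx
    rw [Subgroup.index, Subgroup.index]
    have hch : ∀ x : G ⧸ Subgroup.normalizer (Qs (i : G) (j : G) : Set G), ∃ g : P, QuotientGroup.mk (g : G) = x := by
      intro x
      induction x using QuotientGroup.induction_on with
      | H x =>
        have hx : x⁻¹ ∈ Subgroup.normalizer (Qs (i : G) (j : G) : Set G) ⊔ P := hfr ▸ Subgroup.mem_top _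
        rw [Subgroup.mem_sup_of_normal_right] at hx
        obtain ⟨n, hn, g, hg, e⟩ := hx
        refine ⟨⟨g⁻¹, inv_mem hg⟩, ?_⟩
        rw [QuotientGroup.eq]
        have : ((⟨g⁻¹, inv_mem hg⟩ : P) : G)⁻¹ * x = n⁻¹ := by
          have : x = g⁻¹ * n⁻¹ := by rw [← mul_inv_rev, e, inv_inv]
          rw [this]; group
        rw [this]
        exact inv_mem hn
    choose f hf using hch
    apply Nat.card_le_card_of_injective (fun x => (QuotientGroup.mk (f x) : P ⧸ Subgroup.normalizer (Qs i j : Set P)))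
    intro x y e
    simp only at e
    rw [QuotientGroup.eq] at e
    rw [← hf x, ← hf y, QuotientGroup.eq]
    have := Subgroup.le_normalizer_map P.subtype ⟨_, e, rfl⟩
    rw [hmap] at this
    exact this


lemma index_two_self {G : Type*} [Group G] (A : Subgroup G) (hA : ∀ x ∈ A, ∀ y ∈ A, x * y = y * x)
    (hi : A.index = 1 ∨ A.index = 2) :
    ∃ A : Subgroup G, A.Normal ∧ (∀ x ∈ A, ∀ y ∈ A, x * y = y * x) ∧
      ∀ x, (∀ y ∈ A, x * y = y * x) → x ∈ A := by
  rcases hi with hi | hi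
  · have : A = ⊤ := Subgroup.index_eq_one.mp hi
    subst this
    exact ⟨⊤, inferInstance, hA, fun x _ => Subgroup.mem_top x⟩
  by_cases hC : ∀ x, (∀ y ∈ A, x * y = y * x) → x ∈ A
  · exact ⟨A, Subgroup.normal_of_index_eq_two hi, hA, hC⟩
  push Not at hC
  obtain ⟨x, hx, hxA⟩ := hC
  have h1 := comm_sup_zpowers A x hA hx
  have htop : A ⊔ Subgroup.zpowers x = ⊤ := by
    rw [eq_top_iff]
    intro y _
    by_cases hy : y ∈ A
    · exact Subgroup.mem_sup_left hy
    · have : x⁻¹ * y ∈ A := by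
        rw [Subgroup.mul_mem_iff_of_index_two hi, inv_mem_iff]
        exact ⟨fun h => absurd h hxA, fun h => absurd h hy⟩
      have h2 : y = x * (x⁻¹ * y) := by group
      rw [h2]
      exact mul_mem (Subgroup.mem_sup_right (Subgroup.mem_zpowers x)) (Subgroup.mem_sup_left this)
  rw [htop] at h1
  exact ⟨⊤, inferInstance, h1, fun x _ => Subgroup.mem_top x⟩

lemma no_nineteen {G : Type*} [Group G] [Finite G] (hF : FC G) {Z C : Subgroup G} {h : G}
    (hZc : ∀ x ∈ Z, ∀ y, x * y = y * x) (hZ6 : Nat.card Z = 6)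
    (hZC : Z ≤ C) (hC : ∀ x ∈ C, ∀ y ∈ C, x * y = y * x) (hCc : Nat.card C = 18) (hh : h ∉ C)
    (hh2 : h ^ 2 ∈ C) (hhC : ∀ x ∈ C, h * x * h⁻¹ ∈ C)
    (hcen : ∀ x ∈ C, x ∉ Z → ∀ y, y * x = x * y → y ∈ C) : False := by
  have hcyc := hF.cyc C hC
  obtain ⟨x, hx⟩ := (Subgroup.isCyclic_iff_exists_zpowers_eq_top C).mp hcyc
  have hxC : x ∈ C := hx ▸ Subgroup.mem_zpowers x
  have hxo : orderOf x = 18 := by rw [← Nat.card_zpowers, hx, hCc]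
  have hcycZ := hF.cyc Z (fun x hx y _ => hZc x hx y)
  obtain ⟨y, hy⟩ := (Subgroup.isCyclic_iff_exists_zpowers_eq_top Z).mp hcycZ
  have hyZ : y ∈ Z := hy ▸ Subgroup.mem_zpowers y
  have hyo : orderOf y = 6 := by rw [← Nat.card_zpowers, hy, hZ6]
  have hmem : ∀ w ∈ C, w ^ 6 = 1 → w ∈ Z := by
    intro w hw hw6
    have := cyc_mem (S := C) (x := ⟨w, hw⟩) (y := ⟨y, hZC hyZ⟩) (by
      rw [← Subgroup.orderOf_coe]
      apply Subtype.ext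
      simp only
      rw [hyo]; exact hw6)
    obtain ⟨k, hk⟩ := this
    have := congrArg Subtype.val hk
    rw [← hy]
    exact ⟨k, by simpa using this⟩
  have hx3 : x ^ 3 ∈ Z := hmem _ (pow_mem hxC 3) (by
    rw [← pow_mul]; have := pow_orderOf_eq_one x; rwa [hxo] at this)
  have hxZ : x ∉ Z := by
    intro hxZ
    have h1 : orderOf (⟨x, hxZ⟩ : Z) ∣ 6 := hZ6 ▸ orderOf_dvd_natCard _
    rw [← Subgroup.orderOf_coe] at h1
    simp only [hxo] at h1
    omega
  set x' := h * x * h⁻¹ with hx'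
  have hx'C : x' ∈ C := hhC x hxC
  have hx'3 : x' ^ 3 = x ^ 3 := by
    rw [hx', conj_pow, ← hZc _ hx3]; group
  have hcm : Commute x' x⁻¹ := hC _ hx'C _ (inv_mem hxC)
  set c := x' * x⁻¹ with hc
  have hc3 : c ^ 3 = 1 := by
    rw [hc, hcm.mul_pow, hx'3, inv_pow]; group
  have hcC : c ∈ C := mul_mem hx'C (inv_mem hxC)
  have hcZ : c ∈ Z := hmem c hcC (by rw [show 6 = 3 * 2 by rfl, pow_mul, hc3, one_pow])
  have hhx : h * x * h⁻¹ = c * x := by rw [hc, hx']; group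
  have hch : h * c = c * h := (hZc c hcZ h).symm
  have e1 : h ^ 2 * x * (h ^ 2)⁻¹ = c * (c * x) := by
    have : h ^ 2 * x * (h ^ 2)⁻¹ = h * (h * x * h⁻¹) * h⁻¹ := by
      simp only [pow_succ, pow_zero, one_mul, mul_assoc, mul_inv_rev]
    rw [this, hhx]
    calc h * (c * x) * h⁻¹ = (h * c) * x * h⁻¹ := by group
      _ = c * (h * x * h⁻¹) := by rw [hch]; group
      _ = _ := by rw [hhx]
  rw [hC _ hh2 _ hxC, mul_inv_cancel_right, ← mul_assoc] at e1
  have hc2 : c * c = 1 := by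
    have : (c * c) * x = 1 * x := by rw [← e1, one_mul]
    exact mul_right_cancel this
  have hc1 : c = 1 := by
    rw [← hc3, pow_succ, pow_two, hc2, one_mul]
  rw [hc1, one_mul] at hhx
  exact hh (hcen x hxC hxZ h (by rw [mul_inv_eq_iff_eq_mul] at hhx; exact hhx))

lemma d2_arith (p m N c k : ℕ) (hp : p.Prime)
    (hmN : (m = 3 ∧ N = 12) ∨ (m = 4 ∧ N = 24) ∨ (m = 5 ∧ N = 60))
    (hNc : p ^ 2 - 1 = N * c) (hcls : 2 * k = (4 + m) * c) (h2 : 2 ∣ c) (hodd : p % 2 = 1)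
    (hdv : p + 1 ∣ N) (h19 : m = 5 → p = 19 → False) :
    (p = 5 ∧ k = 7) ∨ (p = 7 ∧ k = 8) ∨ (p = 11 ∧ k = 9) ∨ (p = 11 ∧ k = 35) ∨
     (p = 23 ∧ k = 88) ∨ (p = 29 ∧ k = 63) ∨ (p = 59 ∧ k = 261) := by
  have hN0 : 0 < N := by rcases hmN with h | h | h <;> omega
  have hle := Nat.le_of_dvd hN0 hdv
  rcases hmN with ⟨rfl, rfl⟩ | ⟨rfl, rfl⟩ | ⟨rfl, rfl⟩
  · have : p ≤ 11 := by omega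
    interval_cases p <;> first | omega | (exfalso; revert hp; norm_num; done)
  · have : p ≤ 23 := by omega
    interval_cases p <;> first | omega | (exfalso; revert hp; norm_num; done)
  · have : p ≤ 59 := by omega
    interval_cases p <;> first | omega | exact (h19 rfl rfl).elim | (exfalso; revert hp; norm_num; done)

theorem d_two {p : ℕ} {G V : Type*} [Group G] [AddCommGroup V] [Module (ZMod p) V]
    {σ : G →* Module.End (ZMod p) V} [Fact p.Prime] [Finite V] [Nontrivial V] (h : Reg σ)
    (hV : Nat.card V = p ^ 2) :
    (∃ A : Subgroup G, A.Normal ∧ (∀ x ∈ A, ∀ y ∈ A, x * y = y * x) ∧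
      ∀ x, (∀ y ∈ A, x * y = y * x) → x ∈ A) ∨
    ((p = 5 ∧ Nat.card (ConjClasses G) = 7) ∨ (p = 7 ∧ Nat.card (ConjClasses G) = 8) ∨
     (p = 11 ∧ Nat.card (ConjClasses G) = 9) ∨ (p = 11 ∧ Nat.card (ConjClasses G) = 35) ∨
     (p = 23 ∧ Nat.card (ConjClasses G) = 88) ∨ (p = 29 ∧ Nat.card (ConjClasses G) = 63) ∨
     (p = 59 ∧ Nat.card (ConjClasses G) = 261)) := by
  have hp : p.Prime := Fact.out
  have hG := h.finite
  have hfd : FiniteDimensional (ZMod p) V := inferInstance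
  let K := AlgebraicClosure (ZMod p)
  have hf := (h.fpf two_ne_zero hV).baseCh K
  have hFC := hf.fc
  have hrank : Module.finrank (ZMod p) V = 2 := by
    have h1 := Module.natCard_eq_pow_finrank (K := ZMod p) (V := V)
    rw [hV, Nat.card_zmod] at h1
    exact (Nat.pow_right_injective hp.two_le h1).symm
  have hrank2 : Module.finrank K (TensorProduct (ZMod p) K V) = 2 := by
    rw [Module.finrank_baseChange, hrank]
  rcases dickson hf hrank2 with ⟨A, hA, hi⟩ | ⟨m, N, D⟩
  · exact Or.inl (index_two_self A hA hi)
  right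
  set Z := scalarSub (bc K σ) with hZ
  have hcard := h.card
  rw [hV] at hcard
  have hNc := D.card
  rw [hcard] at hNc
  have hp2 : p ≠ 2 := by
    rintro rfl
    have hN12 : 12 ≤ N := by rcases D.mN with h | h | h <;> omega
    have hz0 : 0 < Nat.card Z := Nat.card_pos
    have : 12 ≤ N * Nat.card Z := le_trans hN12 (Nat.le_mul_of_pos_right _ hz0)
    omega
  have hodd : p % 2 = 1 := by rcases hp.eq_two_or_odd with h | h; exact absurd h hp2; exact h
  have hinj := hf.injective
  have hZc : ∀ x ∈ Z, ∀ y, x * y = y * x := by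
    rintro x ⟨μ, hμ⟩ y
    apply hinj
    rw [map_mul, map_mul, hμ]; simp
  have h2Z : 2 ∣ Nat.card Z := by
    have h2 : 2 ∣ Nat.card G := by
      rw [hcard]
      have : p ^ 2 % 2 = 1 := by rw [Nat.pow_mod, hodd]
      omega
    have : Fact (Nat.Prime 2) := ⟨Nat.prime_two⟩
    obtain ⟨x, hx⟩ := exists_prime_orderOf_dvd_card' 2 h2
    have hx1 : x ≠ 1 := by rintro rfl; rw [orderOf_one] at hx; omega
    have hxZ : x ∈ Z := ⟨-1, by rw [hf.neg_one x hx1 (by rw [← hx]; exact pow_orderOf_eq_one x)]; exact (neg_one_smul K (1 : Module.End K (TensorProduct (ZMod p) K V))).symm⟩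
    rw [← hx, ← Subgroup.orderOf_mk x hxZ]
    exact orderOf_dvd_natCard _
  have hZp : Nat.card Z ∣ p - 1 := by
    have hcycZ := hFC.cyc Z (fun x hx y _ => hZc x hx y)
    obtain ⟨y, hy⟩ := (Subgroup.isCyclic_iff_exists_zpowers_eq_top Z).mp hcycZ
    rw [← hy, Nat.card_zpowers]
    apply orderOf_dvd_of_pow_eq_one
    have hyZ : y ∈ Z := hy ▸ Subgroup.mem_zpowers y
    obtain ⟨μ, hμ⟩ := hyZ
    have htr : 2 * μ = algebraMap (ZMod p) K (LinearMap.trace (ZMod p) V (σ y)) := by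
      rw [← LinearMap.trace_baseChange]
      have : (σ y).baseChange K = μ • (1 : Module.End K (TensorProduct (ZMod p) K V)) := hμ
      rw [this, map_smul, LinearMap.trace_one, hrank2, smul_eq_mul, mul_comm]
      norm_num
    have h20 : (2 : ZMod p) ≠ 0 := by
      intro h0
      have : ((2 : ℕ) : ZMod p) = 0 := by exact_mod_cast h0
      rw [ZMod.natCast_eq_zero_iff] at this
      exact hp2 ((Nat.prime_dvd_prime_iff_eq hp Nat.prime_two).mp this)
    set t := LinearMap.trace (ZMod p) V (σ y) with ht
    have hμt : μ = algebraMap (ZMod p) K (t / 2) := by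
      have h2K : (2 : K) ≠ 0 := by
        have := (map_ne_zero (algebraMap (ZMod p) K)).mpr h20
        rwa [map_ofNat] at this
      rw [map_div₀, map_ofNat, ← htr]
      rw [mul_div_cancel_left₀ _ h2K]
    have hμ0 : μ ≠ 0 := by
      rintro rfl
      obtain ⟨v, hv⟩ := exists_ne (0 : TensorProduct (ZMod p) K V)
      have h1 : (bc K σ) y v = 0 := by rw [hμ]; simp
      have h2 : (bc K σ) y⁻¹ ((bc K σ) y v) = v := by
        rw [← Module.End.mul_apply, ← map_mul]; simp
      rw [h1, map_zero] at h2
      exact hv h2.symm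
    have hμp : μ ^ (p - 1) = 1 := by
      rw [hμt, ← map_pow, ZMod.pow_card_sub_one_eq_one, map_one]
      intro h0
      rw [h0, map_zero] at hμt
      exact hμ0 hμt
    apply hinj
    rw [map_pow, hμ, smul_pow, hμp, one_smul, one_pow, map_one]
  obtain ⟨t, ht⟩ := hZp
  have hz0 : 0 < Nat.card Z := Nat.card_pos
  have hpN : N = t * (p + 1) := by
    have h1 : p ^ 2 - 1 = (p + 1) * (p - 1) := by
      have := Nat.sq_sub_sq p 1
      simpa using this
    rw [h1, ht] at hNc
    apply Nat.eq_of_mul_eq_mul_right hz0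
    rw [← hNc]; ring
  have hcls := D.cls
  have h19 : m = 5 → p = 19 → False := by
    intro hm hp19
    obtain ⟨C, x, hZC, hC, hCc, hh, hh2, hhC, hcen⟩ := D.five hm
    have hN : N = 60 := by rcases D.mN with h | h | h <;> omega
    subst hp19
    rw [hN] at hNc
    have hZ6 : Nat.card Z = 6 := by omega
    exact no_nineteen hFC hZc hZ6 hZC hC (by rw [hCc, hZ6]) hh hh2 hhC hcen
  have hmN := D.mN
  have hdv : p + 1 ∣ N := ⟨t, by rw [hpN, mul_comm]⟩
  exact d2_arith p m N _ _ hp hmN hNc hcls h2Z hodd hdv h19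




/-! ### Arithmetic for part F -/

lemma s_cover_arith {n Q : ℕ} (hQ : 1 < Q) (hn : n ∣ Q ^ n - 1) (hn0 : n ≠ 0)
    (hs : ∀ t, ∃ j, (∑ i ∈ Finset.range j, Q ^ i) ≡ t [MOD n]) :
    (∀ ℓ : ℕ, ℓ.Prime → ℓ ∣ n → ℓ ∣ Q - 1) ∧ (4 ∣ n → 4 ∣ Q - 1) := by
  have h1 : ∀ ℓ : ℕ, ℓ.Prime → ℓ ∣ n → ℓ ∣ Q - 1 := by
    intro ℓ hℓ hℓn
    by_contra hcon
    have : Fact ℓ.Prime := ⟨hℓ⟩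
    have hQ1 : ((Q : ZMod ℓ) - 1) ≠ 0 := by
      intro h0
      apply hcon
      rw [← ZMod.natCast_eq_zero_iff, Nat.cast_sub hQ.le]
      simpa using h0
    have hQ0 : (Q : ZMod ℓ) ≠ 0 := by
      intro h0
      have h2 : ((Q ^ n - 1 : ℕ) : ZMod ℓ) = 0 := by
        rw [ZMod.natCast_eq_zero_iff]; exact hℓn.trans hn
      rw [Nat.cast_sub (Nat.one_le_pow _ _ (by omega)), Nat.cast_pow, h0, zero_pow hn0] at h2
      simp at h2
    obtain ⟨j, hj⟩ := hs (-(((Q : ZMod ℓ) - 1))⁻¹).val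
    have hj2 := hj.of_dvd hℓn
    rw [← ZMod.natCast_eq_natCast_iff, ZMod.natCast_zmod_val] at hj2
    push_cast at hj2
    have h3 := geom_sum_mul (Q : ZMod ℓ) j
    rw [hj2, neg_mul, inv_mul_cancel₀ hQ1] at h3
    have : (Q : ZMod ℓ) ^ j = 0 := by linear_combination -h3
    exact hQ0 (eq_zero_of_pow_eq_zero this)
  refine ⟨h1, fun h4 => ?_⟩
  by_contra hcon
  have h2 := h1 2 Nat.prime_two ((by norm_num : 2 ∣ 4).trans h4)
  have hQ3 : Q % 4 = 3 := by omega
  have hmod : ∀ j, (∑ i ∈ Finset.range j, Q ^ i) % 4 = 0 ∨ (∑ i ∈ Finset.range j, Q ^ i) % 4 = 1 := by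
    intro j
    induction j with
    | zero => left; rfl
    | succ j ih =>
      rw [geom_sum_succ]
      rcases ih with h | h
      · right; rw [Nat.add_mod, Nat.mul_mod, h]; simp
      · left; rw [Nat.add_mod, Nat.mul_mod, h, hQ3]; rfl
  obtain ⟨j, hj⟩ := hs 2
  have hj2 := hj.of_dvd h4
  have := hmod j
  unfold Nat.ModEq at hj2
  omega

lemma v_odd {Q ℓ N : ℕ} (hQ : 1 < Q) (hℓ : ℓ.Prime) (hodd : ℓ ≠ 2) (hd : ℓ ∣ Q - 1) (hN : N ≠ 0) :
    (Q ^ N - 1).factorization ℓ = (Q - 1).factorization ℓ + N.factorization ℓ := by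
  have : Fact ℓ.Prime := ⟨hℓ⟩
  have h := padicValNat.pow_sub_pow (p := ℓ) (hℓ.odd_of_ne_two hodd) (x := Q) (y := 1) hQ
    (by simpa using hd) (by
      intro h
      have h3 : ℓ ∣ 1 := by
        have := Nat.dvd_sub h hd
        rwa [Nat.sub_sub_self hQ.le] at this
      exact hℓ.one_lt.ne' (Nat.dvd_one.mp h3)) (n := N) hN
  simp only [Nat.factorization_def _ hℓ]
  simpa using h

lemma v_two {Q N : ℕ} (hQ : 1 < Q) (hd : 2 ∣ Q - 1) (hN : N ≠ 0) (hN2 : Even N) :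
    (Q ^ N - 1).factorization 2 + 1 =
      (Q + 1).factorization 2 + (Q - 1).factorization 2 + N.factorization 2 := by
  have h := padicValNat.pow_two_sub_pow (x := Q) (y := 1) hQ (by simpa using hd) (by omega) hN hN2
  simp only [Nat.factorization_def _ Nat.prime_two]
  simpa using h

lemma v_two_odd {Q N : ℕ} (hQ : 1 < Q) (hd : 2 ∣ Q - 1) (hN2 : Odd N) :
    (Q ^ N - 1).factorization 2 = (Q - 1).factorization 2 := by
  have hg : (∑ i ∈ Finset.range N, Q ^ i) * (Q - 1) = Q ^ N - 1 := by
    have h := geom_sum_mul (Q : ℤ) N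
    zify [hQ.le, Nat.one_le_pow N Q (by omega)]
    exact h
  have hodd : Q % 2 = 1 := by omega
  have hm : ∀ N, (∑ i ∈ Finset.range N, Q ^ i) % 2 = N % 2 := by
    intro N
    induction N with
    | zero => rfl
    | succ N ih => rw [Finset.sum_range_succ, Nat.add_mod, ih, Nat.pow_mod, hodd]; simp
  have hs := hm N
  rw [Nat.odd_iff.mp hN2] at hs
  rw [← hg, Nat.factorization_mul (by rintro h; rw [h] at hs; simp at hs) (by omega),
    Finsupp.add_apply, Nat.factorization_eq_zero_of_not_dvd (n := ∑ i ∈ Finset.range N, Q ^ i) (by omega), zero_add]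

lemma gcd_main {n Q : ℕ} (hQ : 1 < Q) (h1 : ∀ ℓ : ℕ, ℓ.Prime → ℓ ∣ n → ℓ ∣ Q - 1) {m' e : ℕ} (hn : n ≠ 0) (hm : Q ^ n - 1 = n * m') (he : e ∣ n) :
    Nat.gcd m' (Q ^ e - 1) * e = Q ^ e - 1 := by
  have he0 : e ≠ 0 := by rintro rfl; exact hn (zero_dvd_iff.mp he)
  have hpos : ∀ N, N ≠ 0 → Q ^ N - 1 ≠ 0 := by
    intro N hN
    have := Nat.one_lt_pow hN hQ
    omega
  have hm0 : m' ≠ 0 := by rintro rfl; exact hpos n hn (by simpa using hm)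
  have hg0 : Nat.gcd m' (Q ^ e - 1) ≠ 0 := Nat.gcd_ne_zero_left hm0
  apply Nat.eq_of_factorization_eq (mul_ne_zero hg0 he0) (hpos e he0)
  intro ℓ
  by_cases hℓ : ℓ.Prime
  swap
  · simp [Nat.factorization_eq_zero_of_not_prime _ hℓ]
  rw [Nat.factorization_mul hg0 he0, Nat.factorization_gcd hm0 (hpos e he0)]
  have hmf : (Q ^ n - 1).factorization ℓ = n.factorization ℓ + m'.factorization ℓ := by
    rw [hm, Nat.factorization_mul hn hm0]; rfl
  simp only [Finsupp.add_apply, Finsupp.inf_apply]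
  by_cases hℓn : ℓ ∣ n
  · have hd := h1 ℓ hℓ hℓn
    by_cases h2 : ℓ = 2
    · subst h2
      have hne : Even n := even_iff_two_dvd.mpr hℓn
      have hvn := v_two hQ hd hn hne
      rcases Nat.even_or_odd e with hev | hodd
      · have hve := v_two hQ hd he0 hev
        have : 1 ≤ (Q + 1).factorization 2 :=
          (Nat.Prime.dvd_iff_one_le_factorization Nat.prime_two (by omega)).mp (by omega)
        have hmin : min (m'.factorization 2) ((Q ^ e - 1).factorization 2) = m'.factorization 2 := by
          apply min_eq_left; omega
        rw [hmin]; omega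
      · have hve := v_two_odd hQ hd hodd
        have h0 : e.factorization 2 = 0 := Nat.factorization_eq_zero_of_not_dvd (by
          rw [← even_iff_two_dvd]; exact Nat.not_even_iff_odd.mpr hodd)
        have : 1 ≤ (Q + 1).factorization 2 :=
          (Nat.Prime.dvd_iff_one_le_factorization Nat.prime_two (by omega)).mp (by omega)
        have hmin : min (m'.factorization 2) ((Q ^ e - 1).factorization 2) = (Q ^ e - 1).factorization 2 := by
          apply min_eq_right; omega
        rw [hmin]; omega
    · have hvn := v_odd hQ hℓ h2 hd hn
      have hve := v_odd hQ hℓ h2 hd he0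
      have hmin : min (m'.factorization ℓ) ((Q ^ e - 1).factorization ℓ) = m'.factorization ℓ := by
        apply min_eq_left; omega
      rw [hmin]; omega
  · have h0 : e.factorization ℓ = 0 := Nat.factorization_eq_zero_of_not_dvd (fun h => hℓn (h.trans he))
    have h0n : n.factorization ℓ = 0 := Nat.factorization_eq_zero_of_not_dvd hℓn
    have hle : (Q ^ e - 1).factorization ℓ ≤ (Q ^ n - 1).factorization ℓ :=
      (Nat.factorization_le_iff_dvd (hpos e he0) (hpos n hn)).mpr (by
        obtain ⟨f, rfl⟩ := he
        rw [pow_mul]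
        simpa using Nat.sub_dvd_pow_sub_pow (Q ^ e) 1 f) ℓ
    have hmin : min (m'.factorization ℓ) ((Q ^ e - 1).factorization ℓ) = (Q ^ e - 1).factorization ℓ := by
      apply min_eq_right; omega
    rw [hmin]; omega


lemma J2_one : J2 1 = 1 := by simp [J2]

/-- `J2` as an arithmetic function. -/
def J2A : ArithmeticFunction ℚ := ⟨J2, by simp [J2]⟩

lemma J2A_mult : J2A.IsMultiplicative := by
  refine ⟨J2_one, ?_⟩
  intro m n h
  change J2 (m * n) = J2 m * J2 n
  unfold J2
  rw [h.primeFactors_mul, Finset.prod_union h.disjoint_primeFactors]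
  push_cast
  ring

lemma J2_prime_pow {p : ℕ} (hp : p.Prime) (a : ℕ) :
    J2 (p ^ (a + 1)) = (p : ℚ) ^ (2 * (a + 1)) - (p : ℚ) ^ (2 * a) := by
  unfold J2
  rw [Nat.primeFactors_prime_pow (by omega) hp, Finset.prod_singleton]
  have : (p : ℚ) ≠ 0 := by exact_mod_cast hp.ne_zero
  push_cast
  field_simp
  ring

/-- The arithmetic function `n ↦ n²`. -/
def sqA : ArithmeticFunction ℚ := ⟨fun n => (n : ℚ) ^ 2, by simp⟩

lemma sqA_mult : sqA.IsMultiplicative := by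
  refine ⟨by simp [sqA], ?_⟩
  intro m n _
  simp only [sqA, ArithmeticFunction.coe_mk]
  push_cast; ring

lemma sum_J2A : J2A * ((ArithmeticFunction.zeta : ArithmeticFunction ℕ) : ArithmeticFunction ℚ) = sqA := by
  rw [ArithmeticFunction.IsMultiplicative.eq_iff_eq_on_prime_powers _
    (J2A_mult.mul ArithmeticFunction.isMultiplicative_zeta.natCast) _ sqA_mult]
  intro p a hp
  rw [ArithmeticFunction.coe_mul_zeta_apply, Nat.sum_divisors_prime_pow hp]
  induction a with
  | zero => simp [J2A, sqA, J2_one]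
  | succ a ih =>
    rw [Finset.sum_range_succ, ih]
    simp only [J2A, sqA, ArithmeticFunction.coe_mk]
    rw [J2_prime_pow hp]
    push_cast
    ring

lemma sum_J2 (n : ℕ) : ∑ e ∈ n.divisors, J2 e = (n : ℚ) ^ 2 := by
  have := congrArg (fun f => f n) sum_J2A
  simp only [ArithmeticFunction.coe_mul_zeta_apply] at this
  exact this

/-- pairs with given gcd -/
def gp (n e : ℕ) : Finset (ℕ × ℕ) :=
  (Finset.range n ×ˢ Finset.range n).filter (fun q => Nat.gcd n (Nat.gcd q.1 q.2) = e)

lemma gp_scale {n e : ℕ} (hn : n ≠ 0) (he : e ∣ n) : (gp n e).card = (gp (n / e) 1).card := by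
  obtain ⟨x, rfl⟩ := he
  have he0 : 0 < e := Nat.pos_of_ne_zero (by rintro rfl; simp at hn)
  rw [Nat.mul_div_cancel_left x he0]
  symm
  apply Finset.card_bij (fun q _ => (e * q.1, e * q.2))
  · rintro ⟨i, j⟩ h
    simp only [gp, Finset.mem_filter, Finset.mem_product, Finset.mem_range] at h ⊢
    refine ⟨⟨Nat.mul_lt_mul_of_pos_left h.1.1 he0, Nat.mul_lt_mul_of_pos_left h.1.2 he0⟩, ?_⟩
    rw [Nat.gcd_mul_left, Nat.gcd_mul_left, h.2, mul_one]
  · rintro ⟨i, j⟩ _ ⟨i', j'⟩ _ h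
    simp only [Prod.mk.injEq] at h
    rw [Nat.eq_of_mul_eq_mul_left he0 h.1, Nat.eq_of_mul_eq_mul_left he0 h.2]
  · rintro ⟨i, j⟩ h
    simp only [gp, Finset.mem_filter, Finset.mem_product, Finset.mem_range] at h
    obtain ⟨⟨h1, h2⟩, h3⟩ := h
    have hi : e ∣ i := by
      rw [← h3]; exact (Nat.gcd_dvd_right _ _).trans (Nat.gcd_dvd_left _ _)
    have hj : e ∣ j := by
      rw [← h3]; exact (Nat.gcd_dvd_right _ _).trans (Nat.gcd_dvd_right _ _)
    obtain ⟨i, rfl⟩ := hi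
    obtain ⟨j, rfl⟩ := hj
    refine ⟨(i, j), ?_, rfl⟩
    simp only [gp, Finset.mem_filter, Finset.mem_product, Finset.mem_range]
    refine ⟨⟨lt_of_mul_lt_mul_left h1 he0.le, lt_of_mul_lt_mul_left h2 he0.le⟩, ?_⟩
    rw [Nat.gcd_mul_left, Nat.gcd_mul_left] at h3
    exact Nat.eq_of_mul_eq_mul_left he0 (by rw [h3, mul_one])

lemma sum_gp {n : ℕ} (hn : n ≠ 0) (F : ℕ → ℚ) :
    ∑ q ∈ Finset.range n ×ˢ Finset.range n, F (Nat.gcd n (Nat.gcd q.1 q.2)) =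
      ∑ e ∈ n.divisors, F e * (gp n e).card := by
  rw [← Finset.sum_fiberwise_of_maps_to (t := n.divisors)
    (g := fun q : ℕ × ℕ => Nat.gcd n (Nat.gcd q.1 q.2))]
  · apply Finset.sum_congr rfl
    intro e _
    rw [Finset.sum_congr rfl (g := fun _ => F e)]
    · rw [Finset.sum_const, nsmul_eq_mul, mul_comm]; rfl
    · intro q hq
      rw [(Finset.mem_filter.mp hq).2]
  · intro q _
    exact Nat.mem_divisors.mpr ⟨Nat.gcd_dvd_left _ _, hn⟩

lemma gp_one (n : ℕ) (hn : n ≠ 0) : ((gp n 1).card : ℚ) = J2 n := by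
  induction n using Nat.strong_induction_on with
  | _ n ih =>
    have h1 := sum_gp hn (fun _ => 1)
    simp only [Finset.sum_const, Finset.card_product, Finset.card_range, one_mul, nsmul_eq_mul,
      mul_one] at h1
    have h2 : ∑ e ∈ n.divisors, ((gp n e).card : ℚ) = ∑ e ∈ n.divisors, ((gp e 1).card : ℚ) := by
      rw [← Nat.sum_div_divisors n (fun e => ((gp e 1).card : ℚ))]
      apply Finset.sum_congr rfl
      intro e he
      rw [gp_scale hn (Nat.dvd_of_mem_divisors he)]
    have h3 := sum_J2 n
    rw [← Nat.insert_self_properDivisors hn, Finset.sum_insert Nat.self_notMem_properDivisors] at h3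
    rw [h2, ← Nat.insert_self_properDivisors hn, Finset.sum_insert Nat.self_notMem_properDivisors] at h1
    have h4 : ∑ e ∈ n.properDivisors, ((gp e 1).card : ℚ) = ∑ e ∈ n.properDivisors, J2 e := by
      apply Finset.sum_congr rfl
      intro e he
      rw [Nat.mem_properDivisors] at he
      exact ih e he.2 (by rintro rfl; exact hn (zero_dvd_iff.mp he.1))
    rw [h4] at h1
    push_cast at h1
    linarith

lemma sum_J2_pairs {n : ℕ} (hn : n ≠ 0) (F : ℕ → ℚ) :
    ∑ q ∈ Finset.range n ×ˢ Finset.range n, F (Nat.gcd n (Nat.gcd q.1 q.2)) =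
      ∑ e ∈ n.divisors, F e * J2 (n / e) := by
  rw [sum_gp hn]
  apply Finset.sum_congr rfl
  intro e he
  have hd := Nat.dvd_of_mem_divisors he
  rw [gp_scale hn hd, gp_one]
  exact (Nat.div_pos (Nat.le_of_dvd (Nat.pos_of_ne_zero hn) hd)
    (Nat.pos_of_mem_divisors he)).ne'

lemma J2_nonneg (n : ℕ) : 0 ≤ J2 n := by
  unfold J2
  apply mul_nonneg (by positivity)
  apply Finset.prod_nonneg
  intro ℓ hℓ
  have h1 : (1 : ℚ) ≤ (ℓ : ℚ) := by exact_mod_cast (Nat.prime_of_mem_primeFactors hℓ).one_le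
  have : 1 / (ℓ : ℚ) ^ 2 ≤ 1 := by
    rw [div_le_one (by positivity)]
    exact one_le_pow₀ h1
  linarith

lemma J2_gt {n : ℕ} (hn : 1 < n) : (n : ℚ) * (Nat.totient n : ℚ) < J2 n := by
  have h1 := Nat.totient_eq_mul_prod_factors n
  rw [h1]
  unfold J2
  have hpos : ∀ ℓ ∈ n.primeFactors, (0 : ℚ) < 1 - (ℓ : ℚ)⁻¹ := by
    intro ℓ hℓ
    have : (1 : ℚ) < ℓ := by exact_mod_cast (Nat.prime_of_mem_primeFactors hℓ).one_lt
    have := inv_lt_one_of_one_lt₀ this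
    linarith
  have hlt : ∏ ℓ ∈ n.primeFactors, (1 - (ℓ : ℚ)⁻¹) < ∏ ℓ ∈ n.primeFactors, (1 - 1 / (ℓ : ℚ) ^ 2) := by
    apply Finset.prod_lt_prod_of_nonempty hpos
    · intro ℓ hℓ
      have hl : (1 : ℚ) < ℓ := by exact_mod_cast (Nat.prime_of_mem_primeFactors hℓ).one_lt
      have h0 : (0 : ℚ) < (ℓ : ℚ)⁻¹ := by positivity
      have h2 := inv_lt_one_of_one_lt₀ hl
      rw [one_div, ← inv_pow]
      nlinarith
    · exact Nat.nonempty_primeFactors.mpr hn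
  have hn0 : (0 : ℚ) < (n : ℚ) ^ 2 := by positivity
  calc (n : ℚ) * (n * ∏ ℓ ∈ n.primeFactors, (1 - (ℓ : ℚ)⁻¹))
      = (n : ℚ) ^ 2 * ∏ ℓ ∈ n.primeFactors, (1 - (ℓ : ℚ)⁻¹) := by ring
    _ < _ := mul_lt_mul_of_pos_left hlt hn0

lemma final_ineq {n Q : ℕ} (hn : 1 < n) (hQ : 1 < Q) :
    ((Q : ℚ) - 1) * (Nat.totient n : ℚ) + ((Q : ℚ) ^ n - 1) / (n : ℚ) ^ 2 <
      ∑ e ∈ n.divisors, ((Q : ℚ) ^ e - 1) / ((n : ℚ) * (e : ℚ)) * J2 (n / e) := by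
  have hn0 : n ≠ 0 := by omega
  have hnq : (0 : ℚ) < n := by exact_mod_cast (by omega : 0 < n)
  have hQq : (1 : ℚ) < Q := by exact_mod_cast hQ
  have hsub : ({1, n} : Finset ℕ) ⊆ n.divisors := by
    intro e he
    simp only [Finset.mem_insert, Finset.mem_singleton] at he
    rcases he with rfl | rfl <;> simp [hn0]
  have hle := Finset.sum_le_sum_of_subset_of_nonneg hsub
    (f := fun e : ℕ => ((Q : ℚ) ^ e - 1) / ((n : ℚ) * (e : ℚ)) * J2 (n / e)) (by
      intro e _ _
      apply mul_nonneg _ (J2_nonneg _)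
      apply div_nonneg _ (by positivity)
      have := one_le_pow₀ hQq.le (n := e)
      linarith)
  refine lt_of_lt_of_le ?_ hle
  rw [Finset.sum_pair (by omega)]
  have h1 : ((Q : ℚ) ^ n - 1) / ((n : ℚ) * (n : ℚ)) * J2 (n / n) = ((Q : ℚ) ^ n - 1) / (n : ℚ) ^ 2 := by
    rw [Nat.div_self (by omega), J2_one]; ring
  rw [h1]
  have h2 : ((Q : ℚ) - 1) * (Nat.totient n : ℚ) < ((Q : ℚ) ^ 1 - 1) / ((n : ℚ) * ((1 : ℕ) : ℚ)) * J2 (n / 1) := by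
    have := J2_gt hn
    rw [Nat.div_one, pow_one, Nat.cast_one, mul_one, div_mul_eq_mul_div, lt_div_iff₀ hnq, mul_assoc]
    apply mul_lt_mul_of_pos_left _ (by linarith)
    rw [mul_comm]; exact this
  linarith


lemma cyc_pairs {B : Type*} [CommGroup B] [Finite B] [IsCyclic B] (u w : ℕ) :
    Nat.card {q : B × B // q.2 ^ u = q.1 ^ w} = Nat.card B * Nat.gcd (Nat.card B) (Nat.gcd u w) := by
  obtain ⟨z, hz⟩ := IsCyclic.exists_generator (α := B)
  let f : B × B →* B :=
    { toFun := fun q => q.2 ^ u * (q.1 ^ w)⁻¹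
      map_one' := by simp
      map_mul' := by
        rintro ⟨a, b⟩ ⟨a', b'⟩
        simp only [Prod.mk_mul_mk, mul_pow, mul_inv]
        exact mul_mul_mul_comm _ _ _ _ }
  have hfa : ∀ q : B × B, f q = q.2 ^ u * (q.1 ^ w)⁻¹ := fun _ => rfl
  set g := Nat.gcd u w with hg
  have hrange : f.range = Subgroup.zpowers (z ^ g) := by
    apply le_antisymm
    · rintro _ ⟨⟨a, b⟩, rfl⟩
      obtain ⟨k, rfl⟩ := hz a
      obtain ⟨l, rfl⟩ := hz b
      obtain ⟨u', hu⟩ := Nat.gcd_dvd_left u w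
      obtain ⟨w', hw⟩ := Nat.gcd_dvd_right u w
      rw [← hg] at hu hw
      refine ⟨l * u' - k * w', ?_⟩
      simp only [hfa]
      rw [hu, hw]
      simp only [← zpow_natCast, ← zpow_mul, ← zpow_neg, ← zpow_add]
      congr 1
      push_cast
      ring
    · rw [Subgroup.zpowers_le]
      refine ⟨(z ^ (-(Nat.gcdB u w)), z ^ (Nat.gcdA u w)), ?_⟩
      simp only [hfa]
      simp only [← zpow_natCast, ← zpow_mul, ← zpow_neg, ← zpow_add]
      congr 1
      rw [hg, Nat.gcd_eq_gcd_ab]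
      ring
  have hzo : orderOf z = Nat.card B := orderOf_eq_card_of_forall_mem_zpowers hz
  have hcr : Nat.card f.range = Nat.card B / Nat.gcd (Nat.card B) g := by
    rw [hrange, Nat.card_zpowers, orderOf_pow, hzo]
  have hker : Nat.card {q : B × B // q.2 ^ u = q.1 ^ w} = Nat.card f.ker := by
    apply Nat.card_congr
    apply Equiv.subtypeEquivRight
    intro q
    rw [MonoidHom.mem_ker, hfa, mul_inv_eq_one]
  have h1 := Subgroup.card_mul_index f.ker
  rw [Subgroup.index_ker, hcr, Nat.card_prod] at h1
  rw [hker]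
  have hB : 0 < Nat.card B := Nat.card_pos
  obtain ⟨t, ht⟩ := Nat.gcd_dvd_left (Nat.card B) g
  have hg0 : 0 < Nat.gcd (Nat.card B) g := Nat.gcd_pos_of_pos_left _ hB
  generalize Nat.gcd (Nat.card B) g = x at *
  generalize Nat.card B = b at *
  subst ht
  rw [Nat.mul_div_cancel_left _ hg0] at h1
  have ht0 : 0 < t := Nat.pos_of_mul_pos_left hB
  apply Nat.eq_of_mul_eq_mul_right ht0
  rw [h1]; ring

theorem nf_count {G U : Type*} [Group G] [Finite G] [CommGroup U] [Finite U] [IsCyclic U]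
    {n Q : ℕ} (hQ : 1 < Q) (hn : n ≠ 0) (A : Subgroup G) (g0 : G) (c : G → U)
    (hc : Function.Injective c) (hU : Nat.card U = Q ^ n - 1) (hGU : Nat.card G = Q ^ n - 1)
    (hidx : A.index = n) (hgen : ∀ g, ∃ a ∈ A, ∃ j < n, g = a * g0 ^ j)
    (hA : ∀ a ∈ A, ∀ h, c (a * h) = c a * c h) (hg0 : ∀ h, c (g0 * h) = c g0 * c h ^ Q) :
    (∀ ℓ : ℕ, ℓ.Prime → ℓ ∣ n → ℓ ∣ Q - 1) ∧ (4 ∣ n → 4 ∣ Q - 1) ∧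
    (Nat.card (ConjClasses G) : ℚ) =
        ∑ e ∈ n.divisors, ((Q : ℚ) ^ e - 1) / ((n : ℚ) * (e : ℚ)) * J2 (n / e) := by
  classical
  have hc1 : c 1 = 1 := by
    have := hA 1 (one_mem A) 1
    rw [mul_one] at this
    exact (mul_eq_left.mp this.symm)
  let f : A →* U :=
    { toFun := fun a => c a
      map_one' := hc1
      map_mul' := fun a b => hA a a.2 b }
  have hfa : ∀ a : A, f a = c a := fun _ => rfl
  have hf : Function.Injective f := fun a b h => Subtype.ext (hc h)
  set γ := c g0 with hγ
  let s : ℕ → ℕ := fun j => ∑ i ∈ Finset.range j, Q ^ i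
  have hpow : ∀ j h, c (g0 ^ j * h) = γ ^ s j * c h ^ (Q ^ j) := by
    intro j h
    induction j with
    | zero => simp [s]
    | succ j ih =>
      have e1 : s (j + 1) = Q * s j + 1 := geom_sum_succ
      rw [pow_succ', mul_assoc, hg0, ih, mul_pow, e1, ← pow_mul, ← pow_mul, pow_succ γ, pow_succ Q,
        mul_comm (s j) Q, ← mul_assoc, mul_comm γ]
  have hpow1 : ∀ j, c (g0 ^ j) = γ ^ s j := by
    intro j
    have := hpow j 1
    rwa [mul_one, hc1, one_pow, mul_one] at this
  have hag : ∀ a ∈ A, ∀ j, c (a * g0 ^ j) = c a * γ ^ s j := by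
    intro a ha j; rw [hA a ha, hpow1]
  have hagh : ∀ a ∈ A, ∀ j h, c (a * g0 ^ j * h) = c a * γ ^ s j * c h ^ (Q ^ j) := by
    intro a ha j h; rw [mul_assoc, hA a ha, hpow, mul_assoc]
  set m' := Nat.card A with hm'
  have hm : Q ^ n - 1 = n * m' := by
    rw [← hGU, ← A.card_mul_index, hidx, mul_comm]
  have hsurj : Function.Surjective c :=
    ((Nat.bijective_iff_injective_and_card c).mpr ⟨hc, by rw [hU, hGU]⟩).2
  have hAm : ∀ a ∈ A, c a ^ m' = 1 := by
    intro a ha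
    rw [← hfa ⟨a, ha⟩, ← map_pow, hm', pow_card_eq_one', map_one]
  have hγn : (γ ^ m') ^ n = 1 := by
    rw [← pow_mul, mul_comm, ← hm, ← hU, pow_card_eq_one']
  have hm'0 : 0 < m' := Nat.card_pos
  obtain ⟨z, hz⟩ := IsCyclic.exists_generator (α := U)
  have hzo : orderOf z = n * m' := by rw [orderOf_eq_card_of_forall_mem_zpowers hz, hU, hm]
  have hγo : orderOf (γ ^ m') = n := by
    apply Nat.dvd_antisymm (orderOf_dvd_of_pow_eq_one hγn)
    obtain ⟨g, hg⟩ := hsurj z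
    obtain ⟨a, ha, j, -, rfl⟩ := hgen g
    have h1 : z ^ m' = (γ ^ m') ^ s j := by
      rw [← hg, hag a ha, mul_pow, hAm a ha, one_mul, ← pow_mul, ← pow_mul, mul_comm]
    have h2 : orderOf (z ^ m') = n := by
      rw [orderOf_pow, hzo, Nat.gcd_mul_left_left, Nat.mul_div_cancel _ hm'0]
    rw [← h2, h1]
    exact orderOf_pow_dvd _
  have hs : ∀ t, ∃ j, (∑ i ∈ Finset.range j, Q ^ i) ≡ t [MOD n] := by
    intro t
    obtain ⟨g, hg⟩ := hsurj (γ ^ t)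
    obtain ⟨a, ha, j, -, rfl⟩ := hgen g
    refine ⟨j, ?_⟩
    have h1 : (γ ^ m') ^ s j = (γ ^ m') ^ t := by
      rw [← pow_mul γ m' t, mul_comm m' t, pow_mul, ← hg, hag a ha, mul_pow, hAm a ha, one_mul,
        ← pow_mul, ← pow_mul, mul_comm]
    rw [pow_eq_pow_iff_modEq, hγo] at h1
    exact h1
  obtain ⟨h1, h4⟩ := s_cover_arith hQ ⟨m', hm⟩ hn hs
  refine ⟨h1, h4, ?_⟩
  -- counting
  have hQ0 : 0 < Q := by omega
  have hcycA : IsCyclic A := isCyclic_of_injective f hf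
  have hcommA : ∀ a b : A, a * b = b * a := fun a b => hf (by rw [map_mul, map_mul, mul_comm])
  let iA : CommGroup A := { (inferInstance : Group A) with mul_comm := hcommA }
  let F : A × Fin n → G := fun q => q.1 * g0 ^ (q.2 : ℕ)
  have hFb : Function.Bijective F := by
    rw [Nat.bijective_iff_surjective_and_card]
    constructor
    · intro g
      obtain ⟨a, ha, j, hj, rfl⟩ := hgen g
      exact ⟨(⟨a, ha⟩, ⟨j, hj⟩), rfl⟩
    · rw [Nat.card_prod, hGU, hm, Nat.card_fin, mul_comm]
  have hs2 : ∀ i j, s i + s j * Q ^ i = s j + s i * Q ^ j := by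
    intro i j
    have e1 := geom_sum_mul (Q : ℤ) i
    have e2 := geom_sum_mul (Q : ℤ) j
    have hs' : ∀ i, ((s i : ℕ) : ℤ) = ∑ k ∈ Finset.range i, (Q : ℤ) ^ k := by
      intro i; simp [s]
    rw [← hs'] at e1 e2
    have hq1 : ((Q : ℤ) - 1) ≠ 0 := by
      have : (1 : ℤ) < Q := by exact_mod_cast hQ
      omega
    zify
    apply mul_right_cancel₀ hq1
    linear_combination e1 + (Q : ℤ) ^ i * e2 - e2 - (Q : ℤ) ^ j * e1
  have hcomm : ∀ (a b : A) (i j : Fin n), Commute (F (a, i)) (F (b, j)) ↔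
      b ^ (Q ^ (i : ℕ) - 1) = a ^ (Q ^ (j : ℕ) - 1) := by
    intro a b i j
    have k1 : (1 : ℕ) ≤ Q ^ (i : ℕ) := Nat.one_le_pow _ _ hQ0
    have k2 : (1 : ℕ) ≤ Q ^ (j : ℕ) := Nat.one_le_pow _ _ hQ0
    have e1 : c (F (a, i) * F (b, j)) = (c a * c b * γ ^ (s i + s j * Q ^ (i : ℕ))) * c b ^ (Q ^ (i : ℕ) - 1) := by
      simp only [F]
      rw [hagh a a.2, hag b b.2, mul_pow, ← pow_mul, pow_add]
      nth_rw 1 [← Nat.sub_add_cancel k1]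
      rw [pow_succ]
      simp only [mul_assoc, mul_left_comm, mul_comm]
    have e2 : c (F (b, j) * F (a, i)) = (c a * c b * γ ^ (s i + s j * Q ^ (i : ℕ))) * c a ^ (Q ^ (j : ℕ) - 1) := by
      rw [hs2]
      simp only [F]
      rw [hagh b b.2, hag a a.2, mul_pow, ← pow_mul, pow_add]
      nth_rw 1 [← Nat.sub_add_cancel k2]
      rw [pow_succ]
      simp only [mul_assoc, mul_left_comm, mul_comm]
    rw [commute_iff_eq, ← hc.eq_iff, e1, e2, mul_right_inj, ← hfa, ← hfa, ← map_pow, ← map_pow, hf.eq_iff]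
  let e : {q : G × G // Commute q.1 q.2} ≃
      Σ ij : Fin n × Fin n, {q : A × A // q.2 ^ (Q ^ (ij.1 : ℕ) - 1) = q.1 ^ (Q ^ (ij.2 : ℕ) - 1)} :=
    (((Equiv.ofBijective F hFb).prodCongr (Equiv.ofBijective F hFb)).subtypeEquiv
      (p := fun q => Commute (F q.1) (F q.2)) (q := fun q => Commute q.1 q.2) (fun q => Iff.rfl)).symm.trans
    { toFun := fun q => ⟨(q.1.1.2, q.1.2.2), ⟨(q.1.1.1, q.1.2.1), (hcomm _ _ _ _).mp q.2⟩⟩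
      invFun := fun r => ⟨((r.2.1.1, r.1.1), (r.2.1.2, r.1.2)), (hcomm _ _ _ _).mpr r.2.2⟩
      left_inv := fun _ => rfl
      right_inv := fun _ => rfl }
  have hcount := card_comm_eq_card_conjClasses_mul_card G
  rw [Nat.card_congr e, Nat.card_sigma, hGU] at hcount
  have hgcd : ∀ i j : ℕ, Nat.gcd m' (Nat.gcd (Q ^ i - 1) (Q ^ j - 1)) =
      Nat.gcd m' (Q ^ (Nat.gcd n (Nat.gcd i j)) - 1) := by
    intro i j
    rw [Nat.pow_sub_one_gcd_pow_sub_one, ← Nat.pow_sub_one_gcd_pow_sub_one Q n]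
    rw [← Nat.gcd_assoc, Nat.gcd_eq_left (m := m') (n := Q ^ n - 1) ⟨n, by rw [hm, mul_comm]⟩]
  have hterm : ∀ ij : Fin n × Fin n,
      ((Nat.card {q : A × A // q.2 ^ (Q ^ (ij.1 : ℕ) - 1) = q.1 ^ (Q ^ (ij.2 : ℕ) - 1)} : ℕ) : ℚ) =
      m' * (((Q : ℚ) ^ (Nat.gcd n (Nat.gcd ij.1 ij.2)) - 1) / (Nat.gcd n (Nat.gcd ij.1 ij.2) : ℕ)) := by
    intro ij
    rw [cyc_pairs, ← hm', hgcd]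
    have hg := gcd_main hQ h1 hn hm (Nat.gcd_dvd_left n (Nat.gcd ij.1 ij.2))
    have hp0 : 0 < Nat.gcd n (Nat.gcd ij.1 ij.2) := Nat.gcd_pos_of_pos_left _ (Nat.pos_of_ne_zero hn)
    generalize Nat.gcd n (Nat.gcd ij.1 ij.2) = t at *
    have hg' : ((Nat.gcd m' (Q ^ t - 1) : ℕ) : ℚ) * t = (Q : ℚ) ^ t - 1 := by
      have := congrArg (Nat.cast : ℕ → ℚ) hg
      rw [Nat.cast_mul, Nat.cast_sub (Nat.one_le_pow _ _ hQ0)] at this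
      simpa using this
    rw [Nat.cast_mul, ← hg', mul_div_cancel_right₀]
    exact_mod_cast hp0.ne'
  have hcount2 := congrArg (Nat.cast : ℕ → ℚ) hcount
  rw [Nat.cast_sum, Finset.sum_congr rfl (fun ij _ => hterm ij), ← Finset.mul_sum,
    Fintype.sum_prod_type] at hcount2
  have hsum := sum_J2_pairs hn (fun t => ((Q : ℚ) ^ t - 1) / (t : ℚ))
  rw [Finset.sum_product, Finset.sum_range] at hsum
  simp only [Finset.sum_range] at hsum
  rw [hsum, hm] at hcount2
  push_cast at hcount2
  have hn' : (n : ℚ) ≠ 0 := by exact_mod_cast hn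
  have hm'' : (m' : ℚ) ≠ 0 := by exact_mod_cast hm'0.ne'
  have hfin : ∑ e ∈ n.divisors, ((Q : ℚ) ^ e - 1) / ((n : ℚ) * (e : ℚ)) * J2 (n / e) =
      (∑ e ∈ n.divisors, ((Q : ℚ) ^ e - 1) / (e : ℚ) * J2 (n / e)) / n := by
    rw [Finset.sum_div]
    apply Finset.sum_congr rfl
    intro e _
    rw [mul_comm (n : ℚ), ← div_div]; ring
  rw [hfin, eq_div_iff hn']
  apply mul_left_cancel₀ hm''
  rw [hcount2]; ring


/-- The conclusion (i) of the main theorem. -/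
def AltI (p d c : ℕ) : Prop :=
  ∃ n k : ℕ, d = n * k ∧
      (∀ ℓ : ℕ, ℓ.Prime → ℓ ∣ n → ℓ ∣ p ^ k - 1) ∧
      (4 ∣ n → 4 ∣ p ^ k - 1) ∧
      (c : ℚ) =
        ∑ e ∈ n.divisors, ((p : ℚ) ^ (e * k) - 1) / ((n : ℚ) * (e : ℚ)) * J2 (n / e) ∧
      (n = 1 → c = p ^ d - 1) ∧
      (1 < n → ((p : ℚ) ^ k - 1) * (Nat.totient n : ℚ) + ((p : ℚ) ^ d - 1) / (n : ℚ) ^ 2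
          < (c : ℚ))

lemma dim_one_arith {q m r n a : ℕ} (hq : m < q) (hm : 0 < m) (hr : r ≠ 0) (hn : n ≤ m)
    (ha : a ≤ q - 1) (h : q ^ r - 1 = a * n) : r = 1 := by
  by_contra hcon
  have hr2 : 2 ≤ r := by omega
  have h1 : q ^ 2 ≤ q ^ r := Nat.pow_le_pow_right (by omega) hr2
  have h2 : a * n ≤ (q - 1) * m := Nat.mul_le_mul ha hn
  have h3 : (q - 1) * m ≤ (q - 1) * (q - 1) := Nat.mul_le_mul_left _ (by omega)
  obtain ⟨t, rfl⟩ : ∃ t, q = t + 1 := ⟨q - 1, by omega⟩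
  simp only [Nat.add_sub_cancel] at *
  have h4 : (t + 1) ^ 2 = t * t + 2 * t + 1 := by ring
  omega

theorem F_two {p d : ℕ} {G V K : Type*} [Group G] [AddCommGroup V] [Module (ZMod p) V]
    {σ : G →* Module.End (ZMod p) V} [Fact p.Prime] [Finite V] [Nontrivial V] (h : Reg σ)
    (hd : d ≠ 0) (hV : Nat.card V = p ^ d) (A : Subgroup G)
    [Field K] [Finite K] [Algebra (ZMod p) K] [Module K V]
    (φ : G →* (K ≃ₐ[ZMod p] K)) (hφ : ∀ g (x : K) (v : V), σ g (x • v) = φ g x • σ g v)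
    (hφA : ∀ g, φ g = 1 ↔ g ∈ A) (hA : ∀ a ∈ A, ∃ x : K, ∀ v, σ a v = x • v) :
    AltI p d (Nat.card (ConjClasses G)) := by
  classical
  have hp : p.Prime := Fact.out
  have hG := h.finite
  have hfd : FiniteDimensional (ZMod p) K := inferInstance
  set m := Module.finrank (ZMod p) K with hm
  have hKc : Nat.card K = p ^ m := by
    have h1 := Module.natCard_eq_pow_finrank (K := ZMod p) (V := K)
    rwa [Nat.card_zmod] at h1
  have hm0 : 0 < m := Module.finrank_pos
  have hGal : Nat.card (K ≃ₐ[ZMod p] K) = m := IsGalois.card_aut_eq_finrank (ZMod p) K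
  have hker : φ.ker = A := by
    ext g; rw [MonoidHom.mem_ker, hφA]
  set n := A.index with hn
  have hrange : Nat.card φ.range = n := by rw [hn, ← hker, Subgroup.index_ker]
  have hnm : n ∣ m := by rw [← hrange, ← hGal]; exact Subgroup.card_subgroup_dvd_card _
  have hn0 : n ≠ 0 := by rintro h0; rw [h0] at hnm; exact hm0.ne' (zero_dvd_iff.mp hnm)
  obtain ⟨v0, hv0⟩ := exists_ne (0 : V)
  have hsm : ∀ x y : K, x • v0 = y • v0 → x = y := fun x y e => smul_left_injective K hv0 e
  have hAc : Nat.card A ≤ Nat.card K - 1 := by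
    choose! f hf using hA
    have h1 : Nat.card A ≤ Nat.card Kˣ := by
      have hne : ∀ a : A, f a ≠ 0 := by
        intro a h0
        have := hf a a.2 v0
        rw [h0, zero_smul] at this
        exact sigma_ne σ hv0 _ this
      apply Nat.card_le_card_of_injective (fun a : A => Units.mk0 (f a) (hne a))
      intro a b hab
      have hab' : f a = f b := by simpa using congrArg Units.val hab
      apply Subtype.ext
      apply h.inj hv0
      rw [hf a a.2, hf b b.2, hab']
    rwa [Nat.card_units] at h1
  have hVK : Nat.card V = Nat.card K ^ Module.finrank K V := Module.natCard_eq_pow_finrank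
  have hGc : Nat.card G = p ^ d - 1 := by rw [h.card, hV]
  have hAn : p ^ d - 1 = Nat.card A * n := by rw [← hGc, hn, A.card_mul_index]
  have hr1 : Module.finrank K V = 1 := by
    apply dim_one_arith (q := Nat.card K) (m := m) (n := n) (a := Nat.card A)
    · rw [hKc]; exact Nat.lt_pow_self hp.one_lt
    · exact hm0
    · exact (Module.finrank_pos (R := K) (M := V)).ne'
    · exact Nat.le_of_dvd hm0 hnm
    · exact hAc
    · rw [← hVK, hV, hAn]
  rw [hr1, pow_one] at hVK
  have hmd : m = d := by
    rw [hV, hKc] at hVK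
    exact (Nat.pow_right_injective hp.two_le hVK).symm
  obtain ⟨k, hk⟩ := hnm
  have hk0 : k ≠ 0 := by rintro rfl; omega
  have hbij : Function.Bijective (fun x : K => x • v0) :=
    (Nat.bijective_iff_injective_and_card _).mpr ⟨hsm, hVK.symm⟩
  have hex : ∀ g, ∃ x : Kˣ, σ g v0 = (x : K) • v0 := by
    intro g
    obtain ⟨x, hx⟩ := hbij.2 (σ g v0)
    have hx0 : x ≠ 0 := by
      rintro rfl
      simp only [zero_smul] at hx
      exact sigma_ne σ hv0 g hx.symm
    exact ⟨Units.mk0 x hx0, hx.symm⟩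
  choose c hc using hex
  have hcinj : Function.Injective c := by
    intro g g' e
    apply h.inj hv0
    rw [hc, hc, e]
  have hcm : ∀ g h', (c (g * h') : K) = c g * φ g (c h') := by
    intro g h'
    apply hsm
    rw [← hc, map_mul, Module.End.mul_apply, hc h', hφ, hc g, smul_smul, mul_comm]
  -- Frobenius
  let Fr := FiniteField.frobeniusAlgEquivOfAlgebraic (ZMod p) K
  have hFro : orderOf Fr = m := FiniteField.orderOf_frobeniusAlgEquivOfAlgebraic (ZMod p) K
  have hFrp : ∀ (j : ℕ) (x : K), (Fr ^ j) x = x ^ p ^ j := by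
    intro j x
    rw [AlgEquiv.coe_pow]
    have := congrFun (FiniteField.coe_frobeniusAlgEquivOfAlgebraic_iterate (ZMod p) K j) x
    rwa [ZMod.card] at this
  have hFko : orderOf (Fr ^ k) = n := by
    rw [orderOf_pow, hFro, hk, Nat.gcd_mul_left_left, Nat.mul_div_cancel _ (Nat.pos_of_ne_zero hk0)]
  have hFkm : Fr ^ k ∈ φ.range := by
    obtain ⟨y, hy⟩ := (Subgroup.isCyclic_iff_exists_zpowers_eq_top φ.range).mp inferInstance
    have hyo : orderOf y = n := by rw [← Nat.card_zpowers, hy, hrange]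
    rw [← hy]
    apply cyc_mem
    rw [hyo, ← hFko, pow_orderOf_eq_one]
  have hzr : Subgroup.zpowers (Fr ^ k) = φ.range := by
    apply Subgroup.eq_of_le_of_card_ge
    · rwa [Subgroup.zpowers_le]
    · rw [Nat.card_zpowers, hFko, hrange]
  obtain ⟨g0, hg0⟩ := hFkm
  have hQ : 1 < p ^ k := Nat.one_lt_pow hk0 hp.one_lt
  have hQn : (p ^ k) ^ n = p ^ d := by rw [← pow_mul, ← hmd, hk, mul_comm]
  have hmain := nf_count (G := G) (U := Kˣ) hQ hn0 A g0 c hcinj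
    (by rw [Nat.card_units, hQn, ← hVK, hV]) (by rw [hGc, hQn]) hn.symm
    (by
      intro g
      have hg : φ g ∈ Subgroup.zpowers (Fr ^ k) := by rw [hzr]; exact ⟨g, rfl⟩
      rw [mem_zpowers_iff_mem_range_orderOf, Finset.mem_image] at hg
      obtain ⟨j, hj, hj2⟩ := hg
      rw [hFko, Finset.mem_range] at hj
      refine ⟨g * (g0 ^ j)⁻¹, ?_, j, hj, by group⟩
      rw [← hφA, map_mul, map_inv, map_pow, hg0, hj2, mul_inv_cancel])
    (by
      intro a ha h'
      apply Units.ext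
      rw [hcm, (hφA a).mpr ha]; rfl)
    (by
      intro h'
      apply Units.ext
      rw [hcm, hg0, hFrp]; rfl)
  obtain ⟨h1, h4, hcl⟩ := hmain
  refine ⟨n, k, by rw [← hmd, hk], h1, h4, ?_, ?_, ?_⟩
  · rw [hcl]
    apply Finset.sum_congr rfl
    intro e _
    rw [mul_comm e k, pow_mul]; push_cast; rfl
  · intro hn1
    rw [hn1] at hcl hQn
    rw [pow_one] at hQn
    simp only [Nat.divisors_one, Finset.sum_singleton, Nat.div_one, J2_one, pow_one, Nat.cast_one,
      mul_one, div_one] at hcl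
    have : (Nat.card (ConjClasses G) : ℚ) = ((p ^ d - 1 : ℕ) : ℚ) := by
      rw [hcl, hQn, Nat.cast_sub (Nat.one_le_pow _ _ hp.pos)]; simp
    exact_mod_cast this
  · intro hn1
    have := final_ineq hn1 hQ
    rw [← hcl] at this
    have e1 : (((p ^ k : ℕ) : ℚ)) ^ n = (p : ℚ) ^ d := by exact_mod_cast hQn
    rw [e1] at this
    push_cast at this
    exact this


section FieldPart
variable {p : ℕ} {G V : Type*} [Group G] [AddCommGroup V] [Module (ZMod p) V]

/-- The algebra spanned by `A`. -/
def algA (σ : G →* Module.End (ZMod p) V) (A : Subgroup G) :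
    Subalgebra (ZMod p) (Module.End (ZMod p) V) :=
  Algebra.adjoin (ZMod p) (σ '' (A : Set G))

lemma algA_conj (σ : G →* Module.End (ZMod p) V) (A : Subgroup G) (hN : A.Normal) (g : G)
    (s : Module.End (ZMod p) V) (hs : s ∈ algA σ A) : σ g * s * σ g⁻¹ ∈ algA σ A := by
  have hgg : σ g⁻¹ * σ g = 1 := by rw [← map_mul, inv_mul_cancel, map_one]
  have hgg' : σ g * σ g⁻¹ = 1 := by rw [← map_mul, mul_inv_cancel, map_one]
  unfold algA at hs ⊢
  induction hs using Algebra.adjoin_induction with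
  | mem x hx =>
    obtain ⟨a, ha, rfl⟩ := hx
    rw [← map_mul, ← map_mul]
    exact Algebra.subset_adjoin ⟨_, hN.conj_mem a ha g, rfl⟩
  | algebraMap r =>
    rw [← Algebra.commutes, mul_assoc, hgg', mul_one]
    exact Subalgebra.algebraMap_mem _ r
  | add x y _ _ hx hy =>
    rw [mul_add, add_mul]; exact add_mem hx hy
  | mul x y _ _ hx hy =>
    have : σ g * (x * y) * σ g⁻¹ = (σ g * x * σ g⁻¹) * (σ g * y * σ g⁻¹) := by
      calc σ g * (x * y) * σ g⁻¹ = σ g * x * 1 * y * σ g⁻¹ := by simp only [mul_assoc, one_mul]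
        _ = _ := by rw [← hgg]; simp only [mul_assoc]
    rw [this]; exact mul_mem hx hy

lemma algA_comm (σ : G →* Module.End (ZMod p) V) (A : Subgroup G)
    (hA : ∀ x ∈ A, ∀ y ∈ A, x * y = y * x) (s t : Module.End (ZMod p) V)
    (hs : s ∈ algA σ A) (ht : t ∈ algA σ A) : s * t = t * s := by
  have h1 : ∀ a ∈ A, ∀ s ∈ algA σ A, s * σ a = σ a * s := by
    intro a ha s hs
    unfold algA at hs
    induction hs using Algebra.adjoin_induction with
    | mem x hx =>
      obtain ⟨b, hb, rfl⟩ := hx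
      rw [← map_mul, ← map_mul, hA b hb a ha]
    | algebraMap r => exact Algebra.commutes _ _
    | add x y _ _ hx hy => rw [mul_add, add_mul, hx, hy]
    | mul x y _ _ hx hy => rw [mul_assoc, hy, ← mul_assoc, hx, mul_assoc]
  unfold algA at ht
  induction ht using Algebra.adjoin_induction with
  | mem x hx =>
    obtain ⟨b, hb, rfl⟩ := hx
    exact h1 b hb s hs
  | algebraMap r => exact (Algebra.commutes _ _).symm
  | add x y _ _ hx hy => rw [mul_add, add_mul, hx, hy]
  | mul x y _ _ hx hy => rw [← mul_assoc, hx, mul_assoc, hy, mul_assoc]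

/-- The cyclic module generated by `v`. -/
def orb (σ : G →* Module.End (ZMod p) V) (A : Subgroup G) (v : V) : Set V :=
  {w | ∃ s ∈ algA σ A, s v = w}

lemma algA_inj [Finite V] {σ : G →* Module.End (ZMod p) V} (h : Reg σ) (A : Subgroup G) (hN : A.Normal)
    (hA : ∀ x ∈ A, ∀ y ∈ A, x * y = y * x) (s : Module.End (ZMod p) V) (hs : s ∈ algA σ A)
    (hs0 : s ≠ 0) (v : V) (hv : s v = 0) : v = 0 := by
  have hgg : ∀ g v, σ g⁻¹ (σ g v) = v := by
    intro g v; rw [← Module.End.mul_apply, ← map_mul, inv_mul_cancel, map_one]; rfl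
  have hgg' : ∀ g v, σ g (σ g⁻¹ v) = v := by
    intro g v; rw [← Module.End.mul_apply, ← map_mul, mul_inv_cancel, map_one]; rfl
  have hself : ∀ v, v ∈ orb σ A v := fun v => ⟨1, one_mem _, rfl⟩
  have himg : ∀ g v, σ g '' (orb σ A v) ⊆ orb σ A (σ g v) := by
    rintro g v _ ⟨_, ⟨s, hs, rfl⟩, rfl⟩
    refine ⟨σ g * s * σ g⁻¹, algA_conj σ A hN g s hs, ?_⟩
    rw [Module.End.mul_apply, Module.End.mul_apply, hgg]
  have hinj : ∀ g, Function.Injective (σ g) := by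
    intro g x y e
    rw [← hgg g x, e, hgg]
  have hle : ∀ g v, (orb σ A v).ncard ≤ (orb σ A (σ g v)).ncard := by
    intro g v
    rw [← Set.ncard_image_of_injective _ (hinj g)]
    exact Set.ncard_le_ncard (himg g v) (Set.toFinite _)
  have heq : ∀ v w, v ≠ 0 → w ≠ 0 → (orb σ A v).ncard = (orb σ A w).ncard := by
    intro v w hv hw
    obtain ⟨g, rfl⟩ := h.trans v w hv hw
    apply le_antisymm (hle g v)
    have := hle g⁻¹ (σ g v)
    rwa [hgg] at this
  have hsub : ∀ v w, w ∈ orb σ A v → orb σ A w ⊆ orb σ A v := by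
    rintro v _ ⟨s, hs, rfl⟩ _ ⟨t, ht, rfl⟩
    exact ⟨t * s, mul_mem ht hs, rfl⟩
  have hsim : ∀ v w, v ≠ 0 → w ≠ 0 → w ∈ orb σ A v → v ∈ orb σ A w := by
    intro v w hv hw hm
    have : orb σ A w = orb σ A v :=
      Set.eq_of_subset_of_ncard_le (hsub v w hm) (heq v w hv hw).le (Set.toFinite _)
    rw [this]; exact hself v
  by_contra hv0
  obtain ⟨w, hw⟩ : ∃ w, s w ≠ 0 := by
    by_contra hcon
    push Not at hcon
    exact hs0 (LinearMap.ext hcon)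
  have hw0 : w ≠ 0 := by rintro rfl; exact hw (map_zero s)
  have hsvw : s (v + w) = s w := by rw [map_add, hv, zero_add]
  have hvw0 : v + w ≠ 0 := by
    intro h0; rw [h0, map_zero] at hsvw; exact hw hsvw.symm
  have m1 : v + w ∈ orb σ A (s w) := hsim _ _ hvw0 hw ⟨s, hs, hsvw⟩
  have m2 : v + w ∈ orb σ A w := hsub _ _ ⟨s, hs, rfl⟩ m1
  have m3 : v ∈ orb σ A w := by
    obtain ⟨t, ht, e⟩ := m2
    refine ⟨t - 1, sub_mem ht (one_mem _), ?_⟩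
    rw [LinearMap.sub_apply, e, Module.End.one_apply, add_sub_cancel_right]
  obtain ⟨t, ht, e⟩ := hsim _ _ hw0 hv0 m3
  apply hw
  rw [← e, ← Module.End.mul_apply, algA_comm σ A hA s t hs ht, Module.End.mul_apply, hv, map_zero]

end FieldPart

theorem partF {p d : ℕ} {G V : Type*} [Group G] [AddCommGroup V] [Module (ZMod p) V]
    {σ : G →* Module.End (ZMod p) V} [Fact p.Prime] [Finite V] [Nontrivial V] (h : Reg σ)
    (hd : d ≠ 0) (hV : Nat.card V = p ^ d) (A : Subgroup G) (hN : A.Normal)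
    (hA : ∀ x ∈ A, ∀ y ∈ A, x * y = y * x) (hC : ∀ x, (∀ y ∈ A, x * y = y * x) → x ∈ A) :
    AltI p d (Nat.card (ConjClasses G)) := by
  have hfE : Finite (Module.End (ZMod p) V) := Finite.of_injective (fun f : Module.End (ZMod p) V => (f : V → V)) DFunLike.coe_injective
  have hnt : Nontrivial (algA σ A) := by
    refine ⟨⟨0, 1, fun e => ?_⟩⟩
    obtain ⟨v, hv⟩ := exists_ne (0 : V)
    have := congrArg (fun s : algA σ A => (s : Module.End (ZMod p) V) v) e
    exact hv this.symm
  have hnz : NoZeroDivisors (algA σ A) := by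
    refine ⟨fun {s t} e => ?_⟩
    by_cases hs : s = 0
    · exact Or.inl hs
    right
    apply Subtype.ext
    apply LinearMap.ext
    intro v
    apply algA_inj h A hN hA s s.2 (fun h0 => hs (Subtype.ext h0))
    have := congrArg (fun s : algA σ A => (s : Module.End (ZMod p) V) v) e
    exact this
  have hdom : IsDomain (algA σ A) := NoZeroDivisors.to_isDomain _
  let iF : Field (algA σ A) := IsField.toField (Finite.isDomain_to_isField (algA σ A))
  have hgg : ∀ g, σ g⁻¹ * σ g = 1 := fun g => by rw [← map_mul, inv_mul_cancel, map_one]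
  have hgg' : ∀ g, σ g * σ g⁻¹ = 1 := fun g => by rw [← map_mul, mul_inv_cancel, map_one]
  let ψ : G → (algA σ A ≃ₐ[ZMod p] algA σ A) := fun g =>
    { toFun := fun s => ⟨σ g * s * σ g⁻¹, algA_conj σ A hN g s s.2⟩
      invFun := fun s => ⟨σ g⁻¹ * s * σ g, by
        have := algA_conj σ A hN g⁻¹ s s.2
        rwa [inv_inv] at this⟩
      left_inv := fun s => Subtype.ext (by
        change σ g⁻¹ * (σ g * s * σ g⁻¹) * σ g = s
        calc σ g⁻¹ * (σ g * s * σ g⁻¹) * σ g = (σ g⁻¹ * σ g) * s * (σ g⁻¹ * σ g) := by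
              simp only [mul_assoc]
          _ = s := by rw [hgg, one_mul, mul_one])
      right_inv := fun s => Subtype.ext (by
        change σ g * (σ g⁻¹ * s * σ g) * σ g⁻¹ = s
        calc σ g * (σ g⁻¹ * s * σ g) * σ g⁻¹ = (σ g * σ g⁻¹) * s * (σ g * σ g⁻¹) := by
              simp only [mul_assoc]
          _ = s := by rw [hgg', one_mul, mul_one])
      map_mul' := fun x y => Subtype.ext (by
        change σ g * ((x : Module.End (ZMod p) V) * y) * σ g⁻¹ = (σ g * x * σ g⁻¹) * (σ g * y * σ g⁻¹)
        calc σ g * ((x : Module.End (ZMod p) V) * y) * σ g⁻¹ = σ g * x * 1 * y * σ g⁻¹ := by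
              simp only [mul_assoc, one_mul]
          _ = _ := by rw [← hgg g]; simp only [mul_assoc])
      map_add' := fun x y => Subtype.ext (by
        change σ g * ((x : Module.End (ZMod p) V) + y) * σ g⁻¹ = (σ g * x * σ g⁻¹) + (σ g * y * σ g⁻¹)
        rw [mul_add, add_mul])
      commutes' := fun r => Subtype.ext (by
        change σ g * algebraMap (ZMod p) (Module.End (ZMod p) V) r * σ g⁻¹ =
          algebraMap (ZMod p) (Module.End (ZMod p) V) r
        rw [← Algebra.commutes, mul_assoc, hgg', mul_one]) }
  have hψ : ∀ g s, ((ψ g s : algA σ A) : Module.End (ZMod p) V) = σ g * s * σ g⁻¹ := fun _ _ => rfl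
  let φ : G →* (algA σ A ≃ₐ[ZMod p] algA σ A) :=
    { toFun := ψ
      map_one' := by
        apply AlgEquiv.ext; intro s; apply Subtype.ext
        rw [hψ, inv_one, map_one, one_mul, mul_one]; rfl
      map_mul' := by
        intro g g'
        apply AlgEquiv.ext; intro s; apply Subtype.ext
        rw [AlgEquiv.mul_apply, hψ, hψ, hψ, mul_inv_rev, map_mul, map_mul]
        simp only [mul_assoc] }
  have hinj : Function.Injective σ := by
    obtain ⟨v, hv⟩ := exists_ne (0 : V)
    intro g g' e
    apply h.inj hv
    rw [e]
  have hmem : ∀ a ∈ A, σ a ∈ algA σ A := fun a ha => Algebra.subset_adjoin ⟨a, ha, rfl⟩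
  refine F_two (K := algA σ A) h hd hV A φ ?_ ?_ ?_
  · intro g x v
    change σ g ((x : Module.End (ZMod p) V) v) = (σ g * x * σ g⁻¹) (σ g v)
    rw [Module.End.mul_apply, Module.End.mul_apply, ← Module.End.mul_apply (σ g⁻¹), hgg]; rfl
  · intro g
    constructor
    · intro e
      apply hC
      intro a ha
      apply hinj
      have h1 : ψ g ⟨σ a, hmem a ha⟩ = ⟨σ a, hmem a ha⟩ := by
        have : ψ g = 1 := e
        rw [this]; rfl
      have h2 : σ g * σ a * σ g⁻¹ = σ a := congrArg Subtype.val h1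
      rw [map_mul, map_mul]
      nth_rw 2 [← h2]
      rw [mul_assoc (σ g * σ a), hgg, mul_one]
    · intro hg
      apply AlgEquiv.ext; intro s; apply Subtype.ext
      change σ g * s * σ g⁻¹ = s
      rw [algA_comm σ A hA (σ g) s (hmem g hg) s.2, mul_assoc, hgg', mul_one]
  · intro a ha
    exact ⟨⟨σ a, hmem a ha⟩, fun v => rfl⟩

/-- Zassenhaus' classification, in the form used for blocks with `k(B) - l(B) = 1`:
if `D` is elementary abelian of order `p^d` and `E ≤ Aut(D)` acts regularly
(transitively with trivial stabilizers) on `D ∖ {1}`, then either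
(i) there is a factorization `d = nk` with every prime divisor of `n` dividing
`p^k - 1`, with `4 ∣ p^k - 1` whenever `4 ∣ n`, and
`k(E) = ∑_{e ∣ n} ((p^{ek} - 1)/(ne))·J₂(n/e)`; in this case `k(E) = p^d - 1` if
`n = 1` and `k(E) > (p^k - 1)·φ(n) + (p^d - 1)/n²` if `n > 1`; or
(ii) `(p^d, k(E))` is one of the seven exceptional pairs
`(5²,7), (7²,8), (11²,9), (11²,35), (23²,88), (29²,63), (59²,261)`. -/
theorem zassenhaus_regular_automorphism_classes
    (p d : ℕ) (hp : p.Prime) (hd : 1 ≤ d)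
    (D : Type*) [CommGroup D] (hcard : Nat.card D = p ^ d)
    (hel : ∀ x : D, x ^ p = 1)
    (E : Subgroup (MulAut D))
    (htrans : ∀ x y : D, x ≠ 1 → y ≠ 1 → ∃ φ ∈ E, φ x = y)
    (hfree : ∀ φ ∈ E, φ ≠ 1 → ∀ x : D, φ x = x → x = 1) :
    (∃ n k : ℕ, d = n * k ∧
      (∀ ℓ : ℕ, ℓ.Prime → ℓ ∣ n → ℓ ∣ p ^ k - 1) ∧
      (4 ∣ n → 4 ∣ p ^ k - 1) ∧
      (Nat.card (ConjClasses E) : ℚ) =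
        ∑ e ∈ n.divisors, ((p : ℚ) ^ (e * k) - 1) / ((n : ℚ) * (e : ℚ)) * J2 (n / e) ∧
      (n = 1 → Nat.card (ConjClasses E) = p ^ d - 1) ∧
      (1 < n → ((p : ℚ) ^ k - 1) * (Nat.totient n : ℚ) + ((p : ℚ) ^ d - 1) / (n : ℚ) ^ 2
          < (Nat.card (ConjClasses E) : ℚ))) ∨
    ((p ^ d = 5 ^ 2 ∧ Nat.card (ConjClasses E) = 7) ∨
     (p ^ d = 7 ^ 2 ∧ Nat.card (ConjClasses E) = 8) ∨
     (p ^ d = 11 ^ 2 ∧ Nat.card (ConjClasses E) = 9) ∨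
     (p ^ d = 11 ^ 2 ∧ Nat.card (ConjClasses E) = 35) ∨
     (p ^ d = 23 ^ 2 ∧ Nat.card (ConjClasses E) = 88) ∨
     (p ^ d = 29 ^ 2 ∧ Nat.card (ConjClasses E) = 63) ∨
     (p ^ d = 59 ^ 2 ∧ Nat.card (ConjClasses E) = 261)) := by
  have hfp : Fact p.Prime := ⟨hp⟩
  have hd0 : d ≠ 0 := by omega
  have hfin : Finite D := Nat.finite_of_card_ne_zero (by rw [hcard]; exact pow_ne_zero _ hp.ne_zero)
  have hfinV : Finite (Additive D) := hfin
  have hntD : Nontrivial D := by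
    rw [← Finite.one_lt_card_iff_nontrivial, hcard]; exact Nat.one_lt_pow hd0 hp.one_lt
  have hntV : Nontrivial (Additive D) := hntD
  let iM : Module (ZMod p) (Additive D) := AddCommGroup.zmodModule (n := p) (fun x => hel x.toMul)
  let σ : E →* Module.End (ZMod p) (Additive D) :=
    { toFun := fun g => (MonoidHom.toAdditive (g : MulAut D).toMonoidHom).toZModLinearMap p
      map_one' := rfl
      map_mul' := fun _ _ => rfl }
  have hσ : ∀ (g : E) (x : D), σ g (Additive.ofMul x) = Additive.ofMul ((g : MulAut D) x) :=
    fun _ _ => rfl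
  have hReg : Reg σ := by
    constructor
    · intro v w hv hw
      obtain ⟨φ, hφ, e⟩ := htrans v.toMul w.toMul hv hw
      exact ⟨⟨φ, hφ⟩, congrArg Additive.ofMul e⟩
    · intro g hg v e
      have := hfree g g.2 (fun h0 => hg (Subtype.ext h0)) v.toMul (congrArg Additive.toMul e)
      exact congrArg Additive.ofMul this
  have hV : Nat.card (Additive D) = p ^ d := hcard
  rcases partE hReg hd0 hV with h2 | ⟨A, hN, hA, hC⟩
  · subst h2
    rcases d_two hReg hV with ⟨A, hN, hA, hC⟩ | hex
    · exact Or.inl (partF hReg hd0 hV A hN hA hC)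
    · right
      rcases hex with ⟨rfl, h⟩ | ⟨rfl, h⟩ | ⟨rfl, h⟩ | ⟨rfl, h⟩ | ⟨rfl, h⟩ | ⟨rfl, h⟩ | ⟨rfl, h⟩ <;>
        simp [h]
  · exact Or.inl (partF hReg hd0 hV A hN hA hC)
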